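/- There exist constants 0 < c_1 ≤ c_2 and T_0 such that for all T ≥ T_0, c_1 · T (log T)^{1/4} ≤ −I_−(T) ≤ c_2 · T (log T)^{1/4}, i.e. −I_−(T) is of exact order T (log T)^{1/4}. -/

import Mathlib

open MeasureTheory

/-- The phase factor `e^{iθ(t)} = π^{-it/2} Γ(1/4+it/2)/|Γ(1/4+it/2)|`. -/
noncomputable def eTheta (t : ℝ) : ℂ :=
  (Real.pi : ℂ) ^ (-(Complex.I * (t : ℂ)) / 2) *
    (Complex.Gamma (1 / 4 + Complex.I * (t : ℂ) / 2) /
      ‖Complex.Gamma (1 / 4 + Complex.I * (t : ℂ) / 2)‖)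

/-- Hardy's function `Z(t) = e^{iθ(t)} ζ(1/2+it)` (a real number for real `t`). -/
noncomputable def HardyZ (t : ℝ) : ℝ :=
  (eTheta t * riemannZeta (1 / 2 + Complex.I * (t : ℂ))).re

/-- `I₋(T) = ∫_{t ∈ (T,2T], Z(t)<0} Z(t) dt`. -/
noncomputable def Iminus (T : ℝ) : ℝ :=
  ∫ t in {t : ℝ | t ∈ Set.Ioc T (2 * T) ∧ HardyZ t < 0}, HardyZ t

namespace HardyMoment

open MeasureTheory Set Filter Topology Complex

lemma integrable_of_norm_le_div {f : ℝ → ℂ} (hf : Continuous f) {C : ℝ}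
    (h : ∀ t, ‖f t‖ ≤ C / (1 + t ^ 2)) : Integrable f := by
  have : Integrable (fun t : ℝ => C * (1 + t ^ 2)⁻¹) := integrable_inv_one_add_sq.const_mul C
  exact this.mono' hf.aestronglyMeasurable (Eventually.of_forall fun t => by
    simpa [div_eq_mul_inv] using h t)

lemma differentiable_integral_translate {f : ℂ → ℂ} (hf : Differentiable ℂ f) {φ : ℝ → ℂ}
    (hφ : Measurable φ) (hφ1 : ∀ t, ‖φ t‖ ≤ 1) (a b : ℝ) :
    Differentiable ℂ (fun z : ℂ => ∫ t in Icc a b, f (z + t * I) * φ t) := by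
  intro z₀
  have hf' : Continuous (deriv f) := (hf.contDiff (n := 1)).continuous_deriv le_rfl
  have hK : IsCompact ((fun p : ℂ × ℝ => deriv f (p.1 + p.2 * I)) ''
      (Metric.closedBall z₀ 1 ×ˢ Icc a b)) :=
    ((isCompact_closedBall z₀ 1).prod isCompact_Icc).image (by fun_prop)
  obtain ⟨M, hM⟩ := hK.isBounded.exists_norm_le
  have hmeas : ∀ (g : ℂ → ℂ) (_ : Continuous g) (z : ℂ),
      AEStronglyMeasurable (fun t : ℝ => g (z + t * I) * φ t) (volume.restrict (Icc a b)) := by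
    intro g hg z
    exact ((by fun_prop : Continuous fun t : ℝ => g (z + t * I)).aestronglyMeasurable).mul
      hφ.aestronglyMeasurable
  have hInt : IntegrableOn (fun t : ℝ => f (z₀ + t * I) * φ t) (Icc a b) := by
    have hc : IntegrableOn (fun t : ℝ => f (z₀ + t * I)) (Icc a b) :=
      (by have := hf.continuous; fun_prop : Continuous fun t : ℝ => f (z₀ + t * I)).integrableOn_Icc
    exact hc.mul_bdd hφ.aestronglyMeasurable (Eventually.of_forall hφ1)
  refine (hasDerivAt_integral_of_dominated_loc_of_deriv_le (μ := volume.restrict (Icc a b))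
    (F := fun z t => f (z + t * I) * φ t) (F' := fun z t => deriv f (z + t * I) * φ t)
    (bound := fun _ => M) (Metric.ball_mem_nhds z₀ one_pos)
    (Eventually.of_forall fun z => hmeas f hf.continuous z) hInt (hmeas _ hf' z₀) ?_ ?_ ?_).2.differentiableAt
  · refine (ae_restrict_iff' measurableSet_Icc).2 (Eventually.of_forall fun t ht z hz => ?_)
    rw [norm_mul]
    have h1 := hM _ ⟨(z, t), ⟨Metric.ball_subset_closedBall hz, ht⟩, rfl⟩
    have := hφ1 t
    nlinarith [norm_nonneg (deriv f (z + t * I)), norm_nonneg (φ t)]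
  · exact integrable_const _
  · refine Eventually.of_forall fun t z _ => ?_
    have h1 : HasDerivAt (fun z : ℂ => f (z + t * I)) (deriv f (z + t * I)) z := by
      exact (hf (z + t * I)).hasDerivAt.comp_add_const z (t * I)
    exact h1.mul_const _

/-- Log-convexity in `σ` of the mean value of `‖f (σ + it)‖` over vertical lines. -/
theorem integral_norm_le_interp {f : ℂ → ℂ} (hf : Differentiable ℂ f) {l u C : ℝ} (hlu : l < u)
    (hC : ∀ z : ℂ, l ≤ z.re → z.re ≤ u → ‖f z‖ ≤ C / (1 + z.im ^ 2)) {σ : ℝ} (hl : l ≤ σ)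
    (hu : σ ≤ u) :
    ∫ t : ℝ, ‖f (σ + t * I)‖ ≤ (∫ t : ℝ, ‖f (l + t * I)‖) ^ (1 - (σ - l) / (u - l)) *
      (∫ t : ℝ, ‖f (u + t * I)‖) ^ ((σ - l) / (u - l)) := by
  have hcont : ∀ x : ℝ, Continuous fun t : ℝ => f (x + t * I) := fun x => by
    have := hf.continuous; fun_prop
  have hInt : ∀ x : ℝ, l ≤ x → x ≤ u → Integrable fun t : ℝ => ‖f (x + t * I)‖ := by
    intro x h1 h2
    refine (integrable_of_norm_le_div (hcont x) (C := C) fun t => ?_).norm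
    simpa using hC (x + t * I) (by simpa using h1) (by simpa using h2)
  have hC0 : 0 ≤ C := by
    have := (norm_nonneg _).trans (hC l (by simp) (by simpa using hlu.le))
    simpa using this
  set φ : ℝ → ℂ := fun t => (starRingEnd ℂ) (f (σ + t * I)) / ‖f (σ + t * I)‖ with hφ
  have hφm : Measurable φ := by
    have h1 := (hcont σ).measurable
    exact (Complex.continuous_conj.measurable.comp h1).div
      (Complex.measurable_ofReal.comp h1.norm)
  have hφ1 : ∀ t, ‖φ t‖ ≤ 1 := by
    intro t
    simp only [hφ, norm_div, RCLike.norm_conj, norm_real, norm_norm]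
    exact div_self_le_one _
  have hfφ : ∀ t : ℝ, f (σ + t * I) * φ t = (‖f (σ + t * I)‖ : ℂ) := by
    intro t
    simp only [hφ]
    rw [mul_div_assoc', Complex.mul_conj, Complex.normSq_eq_norm_sq]
    by_cases h : ‖f (σ + t * I)‖ = 0
    · simp [h]
    · push_cast; field_simp
  have hle : ∀ (x : ℝ), l ≤ x → x ≤ u → ∀ (a b y : ℝ),
      ‖∫ t in Icc a b, f ((x + y * I : ℂ) + t * I) * φ t‖ ≤ ∫ t : ℝ, ‖f (x + t * I)‖ := by
    intro x h1 h2 a b y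
    have hi : Integrable fun t : ℝ => ‖f (x + (t + y : ℝ) * I)‖ := (hInt x h1 h2).comp_add_right y
    calc _ ≤ ∫ t in Icc a b, ‖f ((x + y * I : ℂ) + t * I) * φ t‖ := norm_integral_le_integral_norm _
      _ ≤ ∫ t in Icc a b, ‖f (x + (t + y : ℝ) * I)‖ := by
        refine integral_mono_of_nonneg (Eventually.of_forall fun t => norm_nonneg _)
          hi.integrableOn (Eventually.of_forall fun t => ?_)
        have : (x + y * I : ℂ) + t * I = x + (t + y : ℝ) * I := by push_cast; ring
        simp only [this, norm_mul]
        exact mul_le_of_le_one_right (norm_nonneg _) (hφ1 t)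
      _ ≤ ∫ t : ℝ, ‖f (x + (t + y : ℝ) * I)‖ :=
        setIntegral_le_integral hi (Eventually.of_forall fun t => norm_nonneg _)
      _ = _ := integral_add_right_eq_self (fun t : ℝ => ‖f (x + t * I)‖) y
  have key : ∀ n : ℕ, ∫ t in Icc (-(n : ℝ)) n, ‖f (σ + t * I)‖ ≤
      (∫ t : ℝ, ‖f (l + t * I)‖) ^ (1 - (σ - l) / (u - l)) *
      (∫ t : ℝ, ‖f (u + t * I)‖) ^ ((σ - l) / (u - l)) := by
    intro n
    have hd := differentiable_integral_translate hf hφm hφ1 (-(n : ℝ)) n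
    have h3 := Complex.HadamardThreeLines.norm_le_interp_of_mem_verticalClosedStrip' hlu
      (f := fun z : ℂ => ∫ t in Icc (-(n : ℝ)) n, f (z + t * I) * φ t) (z := (σ : ℂ))
      (a := ∫ t : ℝ, ‖f (l + t * I)‖) (b := ∫ t : ℝ, ‖f (u + t * I)‖)
      (by simp [HadamardThreeLines.verticalClosedStrip, hl, hu]) hd.diffContOnCl ?_ ?_ ?_
    · simp only [ofReal_re] at h3
      refine le_trans (le_of_eq ?_) h3
      simp only [hfφ]
      rw [integral_complex_ofReal, Complex.norm_real, Real.norm_of_nonneg]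
      exact integral_nonneg fun t => norm_nonneg _
    · refine ⟨C * (2 * n), ?_⟩
      rintro _ ⟨z, hz, rfl⟩
      have hb : ∀ t ∈ Icc (-(n : ℝ)) n, ‖f (z + t * I) * φ t‖ ≤ C := by
        intro t _
        rw [norm_mul]
        have h1 := hC (z + t * I) (by simpa using hz.1) (by simpa using hz.2)
        have h2 : C / (1 + (z + t * I).im ^ 2) ≤ C :=
          div_le_self hC0 (by nlinarith [sq_nonneg (z + t * I).im])
        exact (mul_le_of_le_one_right (norm_nonneg _) (hφ1 t)).trans (h1.trans h2)
      have := norm_setIntegral_le_of_norm_le_const (μ := volume) (s := Icc (-(n : ℝ)) n)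
        (f := fun t : ℝ => f (z + t * I) * φ t) (C := C) (by simp) hb
      refine this.trans (le_of_eq ?_)
      rw [Real.volume_real_Icc_of_le (by linarith [n.cast_nonneg (α := ℝ)])]
      ring
    · intro z hz
      have : z = (l + z.im * I : ℂ) := by
        rw [← Complex.re_add_im z]; simp at hz; simp [hz]
      rw [this]; exact hle l le_rfl hlu.le _ _ _
    · intro z hz
      have : z = (u + z.im * I : ℂ) := by
        rw [← Complex.re_add_im z]; simp at hz; simp [hz]
      rw [this]; exact hle u hlu.le le_rfl _ _ _
  have hlim : Tendsto (fun n : ℕ => ∫ t in Icc (-(n : ℝ)) n, ‖f (σ + t * I)‖) atTop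
      (𝓝 (∫ t : ℝ, ‖f (σ + t * I)‖)) := by
    have h := tendsto_setIntegral_of_monotone (μ := volume) (s := fun n : ℕ => Icc (-(n : ℝ)) n)
      (f := fun t : ℝ => ‖f (σ + t * I)‖) (fun n => measurableSet_Icc)
      (fun m n hmn => Icc_subset_Icc (by simpa using hmn) (by simpa using hmn))
      (hInt σ hl hu).integrableOn
    have hU : ⋃ n : ℕ, Icc (-(n : ℝ)) n = univ := by
      refine eq_univ_of_forall fun x => mem_iUnion.2 ?_
      obtain ⟨n, hn⟩ := exists_nat_ge |x|
      exact ⟨n, abs_le.1 hn⟩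
    rwa [hU, setIntegral_univ] at h
  exact le_of_tendsto' hlim key

lemma exists_bound_of_strip {f : ℂ → ℂ} {l u C : ℝ}
    (hf : ∀ z : ℂ, l ≤ z.re → z.re ≤ u → ContinuousAt f z)
    (hC : ∀ z : ℂ, l ≤ z.re → z.re ≤ u → 1 ≤ |z.im| → ‖f z‖ ≤ C / (1 + z.im ^ 2)) :
    ∃ D : ℝ, ∀ z : ℂ, l ≤ z.re → z.re ≤ u → ‖f z‖ ≤ D / (1 + z.im ^ 2) := by
  have hK : IsCompact (Icc l u ×ℂ Icc (-1 : ℝ) 1) := isCompact_Icc.reProdIm isCompact_Icc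
  obtain ⟨M, hM⟩ := hK.exists_bound_of_continuousOn (f := f)
    (fun z hz => (hf z hz.1.1 hz.1.2).continuousWithinAt)
  refine ⟨max C (2 * M), fun z h1 h2 => ?_⟩
  rcases le_or_gt 1 |z.im| with h | h
  · exact (hC z h1 h2 h).trans (by gcongr; exact le_max_left _ _)
  · have h3 := hM z ⟨⟨h1, h2⟩, abs_le.1 h.le⟩
    have h4 : z.im ^ 2 ≤ 1 := by nlinarith [abs_le.1 h.le, sq_abs z.im, abs_nonneg z.im]
    rw [le_div_iff₀ (by positivity)]
    nlinarith [norm_nonneg (f z), le_max_right C (2 * M)]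

lemma integrable_line_of_strip {f : ℂ → ℂ} {l u C : ℝ}
    (hf : ∀ z : ℂ, l ≤ z.re → z.re ≤ u → ContinuousAt f z)
    (hC : ∀ z : ℂ, l ≤ z.re → z.re ≤ u → 1 ≤ |z.im| → ‖f z‖ ≤ C / (1 + z.im ^ 2)) {x : ℝ}
    (h1 : l ≤ x) (h2 : x ≤ u) : Integrable fun t : ℝ => f (x + t * I) := by
  obtain ⟨D, hD⟩ := exists_bound_of_strip hf hC
  refine integrable_of_norm_le_div (C := D) ?_ fun t => ?_
  · refine continuous_iff_continuousAt.2 fun t => ?_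
    have := hf (x + t * I) (by simpa using h1) (by simpa using h2)
    exact ContinuousAt.comp (f := fun t : ℝ => (x + t * I : ℂ)) this (by fun_prop)
  · simpa using hD (x + t * I) (by simpa using h1) (by simpa using h2)

/-- Moving the line of integration. -/
theorem integral_line_eq {f : ℂ → ℂ} {l u C : ℝ} (hlu : l ≤ u)
    (hf : ∀ z : ℂ, l ≤ z.re → z.re ≤ u → DifferentiableAt ℂ f z)
    (hC : ∀ z : ℂ, l ≤ z.re → z.re ≤ u → 1 ≤ |z.im| → ‖f z‖ ≤ C / (1 + z.im ^ 2)) :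
    ∫ t : ℝ, f (l + t * I) = ∫ t : ℝ, f (u + t * I) := by
  have hc : ∀ z : ℂ, l ≤ z.re → z.re ≤ u → ContinuousAt f z :=
    fun z h1 h2 => (hf z h1 h2).continuousAt
  have hnat : Tendsto (fun n : ℕ => (n : ℝ)) atTop atTop := tendsto_natCast_atTop_atTop
  have hl := intervalIntegral_tendsto_integral (integrable_line_of_strip hc hC le_rfl hlu)
    (tendsto_neg_atTop_atBot.comp hnat) hnat
  have hu := intervalIntegral_tendsto_integral (integrable_line_of_strip hc hC hlu le_rfl)
    (tendsto_neg_atTop_atBot.comp hnat) hnat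
  have hrect : ∀ n : ℕ, (∫ y in (-(n : ℝ))..n, f (u + y * I)) - (∫ y in (-(n : ℝ))..n, f (l + y * I))
      = I * ((∫ x in l..u, f (x + (-(n : ℝ) : ℝ) * I)) - ∫ x in l..u, f (x + (n : ℝ) * I)) := by
    intro n
    have h := Complex.integral_boundary_rect_eq_zero_of_differentiableOn f
      (l + (-(n : ℝ) : ℝ) * I) (u + (n : ℝ) * I) (by
        intro z hz
        have h1 := hz.1
        simp only [mem_preimage, add_re, ofReal_re, mul_re, I_re, mul_zero, ofReal_im, I_im, mul_one,
          sub_self, add_zero, uIcc_of_le hlu] at h1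
        exact (hf z h1.1 h1.2).differentiableWithinAt)
    simp only [add_re, ofReal_re, mul_re, I_re, mul_zero, ofReal_im, I_im, mul_one,
          sub_self, add_zero, add_im, mul_im, zero_add, smul_eq_mul] at h
    linear_combination (-I) * h + ((∫ y in (-(n : ℝ))..n, f (u + y * I)) -
      (∫ y in (-(n : ℝ))..n, f (l + y * I))) * I_mul_I
  have hbd : ∀ (n : ℕ) (s : ℝ), 1 ≤ n → |s| = n → ‖∫ x in l..u, f (x + s * I)‖ ≤
      C / (1 + (n : ℝ) ^ 2) * |u - l| := by
    intro n s hn hs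
    refine intervalIntegral.norm_integral_le_of_norm_le_const fun x hx => ?_
    rw [uIoc_of_le hlu] at hx
    have := hC (x + s * I) (by simpa using hx.1.le) (by simpa using hx.2)
      (by simp [hs]; exact_mod_cast hn)
    simpa [← sq_abs s, hs] using this
  have hlim : Tendsto (fun n : ℕ => I * ((∫ x in l..u, f (x + (-(n : ℝ) : ℝ) * I)) -
      ∫ x in l..u, f (x + (n : ℝ) * I))) atTop (𝓝 0) := by
    have h0 : Tendsto (fun n : ℕ => 2 * (C / (1 + (n : ℝ) ^ 2) * |u - l|)) atTop (𝓝 0) := by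
      have : Tendsto (fun n : ℕ => C / (1 + (n : ℝ) ^ 2)) atTop (𝓝 0) :=
        tendsto_const_nhds.div_atTop (tendsto_atTop_add_const_left _ _
          ((tendsto_pow_atTop two_ne_zero).comp hnat))
      simpa using (this.mul_const |u - l|).const_mul 2
    refine squeeze_zero_norm' ?_ h0
    filter_upwards [eventually_ge_atTop 1] with n hn
    rw [norm_mul, norm_I, one_mul]
    refine (norm_sub_le _ _).trans ?_
    have h1 := hbd n (-(n : ℝ)) hn (by simp)
    have h2 := hbd n n hn (by simp)
    simp only [ofReal_natCast] at h1 h2 ⊢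
    linarith
  have h4 := hu.sub hl
  have h5 := tendsto_nhds_unique (h4.congr fun n => by simpa using hrect n) hlim
  exact (sub_eq_zero.1 h5).symm

lemma norm_mul_norm_add_one_rpow_le {w : ℂ} (hw : 0 < w.re) {η : ℝ} (h0 : 0 ≤ η) (h1 : η ≤ 1) :
    ‖w‖ * ‖w + 1‖ ^ η ≤ ‖w + η‖ * ‖w‖ ^ η * Real.exp (1 / (8 * ‖w‖ ^ 2)) := by
  have hw0 : w ≠ 0 := by rintro rfl; simp at hw
  have hq : 0 < ‖w‖ := norm_pos_iff.2 hw0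
  have e0 : ‖w‖ ^ 2 = w.re ^ 2 + w.im ^ 2 := by
    rw [← Complex.normSq_eq_norm_sq, Complex.normSq_apply]; ring
  have e1 : ‖w + 1‖ ^ 2 = ‖w‖ ^ 2 + 2 * w.re + 1 := by
    rw [e0, ← Complex.normSq_eq_norm_sq, Complex.normSq_apply]; simp; ring
  have e2 : ‖w + η‖ ^ 2 = ‖w‖ ^ 2 + 2 * η * w.re + η ^ 2 := by
    rw [e0, ← Complex.normSq_eq_norm_sq, Complex.normSq_apply]; simp; ring
  have hag := Real.geom_mean_le_arith_mean2_weighted h0 (sub_nonneg.2 h1)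
    (sq_nonneg ‖w + 1‖) (sq_nonneg ‖w‖) (by ring)
  have hpow : (‖w‖ * ‖w + 1‖ ^ η) ^ 2 = (‖w + 1‖ ^ 2) ^ η * (‖w‖ ^ 2) ^ (1 - η) * (‖w‖ ^ η) ^ 2 := by
    have a1 : (‖w + 1‖ ^ 2) ^ η = (‖w + 1‖ ^ η) ^ 2 := by
      rw [← Real.rpow_natCast, ← Real.rpow_natCast, ← Real.rpow_mul (norm_nonneg _),
        ← Real.rpow_mul (norm_nonneg _), mul_comm]
    have a2 : (‖w‖ ^ 2) ^ (1 - η) * (‖w‖ ^ η) ^ 2 = ‖w‖ ^ 2 := by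
      have : (‖w‖ ^ η) ^ 2 = (‖w‖ ^ 2) ^ η := by
        rw [← Real.rpow_natCast, ← Real.rpow_natCast, ← Real.rpow_mul (norm_nonneg _),
          ← Real.rpow_mul (norm_nonneg _), mul_comm]
      rw [this, ← Real.rpow_add (by positivity)]; simp
    rw [mul_assoc, a2, a1]; ring
  have hexp : (Real.exp (1 / (8 * ‖w‖ ^ 2))) ^ 2 = Real.exp (1 / (4 * ‖w‖ ^ 2)) := by
    rw [← Real.exp_nat_mul]; congr 1; push_cast; field_simp; norm_num
  have hex := Real.add_one_le_exp (1 / (4 * ‖w‖ ^ 2))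
  have hb : η * ‖w + 1‖ ^ 2 + (1 - η) * ‖w‖ ^ 2 ≤ ‖w + η‖ ^ 2 * (1 / (4 * ‖w‖ ^ 2) + 1) := by
    have h3 : ‖w‖ ^ 2 * (1 / (4 * ‖w‖ ^ 2)) = 1 / 4 := by field_simp
    have h4 : 0 ≤ 1 / (4 * ‖w‖ ^ 2) := by positivity
    rw [e1, e2]
    have h5 : 0 ≤ (2 * η * w.re + η ^ 2) * (1 / (4 * ‖w‖ ^ 2)) := by positivity
    nlinarith [sq_nonneg (η - 1 / 2)]
  refine le_of_sq_le_sq ?_ (by positivity)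
  rw [hpow, mul_pow, mul_pow, hexp]
  have hc : 0 ≤ (‖w‖ ^ η) ^ 2 := by positivity
  have : (‖w + 1‖ ^ 2) ^ η * (‖w‖ ^ 2) ^ (1 - η) ≤ ‖w + η‖ ^ 2 * Real.exp (1 / (4 * ‖w‖ ^ 2)) :=
    hag.trans (hb.trans (by gcongr))
  nlinarith

/-- `‖Γ (z + η)‖ ≪ ‖z‖ ^ η ‖Γ z‖`, uniformly for `re z ≥ 1 / 8` and `0 ≤ η ≤ 1`. -/
theorem exists_norm_Gamma_add_le : ∃ C : ℝ, 0 < C ∧ ∀ (z : ℂ) (η : ℝ), 1 / 8 ≤ z.re → 0 ≤ η →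
    η ≤ 1 → ‖Complex.Gamma (z + η)‖ ≤ C * ‖z‖ ^ η * ‖Complex.Gamma z‖ := by
  have hsum : Summable fun j : ℕ => 1 / (8 * ((1 : ℝ) / 8 + j) ^ 2) := by
    have h1 : Summable fun n : ℕ => 1 / |(n : ℝ) + 1 / 8| ^ (2 : ℝ) :=
      Real.summable_one_div_nat_add_rpow (1 / 8) 2 |>.2 (by norm_num)
    refine (h1.mul_left (1 / 8)).congr fun n => ?_
    rw [Real.rpow_two, sq_abs, add_comm]
    field_simp
  refine ⟨Real.exp (∑' j : ℕ, 1 / (8 * ((1 : ℝ) / 8 + j) ^ 2)), Real.exp_pos _, ?_⟩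
  intro z η hz h0 h1
  have hzj : ∀ j : ℕ, 1 / 8 + (j : ℝ) ≤ (z + j).re := fun j => by simpa using hz
  have hpos : ∀ j : ℕ, 0 < (z + j).re := fun j => by
    have h2 : (0 : ℝ) ≤ j := j.cast_nonneg
    linarith [hzj j]
  have hnz : ∀ j : ℕ, 0 < ‖z + j‖ := fun j => (hpos j).trans_le (Complex.re_le_norm _)
  have hnz' : ∀ j : ℕ, 0 < ‖z + η + j‖ := fun j => by
    refine lt_of_lt_of_le ?_ (Complex.re_le_norm _)
    have := hpos j
    simp at this ⊢; linarith
  have hprod : ∀ n : ℕ, (∏ j ∈ Finset.range n, ‖z + j‖) * ‖z + n‖ ^ η ≤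
      (∏ j ∈ Finset.range n, ‖z + η + j‖) * ‖z‖ ^ η *
        Real.exp (∑ j ∈ Finset.range n, 1 / (8 * ((1 : ℝ) / 8 + j) ^ 2)) := by
    intro n
    induction n with
    | zero => simp
    | succ n ih =>
      rw [Finset.prod_range_succ, Finset.prod_range_succ, Finset.sum_range_succ, Real.exp_add]
      have h := norm_mul_norm_add_one_rpow_le (hpos n) h0 h1
      have e : Real.exp (1 / (8 * ‖z + n‖ ^ 2)) ≤ Real.exp (1 / (8 * ((1 : ℝ) / 8 + n) ^ 2)) := by
        gcongr
        exact (hzj n).trans (Complex.re_le_norm _)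
      have h' : ‖z + n‖ * ‖z + (n + 1 : ℕ)‖ ^ η ≤
          ‖z + η + n‖ * ‖z + n‖ ^ η * Real.exp (1 / (8 * ((1 : ℝ) / 8 + n) ^ 2)) := by
        have a1 : z + (n + 1 : ℕ) = z + n + 1 := by push_cast; ring
        have a2 : z + η + n = z + n + η := by ring
        rw [a1, a2]
        exact h.trans (by gcongr)
      set P := ∏ j ∈ Finset.range n, ‖z + j‖
      set Q := ∏ j ∈ Finset.range n, ‖z + η + j‖
      have hP : 0 ≤ P := Finset.prod_nonneg fun _ _ => norm_nonneg _
      calc P * ‖z + n‖ * ‖z + (n + 1 : ℕ)‖ ^ η = P * (‖z + n‖ * ‖z + (n + 1 : ℕ)‖ ^ η) := by ring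
        _ ≤ P * (‖z + η + n‖ * ‖z + n‖ ^ η * Real.exp (1 / (8 * ((1 : ℝ) / 8 + n) ^ 2))) := by gcongr
        _ = (P * ‖z + n‖ ^ η) * (‖z + η + n‖ * Real.exp (1 / (8 * ((1 : ℝ) / 8 + n) ^ 2))) := by ring
        _ ≤ (Q * ‖z‖ ^ η * Real.exp (∑ j ∈ Finset.range n, 1 / (8 * ((1 : ℝ) / 8 + j) ^ 2))) *
            (‖z + η + n‖ * Real.exp (1 / (8 * ((1 : ℝ) / 8 + n) ^ 2))) := by gcongr
        _ = _ := by ring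
  have hseq : ∀ (s : ℂ) (n : ℕ), 1 ≤ n → ‖Complex.GammaSeq s n‖ =
      (n : ℝ) ^ s.re * n.factorial / ∏ j ∈ Finset.range (n + 1), ‖s + j‖ := by
    intro s n hn
    rw [Complex.GammaSeq, norm_div, norm_mul, norm_prod,
      Complex.norm_natCast_cpow_of_pos (by omega), Complex.norm_natCast]
  refine le_of_tendsto_of_tendsto (Complex.GammaSeq_tendsto_Gamma (z + η)).norm
    ((Complex.GammaSeq_tendsto_Gamma z).norm.const_mul _) ?_
  filter_upwards [eventually_ge_atTop 1] with n hn
  rw [hseq _ _ hn, hseq _ _ hn]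
  have hp := hprod (n + 1)
  have hS : Real.exp (∑ j ∈ Finset.range (n + 1), 1 / (8 * ((1 : ℝ) / 8 + j) ^ 2)) ≤
      Real.exp (∑' j : ℕ, 1 / (8 * ((1 : ℝ) / 8 + j) ^ 2)) :=
    Real.exp_le_exp.2 (hsum.sum_le_tsum _ fun _ _ => by positivity)
  set K := Real.exp (∑' j : ℕ, 1 / (8 * ((1 : ℝ) / 8 + j) ^ 2))
  set P := ∏ j ∈ Finset.range (n + 1), ‖z + j‖ with hPdef
  set Q := ∏ j ∈ Finset.range (n + 1), ‖z + η + j‖ with hQdef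
  have hP : 0 < P := Finset.prod_pos fun j _ => hnz j
  have hQ : 0 < Q := Finset.prod_pos fun j _ => hnz' j
  have hn0 : (0 : ℝ) < n := by exact_mod_cast hn
  have hnn : (n : ℝ) ^ η ≤ ‖z + (n + 1 : ℕ)‖ ^ η := by
    gcongr
    have := hzj (n + 1)
    have h3 := Complex.re_le_norm (z + (n + 1 : ℕ))
    push_cast at this h3 ⊢
    linarith
  have hfin : P * (n : ℝ) ^ η ≤ Q * ‖z‖ ^ η * K :=
    calc P * (n : ℝ) ^ η ≤ P * ‖z + (n + 1 : ℕ)‖ ^ η := by gcongr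
      _ ≤ _ := hp
      _ ≤ _ := by gcongr
  have hre : (z + η).re = z.re + η := by simp
  rw [hre, Real.rpow_add hn0, div_le_iff₀ hQ]
  have : (n : ℝ) ^ z.re * n.factorial / P * P = (n : ℝ) ^ z.re * n.factorial := by field_simp
  set B := (n : ℝ) ^ z.re * n.factorial
  have hB : 0 ≤ B / P := by positivity
  calc (n : ℝ) ^ z.re * (n : ℝ) ^ η * n.factorial = B * (n : ℝ) ^ η := by ring
    _ = (B / P) * (P * (n : ℝ) ^ η) := by rw [← mul_assoc, this]
    _ ≤ (B / P) * (Q * ‖z‖ ^ η * K) := by gcongr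
    _ = _ := by ring

lemma norm_Gamma_half_add_sq (y : ℝ) :
    ‖Complex.Gamma (1 / 2 + y * I)‖ ^ 2 = Real.pi / Real.cosh (Real.pi * y) := by
  have h := Complex.Gamma_mul_Gamma_one_sub (1 / 2 + y * I)
  have h1 : (1 - (1 / 2 + y * I) : ℂ) = (starRingEnd ℂ) (1 / 2 + y * I) := by
    simp [Complex.ext_iff]; norm_num
  have h2 : Complex.sin (Real.pi * (1 / 2 + y * I)) = (Real.cosh (Real.pi * y) : ℝ) := by
    have : (Real.pi * (1 / 2 + y * I) : ℂ) = ((Real.pi * y : ℝ) : ℂ) * I + Real.pi / 2 := by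
      push_cast; ring
    rw [this, Complex.sin_add_pi_div_two, Complex.cos_mul_I, Complex.ofReal_cosh]
  rw [h1, Complex.Gamma_conj, Complex.mul_conj, h2, Complex.normSq_eq_norm_sq] at h
  exact_mod_cast h

lemma norm_Gamma_half_add_bounds (y : ℝ) :
    Real.exp (-(Real.pi * |y| / 2)) ≤ ‖Complex.Gamma (1 / 2 + y * I)‖ ∧
      ‖Complex.Gamma (1 / 2 + y * I)‖ ≤ 3 * Real.exp (-(Real.pi * |y| / 2)) := by
  have h := norm_Gamma_half_add_sq y
  have hpi := Real.pi_gt_three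
  have hpi4 := Real.pi_lt_four
  have hE : Real.exp (-(Real.pi * |y| / 2)) ^ 2 = Real.exp (-(Real.pi * |y|)) := by
    rw [← Real.exp_nat_mul]; congr 1; push_cast; ring
  have hc : Real.cosh (Real.pi * y) = (Real.exp (Real.pi * |y|) + Real.exp (-(Real.pi * |y|))) / 2 := by
    rw [← Real.cosh_eq, ← Real.cosh_abs (Real.pi * y), abs_mul, abs_of_pos Real.pi_pos]
  have hp := Real.exp_pos (Real.pi * |y|)
  have hprod : Real.exp (Real.pi * |y|) * Real.exp (-(Real.pi * |y|)) = 1 := by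
    rw [← Real.exp_add]; simp
  have hm := Real.exp_pos (-(Real.pi * |y|))
  have hle : Real.exp (-(Real.pi * |y|)) ≤ Real.exp (Real.pi * |y|) :=
    Real.exp_le_exp.2 (by have : 0 ≤ Real.pi * |y| := by positivity
                          linarith)
  constructor
  · refine le_of_sq_le_sq ?_ (norm_nonneg _)
    rw [h, hE, hc, le_div_iff₀ (by positivity)]
    nlinarith
  · refine le_of_sq_le_sq ?_ (by positivity)
    rw [h, mul_pow, hE, hc, div_le_iff₀ (by positivity)]
    nlinarith

lemma norm_GammaR (s : ℂ) : ‖Gammaℝ s‖ = Real.pi ^ (-s.re / 2) * ‖Complex.Gamma (s / 2)‖ := by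
  rw [Gammaℝ_def, norm_mul, Complex.norm_cpow_eq_rpow_re_of_pos Real.pi_pos]
  simp

lemma norm_GammaR_conj (s : ℂ) : ‖Gammaℝ ((starRingEnd ℂ) s)‖ = ‖Gammaℝ s‖ := by
  have : (starRingEnd ℂ) s / 2 = (starRingEnd ℂ) (s / 2) := by
    rw [map_div₀, Complex.conj_ofNat]
  rw [norm_GammaR, norm_GammaR, this, Complex.Gamma_conj]
  simp

/-- Comparison of `Gammaℝ` at points symmetric about the critical line. -/
theorem exists_norm_GammaR_half_add_le : ∃ C : ℝ, 0 < C ∧ ∀ (δ t : ℝ), 0 ≤ δ → δ ≤ 1 / 4 →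
    ‖Gammaℝ ((1 / 2 + δ : ℝ) + t * I)‖ ≤ C * (1 + |t|) ^ δ * ‖Gammaℝ ((1 / 2 - δ : ℝ) + t * I)‖ := by
  obtain ⟨C, hC, h⟩ := exists_norm_Gamma_add_le
  refine ⟨C, hC, fun δ t h0 h1 => ?_⟩
  set z : ℂ := ((1 / 2 - δ : ℝ) + t * I) / 2 with hz
  have hre : z.re = 1 / 4 - δ / 2 := by simp [hz]; ring
  have him : z.im = t / 2 := by simp [hz]
  have hzn : ‖z‖ ≤ 1 + |t| := by
    refine (Complex.norm_le_abs_re_add_abs_im z).trans ?_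
    rw [hre, him, abs_of_nonneg (by linarith), abs_div]
    have := abs_nonneg t
    norm_num; linarith
  have e : ((1 / 2 + δ : ℝ) + t * I : ℂ) / 2 = z + δ := by simp only [hz]; push_cast; ring
  rw [norm_GammaR, norm_GammaR, e, ← hz]
  have h2 := h z δ (by rw [hre]; linarith) h0 (by linarith)
  simp only [add_re, ofReal_re, mul_re, I_re, mul_zero, ofReal_im, I_im, mul_one, sub_self, add_zero]
  have hpi : Real.pi ^ (-(1 / 2 + δ) / 2) ≤ Real.pi ^ (-(1 / 2 - δ) / 2) :=
    Real.rpow_le_rpow_of_exponent_le (by linarith [Real.pi_gt_three]) (by linarith)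
  have hz' : ‖z‖ ^ δ ≤ (1 + |t|) ^ δ := by gcongr
  calc _ ≤ Real.pi ^ (-(1 / 2 - δ) / 2) * (C * ‖z‖ ^ δ * ‖Complex.Gamma z‖) := by gcongr
    _ ≤ Real.pi ^ (-(1 / 2 - δ) / 2) * (C * (1 + |t|) ^ δ * ‖Complex.Gamma z‖) := by gcongr
    _ = _ := by ring

/-- The size of `Gammaℝ` on the critical line. -/
theorem exists_norm_GammaR_half_bounds : ∃ c C : ℝ, 0 < c ∧ 0 < C ∧ ∀ t : ℝ,
    c * (1 + |t|) ^ (-(1 : ℝ) / 4) * Real.exp (-(Real.pi * |t| / 4)) ≤ ‖Gammaℝ (1 / 2 + t * I)‖ ∧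
    ‖Gammaℝ (1 / 2 + t * I)‖ ≤
      C * (1 + |t|) ^ (-(1 : ℝ) / 4) * Real.exp (-(Real.pi * |t| / 4)) := by
  obtain ⟨C, hC, h⟩ := exists_norm_Gamma_add_le
  refine ⟨Real.pi ^ (-(1 : ℝ) / 4) / C, Real.pi ^ (-(1 : ℝ) / 4) * (24 * C), by positivity,
    by positivity, fun t => ?_⟩
  have hG : ‖Gammaℝ (1 / 2 + t * I)‖ =
      Real.pi ^ (-(1 : ℝ) / 4) * ‖Complex.Gamma (1 / 4 + (t / 2 : ℝ) * I)‖ := by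
    rw [norm_GammaR]
    congr 2
    · simp; norm_num
    · congr 1; push_cast; ring
  set z : ℂ := 1 / 4 + (t / 2 : ℝ) * I with hz
  have hre : z.re = 1 / 4 := by simp [hz]
  have him : z.im = t / 2 := by simp [hz]
  have ht := abs_nonneg t
  have hzn : ‖z‖ ≤ 1 + |t| := by
    refine (Complex.norm_le_abs_re_add_abs_im z).trans ?_
    have h2 : |t / 2| = |t| / 2 := by rw [abs_div, abs_two]
    rw [hre, him, h2, abs_of_pos (by norm_num)]
    linarith
  have hzn' : (1 + |t|) / 8 ≤ ‖z‖ := by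
    have h1 := Complex.abs_re_le_norm z
    have h2 := Complex.abs_im_le_norm z
    rw [hre] at h1; rw [him, abs_div] at h2
    norm_num at h1 h2; linarith
  have hw : ‖(1 / 2 + (t / 2 : ℝ) * I : ℂ)‖ ≤ 1 + |t| := by
    refine (Complex.norm_le_abs_re_add_abs_im _).trans ?_
    simp [abs_div]; linarith
  have hb := norm_Gamma_half_add_bounds (t / 2)
  have hE : Real.pi * |t / 2| / 2 = Real.pi * |t| / 4 := by rw [abs_div]; norm_num; ring
  rw [hE] at hb
  set E := Real.exp (-(Real.pi * |t| / 4))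
  have hE0 : 0 < E := Real.exp_pos _
  have h1t : (0 : ℝ) < 1 + |t| := by linarith
  have hneg : (1 + |t|) ^ (-(1 : ℝ) / 4) = ((1 + |t|) ^ ((1 : ℝ) / 4))⁻¹ := by
    rw [neg_div, Real.rpow_neg h1t.le]
  rw [hG]
  constructor
  · have h2 := h z (1 / 4) (by rw [hre]; norm_num) (by norm_num) (by norm_num)
    have e : z + ((1 / 4 : ℝ) : ℂ) = 1 / 2 + (t / 2 : ℝ) * I := by
      simp only [hz]; push_cast; ring
    rw [e] at h2
    have h3 : E ≤ C * (1 + |t|) ^ ((1 : ℝ) / 4) * ‖Complex.Gamma z‖ :=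
      hb.1.trans (h2.trans (by gcongr))
    have h4 : ((1 + |t|) ^ ((1 : ℝ) / 4))⁻¹ * E ≤ C * ‖Complex.Gamma z‖ := by
      rw [inv_mul_le_iff₀ (by positivity)]
      linarith
    have h5 : Real.pi ^ (-(1 : ℝ) / 4) * (((1 + |t|) ^ ((1 : ℝ) / 4))⁻¹ * E) ≤
        Real.pi ^ (-(1 : ℝ) / 4) * (C * ‖Complex.Gamma z‖) := by gcongr
    rw [hneg, div_mul_eq_mul_div, div_mul_eq_mul_div, div_le_iff₀ hC]
    linarith
  · have h2 := h (1 / 2 + (t / 2 : ℝ) * I) (3 / 4) (by simp; norm_num) (by norm_num) (by norm_num)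
    have e : (1 / 2 + (t / 2 : ℝ) * I : ℂ) + ((3 / 4 : ℝ) : ℂ) = z + 1 := by
      simp only [hz]; push_cast; ring
    have hz0 : z ≠ 0 := by intro h0; rw [h0] at hre; simp at hre
    rw [e, Complex.Gamma_add_one z hz0, norm_mul] at h2
    have h3 : ‖z‖ * ‖Complex.Gamma z‖ ≤ C * (1 + |t|) ^ ((3 : ℝ) / 4) * (3 * E) :=
      h2.trans (by gcongr; exact hb.2)
    have h4 : (1 + |t|) / 8 * ‖Complex.Gamma z‖ ≤ C * (1 + |t|) ^ ((3 : ℝ) / 4) * (3 * E) :=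
      le_trans (by gcongr) h3
    have h5 : (1 + |t|) ^ ((3 : ℝ) / 4) = (1 + |t|) * (1 + |t|) ^ (-(1 : ℝ) / 4) := by
      rw [← Real.rpow_one_add' h1t.le (by norm_num)]; norm_num
    rw [h5] at h4
    rw [mul_assoc, mul_assoc]
    refine mul_le_mul_of_nonneg_left ?_ (by positivity)
    have : (1 + |t|) * ‖Complex.Gamma z‖ ≤
        (1 + |t|) * (24 * C * ((1 + |t|) ^ (-(1 : ℝ) / 4) * E)) := by linarith
    exact le_of_mul_le_mul_left this h1t

/-- The factor turning `ζ` into the Dirichlet eta function. -/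
noncomputable def etaFactor (s : ℂ) : ℂ := 1 - 2 ^ (1 - s)

/-- The Dirichlet eta function, as an entire function. -/
noncomputable def etaFun (s : ℂ) : ℂ := dslope etaFactor 1 s * riemannZeta₁ s

lemma differentiable_etaFactor : Differentiable ℂ etaFactor := by
  unfold etaFactor
  intro s
  refine DifferentiableAt.const_sub ?_ _
  exact DifferentiableAt.const_cpow (by fun_prop) (Or.inl two_ne_zero)

lemma differentiable_etaFun : Differentiable ℂ etaFun := by
  have h : Differentiable ℂ (dslope etaFactor 1) := by
    rw [← differentiableOn_univ, Complex.differentiableOn_dslope univ_mem]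
    exact differentiable_etaFactor.differentiableOn
  exact h.mul differentiable_riemannZeta₁

lemma etaFun_eq {s : ℂ} (hs : s ≠ 1) : etaFun s = etaFactor s * riemannZeta s := by
  rw [etaFun, dslope_of_ne _ hs, riemannZeta_eq_inv_sub_mul hs, slope_def_field]
  have : etaFactor 1 = 0 := by simp [etaFactor]
  rw [this, sub_zero]
  ring

lemma norm_etaFactor_le {s : ℂ} (hs : 0 ≤ s.re) : ‖etaFactor s‖ ≤ 3 := by
  have h : ‖(2 : ℂ) ^ (1 - s)‖ ≤ 2 := by
    have := Complex.norm_cpow_eq_rpow_re_of_pos (x := 2) two_pos (1 - s)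
    push_cast at this
    rw [this]
    calc (2 : ℝ) ^ (1 - s).re ≤ 2 ^ (1 : ℝ) :=
          Real.rpow_le_rpow_of_exponent_le (by norm_num) (by simpa using hs)
      _ = 2 := by simp
  calc _ ≤ ‖(1 : ℂ)‖ + ‖(2 : ℂ) ^ (1 - s)‖ := norm_sub_le _ _
    _ ≤ 3 := by rw [norm_one]; linarith

lemma le_norm_etaFactor {s : ℂ} (hs : s.re ≤ 3 / 4) : 1 / 10 ≤ ‖etaFactor s‖ := by
  have h : 11 / 10 ≤ ‖(2 : ℂ) ^ (1 - s)‖ := by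
    have := Complex.norm_cpow_eq_rpow_re_of_pos (x := 2) two_pos (1 - s)
    push_cast at this
    rw [this]
    calc (11 / 10 : ℝ) ≤ 2 ^ (1 / 4 : ℝ) := by
          rw [Real.le_rpow_iff_log_le (by norm_num) (by norm_num), ← Real.log_rpow (by norm_num)]
          have h4 : (11 / 10 : ℝ) ^ (4 : ℝ) ≤ 2 := by
            rw [show (4 : ℝ) = (4 : ℕ) by norm_num, Real.rpow_natCast]; norm_num
          have h5 := Real.log_le_log (by positivity) h4
          rw [Real.log_rpow (by norm_num)] at h5
          rw [Real.log_rpow (by norm_num)]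
          linarith
      _ ≤ _ := Real.rpow_le_rpow_of_exponent_le (by norm_num) (by simp; linarith)
  have := norm_sub_norm_le ((2 : ℂ) ^ (1 - s)) 1
  rw [norm_one] at this
  rw [etaFactor, norm_sub_rev]
  linarith

lemma norm_cpow_neg_sub_le {s : ℂ} (hs : 0 < s.re) {x : ℝ} (hx : 0 < x) :
    ‖((x : ℂ)) ^ (-s) - ((x + 1 : ℝ) : ℂ) ^ (-s)‖ ≤ ‖s‖ * x ^ (-s.re - 1) := by
  have hs0 : -s ≠ 0 := by
    intro h
    rw [neg_eq_zero] at h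
    simp [h] at hs
  have h := Convex.norm_image_sub_le_of_norm_hasDerivWithin_le (𝕜 := ℝ)
    (f := fun y : ℝ => (y : ℂ) ^ (-s)) (f' := fun y : ℝ => -s * (y : ℂ) ^ (-s - 1))
    (s := Icc x (x + 1)) (C := ‖s‖ * x ^ (-s.re - 1)) (x := x) (y := x + 1)
    (fun y hy => (hasDerivAt_ofReal_cpow_const (by linarith [hy.1]) hs0).hasDerivWithinAt)
    (fun y hy => ?_) (convex_Icc _ _) (by simp) (by simp)
  · rw [norm_sub_rev]
    simpa using h
  · have hy0 : 0 < y := hx.trans_le hy.1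
    rw [norm_mul, norm_neg, Complex.norm_cpow_eq_rpow_re_of_pos hy0]
    simp only [sub_re, neg_re, one_re]
    gcongr ?_ * ?_
    exact Real.rpow_le_rpow_of_nonpos hx hy.1 (by linarith)

/-- The paired terms of the Dirichlet eta series. -/
noncomputable def etaTerm (n : ℕ) (s : ℂ) : ℂ :=
  ((2 * n + 1 : ℝ) : ℂ) ^ (-s) - ((2 * n + 1 + 1 : ℝ) : ℂ) ^ (-s)

lemma differentiable_etaTerm (n : ℕ) : Differentiable ℂ (etaTerm n) := by
  intro s
  refine DifferentiableAt.sub ?_ ?_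
  · exact DifferentiableAt.const_cpow (by fun_prop) (Or.inl (by
      rw [Complex.ofReal_ne_zero]; positivity))
  · exact DifferentiableAt.const_cpow (by fun_prop) (Or.inl (by
      rw [Complex.ofReal_ne_zero]; positivity))

lemma norm_etaTerm_le (n : ℕ) {s : ℂ} (hs : 1 / 9 ≤ s.re) :
    ‖etaTerm n s‖ ≤ ‖s‖ * (2 * n + 1 : ℝ) ^ (-(10 : ℝ) / 9) := by
  refine (norm_cpow_neg_sub_le (by linarith) (by positivity)).trans ?_
  gcongr
  · have : (0 : ℝ) ≤ n := n.cast_nonneg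
    linarith
  · linarith

lemma summable_etaTerm_bound : Summable fun n : ℕ => (2 * n + 1 : ℝ) ^ (-(10 : ℝ) / 9) := by
  have h1 : Summable fun n : ℕ => 1 / |(n : ℝ) + 1 / 2| ^ ((10 : ℝ) / 9) :=
    Real.summable_one_div_nat_add_rpow (1 / 2) _ |>.2 (by norm_num)
  refine Summable.of_nonneg_of_le (fun n => by positivity) (fun n => ?_) h1
  rw [abs_of_pos (by positivity), neg_div, Real.rpow_neg (by positivity), one_div]
  have : (0 : ℝ) ≤ n := n.cast_nonneg
  gcongr
  · linarith
  · norm_num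

lemma etaFun_eq_tsum_of_one_lt {s : ℂ} (hs : 1 < s.re) : etaFun s = ∑' n, etaTerm n s := by
  have hs1 : s ≠ 1 := by rintro rfl; simp at hs
  have hs0 : s ≠ 0 := by rintro rfl; simp at hs; linarith
  have hsum : Summable fun n : ℕ => (n : ℂ) ^ (-s) := by
    refine (Complex.summable_one_div_nat_cpow.2 hs).congr fun n => ?_
    rw [Complex.cpow_neg, one_div]
  have hz : riemannZeta s = ∑' n : ℕ, (n : ℂ) ^ (-s) := by
    rw [zeta_eq_tsum_one_div_nat_cpow hs]
    refine tsum_congr fun n => ?_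
    rw [Complex.cpow_neg, one_div]
  have hsum1 : Summable fun n : ℕ => ((n + 1 : ℕ) : ℂ) ^ (-s) := (summable_nat_add_iff 1).2 hsum
  have hz1 : riemannZeta s = ∑' n : ℕ, ((n + 1 : ℕ) : ℂ) ^ (-s) := by
    rw [hz, hsum.tsum_eq_zero_add]
    simp [hs0]
  have he : Summable fun n : ℕ => ((2 * n + 1 : ℕ) : ℂ) ^ (-s) :=
    hsum1.comp_injective (i := fun n : ℕ => 2 * n) (fun a b h => by simpa using h)
  have ho : Summable fun n : ℕ => ((2 * n + 1 + 1 : ℕ) : ℂ) ^ (-s) :=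
    hsum1.comp_injective (i := fun n : ℕ => 2 * n + 1) (fun a b h => by simpa using h)
  have hsplit := tsum_even_add_odd (f := fun n : ℕ => ((n + 1 : ℕ) : ℂ) ^ (-s)) he ho
  have hodd : ∑' n : ℕ, ((2 * n + 1 + 1 : ℕ) : ℂ) ^ (-s) = 2 ^ (-s) * riemannZeta s := by
    rw [hz1, ← tsum_mul_left]
    refine tsum_congr fun n => ?_
    have : ((2 * n + 1 + 1 : ℕ) : ℂ) = ((2 : ℝ) : ℂ) * ((n + 1 : ℝ) : ℂ) := by push_cast; ring
    rw [this, Complex.mul_cpow_ofReal_nonneg (by norm_num) (by positivity)]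
    push_cast; rfl
  have ht : ∑' n, etaTerm n s = ∑' n : ℕ, ((2 * n + 1 : ℕ) : ℂ) ^ (-s) -
      ∑' n : ℕ, ((2 * n + 1 + 1 : ℕ) : ℂ) ^ (-s) := by
    rw [← he.tsum_sub ho]
    refine tsum_congr fun n => ?_
    simp [etaTerm]
  have h2 : (2 : ℂ) ^ (1 - s) = 2 * 2 ^ (-s) := by
    rw [sub_eq_add_neg, Complex.cpow_add _ _ two_ne_zero, Complex.cpow_one]
  rw [etaFun_eq hs1, ht, hodd, etaFactor, h2]
  rw [← hz1, hodd] at hsplit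
  linear_combination -hsplit

lemma etaFun_eq_tsum {s : ℂ} (hs : 1 / 8 ≤ s.re) : etaFun s = ∑' n, etaTerm n s := by
  set U : Set ℂ := {z | 1 / 9 < z.re} ∩ Metric.ball 0 (‖s‖ + 3) with hU
  have hUo : IsOpen U := (isOpen_lt continuous_const Complex.continuous_re).inter Metric.isOpen_ball
  have hUc : Convex ℝ U := (convex_halfSpace_re_gt _).inter (convex_ball _ _)
  have hd : DifferentiableOn ℂ (fun z => ∑' n, etaTerm n z) U := by
    refine Complex.differentiableOn_tsum_of_summable_norm
      (u := fun n : ℕ => (‖s‖ + 3) * (2 * n + 1 : ℝ) ^ (-(10 : ℝ) / 9))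
      (summable_etaTerm_bound.mul_left _) (fun n => (differentiable_etaTerm n).differentiableOn)
      hUo fun n z hz => ?_
    refine (norm_etaTerm_le n hz.1.le).trans ?_
    have := hz.2
    rw [Metric.mem_ball, dist_zero_right] at this
    gcongr
  have h2 : (2 : ℂ) ∈ U := by
    refine ⟨by norm_num, ?_⟩
    rw [Metric.mem_ball, dist_zero_right]
    have : ‖(2 : ℂ)‖ = 2 := by simp
    rw [this]; linarith [norm_nonneg s]
  have hsU : s ∈ U := by
    refine ⟨lt_of_lt_of_le (by norm_num) hs, ?_⟩
    rw [Metric.mem_ball, dist_zero_right]; linarith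
  refine AnalyticOnNhd.eqOn_of_preconnected_of_eventuallyEq
    (differentiable_etaFun.differentiableOn.analyticOnNhd hUo) (hd.analyticOnNhd hUo)
    hUc.isPreconnected h2 ?_ hsU
  filter_upwards [(isOpen_lt continuous_const Complex.continuous_re).mem_nhds
    (show (1 : ℝ) < (2 : ℂ).re by norm_num)] with z hz
  exact etaFun_eq_tsum_of_one_lt hz

/-- Convexity-free polynomial bound for the eta function in the critical strip. -/
theorem exists_norm_etaFun_le : ∃ C : ℝ, 0 < C ∧ ∀ s : ℂ, 1 / 8 ≤ s.re →
    ‖etaFun s‖ ≤ C * ‖s‖ := by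
  refine ⟨∑' n : ℕ, (2 * n + 1 : ℝ) ^ (-(10 : ℝ) / 9),
    summable_etaTerm_bound.tsum_pos (fun n => by positivity) 0 (by positivity), fun s hs => ?_⟩
  rw [etaFun_eq_tsum hs, mul_comm]
  rw [← tsum_mul_left]
  exact tsum_of_norm_bounded (summable_etaTerm_bound.mul_left _).hasSum
    fun n => norm_etaTerm_le n (by linarith)

/-- The functional equation, as an inequality between symmetric points. -/
theorem exists_norm_etaFun_half_sub_le : ∃ C : ℝ, 0 < C ∧ ∀ δ t : ℝ, 0 ≤ δ → δ ≤ 1 / 4 →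
    ‖etaFun ((1 / 2 - δ : ℝ) + t * I)‖ ≤
      C * (1 + |t|) ^ δ * ‖etaFun ((1 / 2 + δ : ℝ) + t * I)‖ := by
  obtain ⟨C, hC, h⟩ := exists_norm_GammaR_half_add_le
  refine ⟨30 * C, by positivity, fun δ t h0 h1 => ?_⟩
  set s : ℂ := (1 / 2 - δ : ℝ) + t * I with hs
  set w : ℂ := (1 / 2 + δ : ℝ) + t * I with hw
  have hsre : s.re = 1 / 2 - δ := by simp [hs]
  have hwre : w.re = 1 / 2 + δ := by simp [hw]
  have hs1 : s ≠ 1 := by intro h; rw [h] at hsre; simp at hsre; linarith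
  have hw1 : w ≠ 1 := by intro h; rw [h] at hwre; simp at hwre; linarith
  have hs0 : s ≠ 0 := by intro h; rw [h] at hsre; simp at hsre; linarith
  have hw0 : w ≠ 0 := by intro h; rw [h] at hwre; simp at hwre; linarith
  have hws : (starRingEnd ℂ) w = 1 - s := by
    simp [hs, hw, Complex.ext_iff]; ring
  have hcw0 : (starRingEnd ℂ) w ≠ 0 := by simpa using hw0
  have hGs : Gammaℝ s ≠ 0 := Gammaℝ_ne_zero_of_re_pos (by rw [hsre]; linarith)
  have hGw : Gammaℝ ((starRingEnd ℂ) w) ≠ 0 :=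
    Gammaℝ_ne_zero_of_re_pos (by rw [Complex.conj_re, hwre]; linarith)
  have e1 : Gammaℝ s * riemannZeta s = completedRiemannZeta s := by
    rw [riemannZeta_def_of_ne_zero hs0]; field_simp
  have e2 : Gammaℝ ((starRingEnd ℂ) w) * riemannZeta ((starRingEnd ℂ) w) =
      completedRiemannZeta s := by
    rw [riemannZeta_def_of_ne_zero hcw0, ← completedRiemannZeta_one_sub s, ← hws]; field_simp
  have e3 : ‖Gammaℝ s‖ * ‖riemannZeta s‖ = ‖Gammaℝ w‖ * ‖riemannZeta w‖ := by
    rw [← norm_mul, e1, ← e2, norm_mul, norm_GammaR_conj, riemannZeta_conj, Complex.norm_conj]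
  have hz : ‖riemannZeta s‖ ≤ C * (1 + |t|) ^ δ * ‖riemannZeta w‖ := by
    refine le_of_mul_le_mul_left ?_ (norm_pos_iff.2 hGs)
    rw [e3]
    calc ‖Gammaℝ w‖ * ‖riemannZeta w‖ ≤ (C * (1 + |t|) ^ δ * ‖Gammaℝ s‖) * ‖riemannZeta w‖ := by
          gcongr; exact h δ t h0 h1
      _ = _ := by ring
  rw [etaFun_eq hs1, etaFun_eq hw1, norm_mul, norm_mul]
  have p1 := norm_etaFactor_le (s := s) (by rw [hsre]; linarith)
  have p2 := le_norm_etaFactor (s := w) (by rw [hwre]; linarith)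
  calc ‖etaFactor s‖ * ‖riemannZeta s‖ ≤ (30 * ‖etaFactor w‖) * (C * (1 + |t|) ^ δ * ‖riemannZeta w‖) := by
        gcongr; linarith
    _ = _ := by ring

/-- The coefficients of `(1 - x) ^ (-1 / 2)`. -/
noncomputable def sqrtCoeff (a : ℕ) : ℝ := (Nat.centralBinom a : ℝ) / 4 ^ a

lemma sqrtCoeff_zero : sqrtCoeff 0 = 1 := by simp [sqrtCoeff]

lemma sqrtCoeff_succ (a : ℕ) : (a + 1 : ℝ) * sqrtCoeff (a + 1) = (a + 1 / 2) * sqrtCoeff a := by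
  have h : ((a + 1 : ℕ) : ℝ) * (Nat.centralBinom (a + 1) : ℝ) =
      2 * (2 * a + 1) * Nat.centralBinom a := by
    exact_mod_cast Nat.succ_mul_centralBinom_succ a
  push_cast at h
  rw [sqrtCoeff, sqrtCoeff, pow_succ, mul_div_assoc', h]
  field_simp
  ring

lemma sqrtCoeff_one : sqrtCoeff 1 = 1 / 2 := by
  have h := sqrtCoeff_succ 0
  rw [sqrtCoeff_zero] at h
  norm_num at h ⊢
  exact h

lemma sqrtCoeff_nonneg (a : ℕ) : 0 ≤ sqrtCoeff a := by unfold sqrtCoeff; positivity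

lemma sqrtCoeff_succ_le (a : ℕ) : sqrtCoeff (a + 1) ≤ sqrtCoeff a := by
  have h := sqrtCoeff_succ a
  have h0 := sqrtCoeff_nonneg a
  have ha : (0 : ℝ) < a + 1 := by positivity
  nlinarith

lemma sqrtCoeff_antitone : Antitone sqrtCoeff := antitone_nat_of_succ_le sqrtCoeff_succ_le

lemma sqrtCoeff_le_one (a : ℕ) : sqrtCoeff a ≤ 1 :=
  sqrtCoeff_zero ▸ sqrtCoeff_antitone (Nat.zero_le a)

lemma sqrtCoeff_two : sqrtCoeff 2 = 3 / 8 := by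
  have h := sqrtCoeff_succ 1
  rw [sqrtCoeff_one] at h
  norm_num at h ⊢
  linarith

lemma sum_sqrtCoeff_mul (n : ℕ) :
    ∑ p ∈ Finset.HasAntidiagonal.antidiagonal n, sqrtCoeff p.1 * sqrtCoeff p.2 = 1 := by
  set F : PowerSeries ℝ := PowerSeries.mk sqrtCoeff with hF
  have hode : (2 : ℝ) • PowerSeries.derivative ℝ F =
      (2 : ℝ) • (PowerSeries.X * PowerSeries.derivative ℝ F) + F := by
    ext n
    cases n with
    | zero =>
      simp [PowerSeries.coeff_derivative, hF, sqrtCoeff_one, sqrtCoeff_zero,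
        PowerSeries.coeff_zero_X_mul, -PowerSeries.coeff_zero_eq_constantCoeff]
    | succ n =>
      simp only [map_add, PowerSeries.coeff_smul, PowerSeries.coeff_succ_X_mul,
        PowerSeries.coeff_derivative, hF, PowerSeries.coeff_mk, smul_eq_mul]
      have h := sqrtCoeff_succ (n + 1)
      push_cast at h ⊢
      linarith
  have hG : PowerSeries.derivative ℝ (F * F) =
      PowerSeries.X * PowerSeries.derivative ℝ (F * F) + F * F := by
    rw [Derivation.leibniz]
    simp only [smul_eq_mul]
    have : F * ((2 : ℝ) • PowerSeries.derivative ℝ F) =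
      F * ((2 : ℝ) • (PowerSeries.X * PowerSeries.derivative ℝ F) + F) := by rw [hode]
    simp only [two_smul] at this
    linear_combination this
  have key : ∀ n, PowerSeries.coeff n (F * F) = 1 := by
    intro n
    induction n with
    | zero => simp [PowerSeries.coeff_mul, hF, sqrtCoeff_zero, -PowerSeries.coeff_zero_eq_constantCoeff]
    | succ n ih =>
      have h := congrArg (PowerSeries.coeff n) hG
      cases n with
      | zero =>
        rw [map_add, PowerSeries.coeff_zero_X_mul, PowerSeries.coeff_derivative, ih] at h
        simpa using h
      | succ n =>
        simp only [map_add, PowerSeries.coeff_succ_X_mul, PowerSeries.coeff_derivative, ih] at h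
        push_cast at h
        have h2 : ((n : ℝ) + 1 + 1) ≠ 0 := by positivity
        have : PowerSeries.coeff (n + 1 + 1) (F * F) * ((n : ℝ) + 1 + 1) = 1 * ((n : ℝ) + 1 + 1) := by
          rw [h]; ring
        exact mul_right_cancel₀ h2 this
  have := key n
  rw [PowerSeries.coeff_mul] at this
  simpa [hF] using this

/-- The coefficients of the Dirichlet series of `ζ ^ (1 / 2)`. -/
noncomputable def sqrtZetaFun (n : ℕ) : ℝ :=
  if n = 0 then 0 else n.factorization.prod fun _ a => sqrtCoeff a

/-- `sqrtZetaFun` as an arithmetic function. -/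
noncomputable def sqrtZeta : ArithmeticFunction ℝ := ⟨sqrtZetaFun, by simp [sqrtZetaFun]⟩

lemma sqrtZeta_apply {n : ℕ} (hn : n ≠ 0) :
    sqrtZeta n = n.factorization.prod fun _ a => sqrtCoeff a := by
  simp [sqrtZeta, sqrtZetaFun, hn]

lemma sqrtZeta_isMultiplicative : sqrtZeta.IsMultiplicative := by
  rw [ArithmeticFunction.IsMultiplicative.iff_ne_zero]
  refine ⟨by simp [sqrtZeta_apply], fun {m n} hm hn h => ?_⟩
  rw [sqrtZeta_apply hm, sqrtZeta_apply hn, sqrtZeta_apply (mul_ne_zero hm hn),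
    Nat.factorization_mul_of_coprime h, Finsupp.prod_add_index_of_disjoint]
  simpa using h.disjoint_primeFactors

lemma sqrtZeta_prime_pow {p : ℕ} (hp : p.Prime) (a : ℕ) : sqrtZeta (p ^ a) = sqrtCoeff a := by
  rw [sqrtZeta_apply (pow_ne_zero _ hp.ne_zero), hp.factorization_pow,
    Finsupp.prod_single_index sqrtCoeff_zero]

lemma sqrtZeta_nonneg (n : ℕ) : 0 ≤ sqrtZeta n := by
  rcases eq_or_ne n 0 with rfl | hn
  · simp
  · rw [sqrtZeta_apply hn]
    exact Finset.prod_nonneg fun _ _ => sqrtCoeff_nonneg _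

lemma sqrtZeta_le_one (n : ℕ) : sqrtZeta n ≤ 1 := by
  rcases eq_or_ne n 0 with rfl | hn
  · simp
  · rw [sqrtZeta_apply hn]
    exact Finset.prod_le_one (fun _ _ => sqrtCoeff_nonneg _) fun _ _ => sqrtCoeff_le_one _

lemma sqrtZeta_mul_self : sqrtZeta * sqrtZeta = (ArithmeticFunction.zeta : ArithmeticFunction ℝ) := by
  rw [ArithmeticFunction.IsMultiplicative.eq_iff_eq_on_prime_powers _
    (sqrtZeta_isMultiplicative.mul sqrtZeta_isMultiplicative) _
    ArithmeticFunction.isMultiplicative_zeta.natCast]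
  intro p a hp
  rw [ArithmeticFunction.mul_apply, Nat.sum_divisorsAntidiagonal (fun i j => sqrtZeta i * sqrtZeta j),
    Nat.sum_divisors_prime_pow hp, ArithmeticFunction.natCoe_apply,
    ArithmeticFunction.zeta_apply_ne (pow_ne_zero _ hp.ne_zero), Nat.cast_one,
    ← sum_sqrtCoeff_mul a, Finset.Nat.sum_antidiagonal_eq_sum_range_succ_mk]
  refine Finset.sum_congr rfl fun i hi => ?_
  have hi' : i ≤ a := by simpa [Nat.lt_succ_iff] using hi
  rw [Nat.pow_div hi' hp.pos, sqrtZeta_prime_pow hp, sqrtZeta_prime_pow hp]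

lemma summable_rpow_neg {s : ℝ} (hs : 1 < s) : Summable fun n : ℕ => (n : ℝ) ^ (-s) :=
  Real.summable_nat_rpow.2 (by linarith)

lemma natCast_prime_pow_rpow {p : ℕ} (e : ℕ) (s : ℝ) :
    (((p ^ e : ℕ) : ℝ)) ^ (-s) = ((p : ℝ) ^ (-s)) ^ e := by
  push_cast
  rw [← Real.rpow_natCast, ← Real.rpow_natCast, ← Real.rpow_mul (by positivity),
    ← Real.rpow_mul (by positivity), mul_comm]

lemma prime_rpow_neg_le {p : ℕ} (hp : p.Prime) {s : ℝ} (hs : 1 < s) :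
    0 < (p : ℝ) ^ (-s) ∧ (p : ℝ) ^ (-s) ≤ 1 / 2 := by
  have hp2 : (2 : ℝ) ≤ p := by exact_mod_cast hp.two_le
  refine ⟨by positivity, ?_⟩
  calc (p : ℝ) ^ (-s) ≤ (p : ℝ) ^ (-1 : ℝ) :=
        Real.rpow_le_rpow_of_exponent_le (by linarith) (by linarith)
    _ = (p : ℝ)⁻¹ := Real.rpow_neg_one _
    _ ≤ (2 : ℝ)⁻¹ := by gcongr
    _ = _ := by norm_num

lemma hasProd_zeta {s : ℝ} (hs : 1 < s) :
    HasProd (fun p : Nat.Primes => (1 - ((p : ℕ) : ℝ) ^ (-s))⁻¹) (∑' n : ℕ, (n : ℝ) ^ (-s)) := by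
  have h := EulerProduct.eulerProduct_hasProd (f := fun n : ℕ => (n : ℝ) ^ (-s)) (by simp)
    (fun {m n} _ => by push_cast; exact Real.mul_rpow (by positivity) (by positivity))
    ((summable_rpow_neg hs).congr fun n => by rw [Real.norm_of_nonneg (by positivity)])
    (by simp; rw [Real.zero_rpow (by linarith)])
  have e : (fun p : Nat.Primes => (1 - ((p : ℕ) : ℝ) ^ (-s))⁻¹) =
      fun p : Nat.Primes => ∑' e : ℕ, (((p : ℕ) ^ e : ℕ) : ℝ) ^ (-s) := by
    funext p
    have hp := prime_rpow_neg_le p.2 hs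
    rw [← tsum_geometric_of_lt_one hp.1.le (by linarith)]
    exact tsum_congr fun e => (natCast_prime_pow_rpow e s).symm
  rw [e]
  exact h

/-- The mean square Dirichlet series of `sqrtZeta`. -/
noncomputable def sqDirichlet (s : ℝ) : ℝ := ∑' n : ℕ, sqrtZeta n ^ 2 * (n : ℝ) ^ (-s)

lemma sqrtZeta_sq_le_one (n : ℕ) : sqrtZeta n ^ 2 ≤ 1 :=
  pow_le_one₀ (sqrtZeta_nonneg n) (sqrtZeta_le_one n)

lemma summable_sqDirichlet {s : ℝ} (hs : 1 < s) :
    Summable fun n : ℕ => sqrtZeta n ^ 2 * (n : ℝ) ^ (-s) :=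
  Summable.of_nonneg_of_le (fun n => by positivity)
    (fun n => mul_le_of_le_one_left (by positivity) (sqrtZeta_sq_le_one n)) (summable_rpow_neg hs)

lemma hasProd_sqDirichlet {s : ℝ} (hs : 1 < s) :
    HasProd (fun p : Nat.Primes => ∑' e : ℕ, sqrtCoeff e ^ 2 * (((p : ℕ) : ℝ) ^ (-s)) ^ e)
      (sqDirichlet s) := by
  have h := EulerProduct.eulerProduct_hasProd (f := fun n : ℕ => sqrtZeta n ^ 2 * (n : ℝ) ^ (-s))
    (by simp [sqrtZeta_isMultiplicative.map_one])
    (fun {m n} hmn => by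
      rw [sqrtZeta_isMultiplicative.map_mul_of_coprime hmn]
      push_cast
      rw [Real.mul_rpow (by positivity) (by positivity)]; ring)
    ((summable_sqDirichlet hs).congr fun n => by rw [Real.norm_of_nonneg (by positivity)])
    (by simp)
  have e : (fun p : Nat.Primes => ∑' e : ℕ, sqrtCoeff e ^ 2 * (((p : ℕ) : ℝ) ^ (-s)) ^ e) =
      fun p : Nat.Primes => ∑' e : ℕ, sqrtZeta ((p : ℕ) ^ e) ^ 2 * (((p : ℕ) ^ e : ℕ) : ℝ) ^ (-s) := by
    funext p
    exact tsum_congr fun e => by rw [natCast_prime_pow_rpow, sqrtZeta_prime_pow p.2]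
  rw [e]
  exact h

lemma localFactor_bounds {x : ℝ} (h0 : 0 ≤ x) (h1 : x ≤ 1 / 2) :
    1 + x / 4 ≤ ∑' e : ℕ, sqrtCoeff e ^ 2 * x ^ e ∧
      ∑' e : ℕ, sqrtCoeff e ^ 2 * x ^ e ≤ 1 + x / 4 + 9 / 32 * x ^ 2 := by
  have hg : Summable fun e : ℕ => x ^ e := summable_geometric_of_lt_one h0 (by linarith)
  have hs : Summable fun e : ℕ => sqrtCoeff e ^ 2 * x ^ e :=
    Summable.of_nonneg_of_le (fun n => by positivity)
      (fun n => mul_le_of_le_one_left (by positivity)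
        (pow_le_one₀ (sqrtCoeff_nonneg n) (sqrtCoeff_le_one n))) hg
  have hsplit := hs.sum_add_tsum_nat_add 2
  rw [← hsplit]
  have e2 : ∑ i ∈ Finset.range 2, sqrtCoeff i ^ 2 * x ^ i = 1 + x / 4 := by
    simp [Finset.sum_range_succ, sqrtCoeff_zero, sqrtCoeff_one]; ring
  rw [e2]
  constructor
  · have : 0 ≤ ∑' i : ℕ, sqrtCoeff (i + 2) ^ 2 * x ^ (i + 2) :=
      tsum_nonneg fun i => by positivity
    linarith
  · have hb : ∑' i : ℕ, sqrtCoeff (i + 2) ^ 2 * x ^ (i + 2) ≤ ∑' i : ℕ, 9 / 64 * x ^ 2 * x ^ i := by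
      refine Summable.tsum_le_tsum (fun i => ?_) ((summable_nat_add_iff 2).2 hs) (hg.mul_left _)
      have h3 : sqrtCoeff (i + 2) ≤ 3 / 8 := sqrtCoeff_two ▸ sqrtCoeff_antitone (by omega)
      have h4 : sqrtCoeff (i + 2) ^ 2 ≤ (3 / 8) ^ 2 :=
        pow_le_pow_left₀ (sqrtCoeff_nonneg _) h3 2
      calc sqrtCoeff (i + 2) ^ 2 * x ^ (i + 2) ≤ (3 / 8) ^ 2 * x ^ (i + 2) := by gcongr
        _ = _ := by ring
    rw [tsum_mul_left, tsum_geometric_of_lt_one h0 (by linarith)] at hb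
    have h5 : (1 - x)⁻¹ ≤ 2 := by
      rw [inv_le_comm₀ (by linarith) (by norm_num)]; linarith
    have h6 : 9 / 64 * x ^ 2 * (1 - x)⁻¹ ≤ 9 / 64 * x ^ 2 * 2 := by gcongr
    linarith

lemma localFactor_upper {x E : ℝ} (h0 : 0 ≤ x) (h1 : x ≤ 1 / 2) (hE0 : 0 ≤ E)
    (hE : E ≤ 1 + x / 4 + 9 / 32 * x ^ 2) : E ^ 4 ≤ (1 - x)⁻¹ * (1 - x ^ 2)⁻¹ := by
  have hx2 : x ^ 2 ≤ 1 / 4 := by nlinarith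
  have a1 : (1 + x / 4 + 9 / 32 * x ^ 2) ^ 2 ≤ 1 + x / 2 + 3 / 4 * x ^ 2 := by
    nlinarith [mul_nonneg h0 (sq_nonneg x), mul_nonneg (sq_nonneg x) (sub_nonneg.2 h1),
      mul_nonneg (sq_nonneg x) (sub_nonneg.2 hx2)]
  have a2 : (1 + x / 2 + 3 / 4 * x ^ 2) ^ 2 ≤ (1 + x + x ^ 2) * (1 + x ^ 2) := by
    nlinarith [mul_nonneg h0 (sq_nonneg x), mul_nonneg (sq_nonneg x) (sub_nonneg.2 h1),
      mul_nonneg (sq_nonneg x) (sq_nonneg x), sq_nonneg x]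
  have a3 : 1 + x + x ^ 2 ≤ (1 - x)⁻¹ := by
    rw [← one_div, le_div_iff₀ (by linarith)]
    nlinarith [mul_nonneg h0 (sq_nonneg x)]
  have a4 : 1 + x ^ 2 ≤ (1 - x ^ 2)⁻¹ := by
    rw [← one_div, le_div_iff₀ (by linarith)]
    nlinarith [mul_nonneg (sq_nonneg x) (sq_nonneg x)]
  calc E ^ 4 ≤ (1 + x / 4 + 9 / 32 * x ^ 2) ^ 4 := by gcongr
    _ = ((1 + x / 4 + 9 / 32 * x ^ 2) ^ 2) ^ 2 := by ring
    _ ≤ (1 + x / 2 + 3 / 4 * x ^ 2) ^ 2 := by gcongr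
    _ ≤ _ := a2
    _ ≤ _ := mul_le_mul a3 a4 (by positivity) (le_trans (by positivity) a3)

lemma localFactor_lower {x E : ℝ} (h0 : 0 ≤ x) (h1 : x ≤ 1 / 2) (hE : 1 + x / 4 ≤ E) :
    (1 - x)⁻¹ ≤ E ^ 4 * (1 - x ^ 2)⁻¹ := by
  have hx2 : x ^ 2 ≤ 1 / 4 := by nlinarith
  have h2 : 1 + x ≤ E ^ 4 := by
    have h3 := one_add_mul_le_pow (a := x / 4) (by linarith) 4
    have h4 : (1 + x / 4) ^ 4 ≤ E ^ 4 := by gcongr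
    push_cast at h3
    linarith
  have h5 : (1 - x)⁻¹ = (1 + x) * (1 - x ^ 2)⁻¹ := by
    have : (1 - x ^ 2) = (1 - x) * (1 + x) := by ring
    rw [this, mul_inv]
    have : (1 + x) ≠ 0 := by linarith
    field_simp
  rw [h5]
  have : 0 ≤ (1 - x ^ 2)⁻¹ := inv_nonneg.2 (by linarith)
  gcongr

lemma tsum_rpow_neg_le {s : ℝ} (hs : 2 ≤ s) : ∑' n : ℕ, (n : ℝ) ^ (-s) ≤ 2 := by
  have h2 : ∑' n : ℕ, (n : ℝ) ^ (-2 : ℝ) = Real.pi ^ 2 / 6 := by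
    rw [← hasSum_zeta_two.tsum_eq]
    refine tsum_congr fun n => ?_
    rw [Real.rpow_neg (by positivity), Real.rpow_two, one_div]
  have hpi : Real.pi ^ 2 / 6 ≤ 2 := by
    have := Real.pi_lt_d2
    have := Real.pi_pos
    nlinarith
  refine le_trans (Summable.tsum_le_tsum (fun n => ?_) (summable_rpow_neg (by linarith))
    (summable_rpow_neg one_lt_two)) (h2.le.trans hpi)
  rcases Nat.eq_zero_or_pos n with rfl | hn
  · simp [Real.zero_rpow (show -s ≠ 0 by linarith)]
  · exact Real.rpow_le_rpow_of_exponent_le (by exact_mod_cast hn) (by linarith)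

lemma rpow_neg_sq {p : ℕ} (s : ℝ) : ((p : ℝ) ^ (-s)) ^ 2 = (p : ℝ) ^ (-(2 * s)) := by
  rw [← Real.rpow_natCast, ← Real.rpow_mul (by positivity)]
  congr 1; push_cast; ring

lemma sqDirichlet_nonneg (s : ℝ) : 0 ≤ sqDirichlet s := tsum_nonneg fun n => by positivity

lemma sqDirichlet_pow_bounds {s : ℝ} (hs : 1 < s) :
    (∑' n : ℕ, (n : ℝ) ^ (-s)) / 2 ≤ sqDirichlet s ^ 4 ∧
      sqDirichlet s ^ 4 ≤ 2 * ∑' n : ℕ, (n : ℝ) ^ (-s) := by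
  have hz := hasProd_zeta hs
  have hz2 := hasProd_zeta (s := 2 * s) (by linarith)
  have hD := hasProd_sqDirichlet hs
  have h2 := tsum_rpow_neg_le (s := 2 * s) (by linarith)
  set Z := ∑' n : ℕ, (n : ℝ) ^ (-s)
  set Z2 := ∑' n : ℕ, (n : ℝ) ^ (-(2 * s))
  have hZ0 : 0 ≤ Z := tsum_nonneg fun n => by positivity
  have hE0 : ∀ p : Nat.Primes, 0 ≤ ∑' e : ℕ, sqrtCoeff e ^ 2 * (((p : ℕ) : ℝ) ^ (-s)) ^ e :=
    fun p => tsum_nonneg fun e => by positivity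
  have up : sqDirichlet s ^ 4 ≤ Z * Z2 := by
    refine le_of_tendsto_of_tendsto' (Tendsto.pow hD 4) (Tendsto.mul hz hz2) fun S => ?_
    rw [← Finset.prod_pow, ← Finset.prod_mul_distrib]
    refine Finset.prod_le_prod (fun p _ => by have := hE0 p; positivity) fun p _ => ?_
    have hp := prime_rpow_neg_le p.2 hs
    rw [← rpow_neg_sq]
    exact localFactor_upper hp.1.le hp.2 (hE0 p) (localFactor_bounds hp.1.le hp.2).2
  have low : Z ≤ sqDirichlet s ^ 4 * Z2 := by
    refine le_of_tendsto_of_tendsto' hz (Tendsto.mul (Tendsto.pow hD 4) hz2) fun S => ?_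
    rw [← Finset.prod_pow, ← Finset.prod_mul_distrib]
    refine Finset.prod_le_prod (fun p _ => ?_) fun p _ => ?_
    · have hp := prime_rpow_neg_le p.2 hs
      exact inv_nonneg.2 (by linarith)
    · have hp := prime_rpow_neg_le p.2 hs
      rw [← rpow_neg_sq]
      exact localFactor_lower hp.1.le hp.2 (localFactor_bounds hp.1.le hp.2).1
  have hD4 : 0 ≤ sqDirichlet s ^ 4 := by positivity
  constructor
  · nlinarith
  · nlinarith

/-- `sqDirichlet (1 + ε)` has exact order `ε ^ (-1 / 4)` as `ε → 0+`. -/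
theorem exists_sqDirichlet_bounds : ∃ η : ℝ, 0 < η ∧ ∀ ε : ℝ, 0 < ε → ε < η →
    1 / 2 * ε ^ (-(1 : ℝ) / 4) ≤ sqDirichlet (1 + ε) ∧
      sqDirichlet (1 + ε) ≤ 2 * ε ^ (-(1 : ℝ) / 4) := by
  have h := tendsto_sub_mul_tsum_nat_rpow
  have h1 := h.eventually (Icc_mem_nhds (show (1 / 2 : ℝ) < 1 by norm_num) (show (1 : ℝ) < 2 by norm_num))
  rw [eventually_nhdsWithin_iff, Metric.eventually_nhds_iff] at h1
  obtain ⟨η, hη, h1⟩ := h1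
  refine ⟨η, hη, fun ε h0 hε => ?_⟩
  have h2 := h1 (y := 1 + ε) (by simpa [abs_of_pos h0] using hε) (by simpa using h0)
  have hz : ∑' n : ℕ, 1 / (n : ℝ) ^ (1 + ε) = ∑' n : ℕ, (n : ℝ) ^ (-(1 + ε)) :=
    tsum_congr fun n => by rw [Real.rpow_neg (by positivity), one_div]
  rw [hz] at h2
  obtain ⟨hl, hu⟩ := sqDirichlet_pow_bounds (s := 1 + ε) (by linarith)
  set Z := ∑' n : ℕ, (n : ℝ) ^ (-(1 + ε))
  set D := sqDirichlet (1 + ε)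
  have hD : 0 ≤ D := sqDirichlet_nonneg _
  obtain ⟨h3, h4⟩ := h2
  have e : (1 + ε - 1) = ε := by ring
  rw [e] at h3 h4
  have hp : (ε ^ (-(1 : ℝ) / 4)) ^ 4 = ε⁻¹ := by
    rw [← Real.rpow_natCast, ← Real.rpow_mul h0.le, ← Real.rpow_neg_one]; norm_num
  have h5 : ε⁻¹ / 2 ≤ Z := by
    rw [div_le_iff₀ two_pos, inv_le_iff_one_le_mul₀ h0]; linarith
  have h6 : Z ≤ 2 * ε⁻¹ := by
    rw [← div_eq_mul_inv, le_div_iff₀ h0]; linarith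
  have hinv : 0 < ε⁻¹ := inv_pos.2 h0
  constructor
  · refine le_of_pow_le_pow_left₀ (n := 4) (by norm_num) hD ?_
    rw [mul_pow, hp]; linarith
  · refine le_of_pow_le_pow_left₀ (n := 4) (by norm_num) (by positivity) ?_
    rw [mul_pow, hp]; linarith

/-- Rankin's upper bound for the harmonic mean square of `sqrtZeta`. -/
theorem exists_sum_sqrtZeta_sq_div_le : ∃ C y₀ : ℝ, 0 < C ∧ ∀ (y : ℝ) (N : ℕ), y₀ ≤ y →
    Real.log N ≤ y → ∑ n ∈ Finset.Icc 1 N, sqrtZeta n ^ 2 * (n : ℝ) ^ (-1 : ℝ) ≤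
      C * y ^ ((1 : ℝ) / 4) := by
  obtain ⟨η, hη, h⟩ := exists_sqDirichlet_bounds
  refine ⟨Real.exp 1 * 2, 1 / η + 1, by positivity, fun y N hy hN => ?_⟩
  have hy0 : 0 < y := lt_of_lt_of_le (by positivity) hy
  have hyη : 1 / y < η := by
    rw [div_lt_iff₀ hy0]
    have : 1 / η < y := by linarith
    rw [div_lt_iff₀ hη] at this
    linarith
  have hb := (h (1 / y) (by positivity) hyη).2
  have e : (1 / y) ^ (-(1 : ℝ) / 4) = y ^ ((1 : ℝ) / 4) := by
    rw [one_div, Real.inv_rpow hy0.le, neg_div, Real.rpow_neg hy0.le, inv_inv]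
  rw [e] at hb
  calc ∑ n ∈ Finset.Icc 1 N, sqrtZeta n ^ 2 * (n : ℝ) ^ (-1 : ℝ)
      ≤ ∑ n ∈ Finset.Icc 1 N, Real.exp 1 * (sqrtZeta n ^ 2 * (n : ℝ) ^ (-(1 + 1 / y))) := by
        refine Finset.sum_le_sum fun n hn => ?_
        rw [Finset.mem_Icc] at hn
        have hn0 : (0 : ℝ) < n := by exact_mod_cast hn.1
        have h1 : (n : ℝ) ^ (1 / y) ≤ Real.exp 1 := by
          rw [Real.rpow_def_of_pos hn0]
          refine Real.exp_le_exp.2 ?_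
          rw [mul_one_div, div_le_one hy0]
          refine le_trans (Real.log_le_log hn0 ?_) hN
          exact_mod_cast hn.2
        have h2 : (n : ℝ) ^ (-1 : ℝ) = (n : ℝ) ^ (1 / y) * (n : ℝ) ^ (-(1 + 1 / y)) := by
          rw [← Real.rpow_add hn0]; congr 1; ring
        rw [h2]
        calc sqrtZeta n ^ 2 * ((n : ℝ) ^ (1 / y) * (n : ℝ) ^ (-(1 + 1 / y)))
            = (n : ℝ) ^ (1 / y) * (sqrtZeta n ^ 2 * (n : ℝ) ^ (-(1 + 1 / y))) := by ring
          _ ≤ _ := by gcongr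
    _ = Real.exp 1 * ∑ n ∈ Finset.Icc 1 N, sqrtZeta n ^ 2 * (n : ℝ) ^ (-(1 + 1 / y)) := by
        rw [Finset.mul_sum]
    _ ≤ Real.exp 1 * sqDirichlet (1 + 1 / y) := by
        gcongr
        exact (summable_sqDirichlet (by simpa using hy0)).sum_le_tsum _ fun n _ => by positivity
    _ ≤ Real.exp 1 * (2 * y ^ ((1 : ℝ) / 4)) := by gcongr
    _ = _ := by ring

/-- The matching lower bound, to the right of the critical line. -/
theorem exists_le_sum_sqrtZeta_sq : ∃ a c₀ : ℝ, 0 < a ∧ ∀ c : ℝ, c₀ ≤ c → ∃ y₀ : ℝ,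
    ∀ (y : ℝ) (N : ℕ), y₀ ≤ y → y / 2 ≤ Real.log N →
      a * (y / c) ^ ((1 : ℝ) / 4) ≤
        ∑ n ∈ Finset.Icc 1 N, sqrtZeta n ^ 2 * (n : ℝ) ^ (-(1 + 2 * (c / y))) := by
  obtain ⟨η, hη, h⟩ := exists_sqDirichlet_bounds
  refine ⟨1 / 8, 8, by norm_num, fun c hc => ⟨2 * c / η + 1, fun y N hy hN => ?_⟩⟩
  have hc0 : 0 < c := by linarith
  have hy0 : 0 < y := lt_of_lt_of_le (by positivity) hy
  have hyη : 2 * (c / y) < η := by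
    rw [mul_div_assoc', div_lt_iff₀ hy0]
    have : 2 * c / η < y := by linarith
    rw [div_lt_iff₀ hη] at this
    linarith
  have hε : 0 < c / y := by positivity
  have hb1 := (h (2 * (c / y)) (by positivity) hyη).1
  have hb2 := (h (c / y) hε (by linarith)).2
  have e : (c / y) ^ (-(1 : ℝ) / 4) = (y / c) ^ ((1 : ℝ) / 4) := by
    rw [neg_div, Real.rpow_neg hε.le, ← Real.inv_rpow hε.le, inv_div]
  have e2 : 1 / 2 ≤ (2 : ℝ) ^ (-(1 : ℝ) / 4) := by
    calc (1 / 2 : ℝ) = 2 ^ (-1 : ℝ) := by rw [Real.rpow_neg_one]; norm_num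
      _ ≤ _ := Real.rpow_le_rpow_of_exponent_le (by norm_num) (by norm_num)
  rw [Real.mul_rpow (by norm_num) hε.le, e] at hb1
  rw [e] at hb2
  have hY : 0 ≤ (y / c) ^ ((1 : ℝ) / 4) := by positivity
  set Y := (y / c) ^ ((1 : ℝ) / 4)
  have hS1 := summable_sqDirichlet (s := 1 + 2 * (c / y)) (by linarith)
  have hS2 := summable_sqDirichlet (s := 1 + c / y) (by linarith)
  have hsplit := hS1.sum_add_tsum_compl (s := Finset.Icc 1 N)
  have hexp4 : Real.exp (-(c / 2)) ≤ 1 / 32 := by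
    have h1 : Real.exp (-(c / 2)) ≤ Real.exp (-(4 : ℝ)) := Real.exp_le_exp.2 (by linarith)
    have h2 : Real.exp (-(4 : ℝ)) = (Real.exp (-1)) ^ 4 := by
      rw [← Real.exp_nat_mul]; norm_num
    have h3 : Real.exp (-1) ≤ 2 / 5 := by
      have := Real.exp_neg_one_lt_d9
      linarith
    have h4 : (Real.exp (-1)) ^ 4 ≤ (2 / 5) ^ 4 := by gcongr
    rw [h2] at h1
    norm_num at h4
    linarith
  have htail : ∑' n : ↑(↑(Finset.Icc 1 N) : Set ℕ)ᶜ,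
      sqrtZeta n ^ 2 * ((n : ℕ) : ℝ) ^ (-(1 + 2 * (c / y))) ≤ 1 / 32 * sqDirichlet (1 + c / y) := by
    have hsub : ∑' n : ↑(↑(Finset.Icc 1 N) : Set ℕ)ᶜ,
        sqrtZeta n ^ 2 * ((n : ℕ) : ℝ) ^ (-(1 + c / y)) ≤ sqDirichlet (1 + c / y) :=
      hS2.tsum_subtype_le _ _ (fun n => by positivity)
    refine le_trans ?_ (mul_le_mul_of_nonneg_left hsub (by norm_num))
    rw [← tsum_mul_left]
    refine Summable.tsum_le_tsum (fun n => ?_) (hS1.subtype _) ((hS2.subtype _).mul_left _)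
    obtain ⟨n, hn⟩ := n
    simp only
    rcases Nat.eq_zero_or_pos n with rfl | hn1
    · simp
    · have hnN : N < n := by
        by_contra hcon
        exact hn (by simp; omega)
      have hn0 : (0 : ℝ) < n := by exact_mod_cast hn1
      have hlog : y / 2 ≤ Real.log n := by
        refine hN.trans ?_
        rcases Nat.eq_zero_or_pos N with rfl | hN0
        · simp; exact Real.log_natCast_nonneg n
        · exact Real.log_le_log (by exact_mod_cast hN0) (by exact_mod_cast hnN.le)
      have h1 : (n : ℝ) ^ (-(c / y)) ≤ 1 / 32 := by
        refine le_trans ?_ hexp4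
        rw [Real.rpow_def_of_pos hn0]
        refine Real.exp_le_exp.2 ?_
        have : c / y * (y / 2) ≤ c / y * Real.log n := by gcongr
        have h3 : c / y * (y / 2) = c / 2 := by field_simp
        linarith
      have h2 : (n : ℝ) ^ (-(1 + 2 * (c / y))) = (n : ℝ) ^ (-(c / y)) * (n : ℝ) ^ (-(1 + c / y)) := by
        rw [← Real.rpow_add hn0]; congr 1; ring
      rw [h2]
      calc sqrtZeta n ^ 2 * ((n : ℝ) ^ (-(c / y)) * (n : ℝ) ^ (-(1 + c / y)))
          = (n : ℝ) ^ (-(c / y)) * (sqrtZeta n ^ 2 * (n : ℝ) ^ (-(1 + c / y))) := by ring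
        _ ≤ _ := by gcongr
  have hmain : sqDirichlet (1 + 2 * (c / y)) - 1 / 32 * sqDirichlet (1 + c / y) ≤
      ∑ n ∈ Finset.Icc 1 N, sqrtZeta n ^ 2 * (n : ℝ) ^ (-(1 + 2 * (c / y))) := by
    rw [sqDirichlet, ← hsplit]
    linarith
  have : 1 / 2 * (1 / 2 * Y) ≤ 1 / 2 * ((2 : ℝ) ^ (-(1 : ℝ) / 4) * Y) := by gcongr
  linarith

/-- The truncated Dirichlet series of `ζ ^ (1 / 2)`. -/
noncomputable def sqrtPoly (N : ℕ) (s : ℂ) : ℂ :=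
  ∑ n ∈ Finset.Icc 1 N, (sqrtZeta n : ℂ) * (n : ℂ) ^ (-s)

lemma differentiable_sqrtPoly (N : ℕ) : Differentiable ℂ (sqrtPoly N) := by
  unfold sqrtPoly
  refine Differentiable.fun_sum fun n hn => ?_
  rw [Finset.mem_Icc] at hn
  intro s
  exact (DifferentiableAt.const_cpow (by fun_prop)
    (Or.inl (by exact_mod_cast (show n ≠ 0 by omega)))).const_mul _

lemma norm_sqrtPoly_le (N : ℕ) {s : ℂ} (hs : 0 ≤ s.re) : ‖sqrtPoly N s‖ ≤ N := by
  calc ‖sqrtPoly N s‖ ≤ ∑ n ∈ Finset.Icc 1 N, (1 : ℝ) := by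
        refine norm_sum_le_of_le _ fun n hn => ?_
        rw [Finset.mem_Icc] at hn
        rw [norm_mul, Complex.norm_natCast_cpow_of_pos (by omega), Complex.norm_real,
          Real.norm_of_nonneg (sqrtZeta_nonneg n)]
        refine mul_le_one₀ (sqrtZeta_le_one n) (by positivity) ?_
        exact Real.rpow_le_one_of_one_le_of_nonpos (by exact_mod_cast hn.1) (by simpa using hs)
    _ = N := by simp

lemma LSeries_sqrtZeta_sq {s : ℂ} (hs : 1 < s.re) :
    LSeries (fun n => (sqrtZeta n : ℂ)) s ^ 2 = riemannZeta s := by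
  have hb : ∀ n ≠ 0, ‖(sqrtZeta n : ℂ)‖ ≤ 1 := fun n _ => by
    rw [Complex.norm_real, Real.norm_of_nonneg (sqrtZeta_nonneg n)]
    exact sqrtZeta_le_one n
  have hsum := LSeriesSummable_of_bounded_of_one_lt_re (m := 1) hb hs
  rw [sq, ← LSeries_convolution' hsum hsum, ← LSeries_one_eq_riemannZeta hs]
  refine LSeries_congr (fun {n} hn => ?_) s
  rw [LSeries.convolution_def]
  have h : (sqrtZeta * sqrtZeta) n = (ArithmeticFunction.zeta : ArithmeticFunction ℝ) n := by
    rw [sqrtZeta_mul_self]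
  rw [ArithmeticFunction.mul_apply, ArithmeticFunction.natCoe_apply,
    ArithmeticFunction.zeta_apply_ne hn] at h
  simp only [Pi.one_apply]
  exact_mod_cast h

/-- `ζ` is well approximated by the square of `sqrtPoly` far to the right. -/
theorem exists_norm_zeta_sub_sqrtPoly_sq_le : ∃ C : ℝ, 0 < C ∧ ∀ (N : ℕ) (s : ℂ), 1 ≤ N →
    s.re = 5 / 2 → ‖riemannZeta s - sqrtPoly N s ^ 2‖ ≤ C * (N : ℝ) ^ (-(7 : ℝ) / 5) := by
  set B := ∑' n : ℕ, (n : ℝ) ^ (-(11 : ℝ) / 10) with hB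
  have hBs : Summable fun n : ℕ => (n : ℝ) ^ (-(11 : ℝ) / 10) := by
    have := summable_rpow_neg (s := 11 / 10) (by norm_num)
    simpa [neg_div] using this
  have hBpos : 0 < B := hBs.tsum_pos (fun n => by positivity) 1 (by simp)
  refine ⟨B * (2 * B), by positivity, fun N s hN hs => ?_⟩
  have hb : ∀ n ≠ 0, ‖(sqrtZeta n : ℂ)‖ ≤ 1 := fun n _ => by
    rw [Complex.norm_real, Real.norm_of_nonneg (sqrtZeta_nonneg n)]
    exact sqrtZeta_le_one n
  have hsum : LSeriesSummable (fun n => (sqrtZeta n : ℂ)) s :=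
    LSeriesSummable_of_bounded_of_one_lt_re (m := 1) hb (by rw [hs]; norm_num)
  have hterm : ∀ n : ℕ, LSeries.term (fun n => (sqrtZeta n : ℂ)) s n =
      (sqrtZeta n : ℂ) * (n : ℂ) ^ (-s) := fun n => by
    rcases Nat.eq_zero_or_pos n with rfl | hn
    · simp
    · rw [LSeries.term_of_ne_zero (by omega), Complex.cpow_neg, div_eq_mul_inv]
  have hnorm : ∀ n : ℕ, ‖LSeries.term (fun n => (sqrtZeta n : ℂ)) s n‖ ≤ (n : ℝ) ^ (-(5 : ℝ) / 2) := by
    intro n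
    rcases Nat.eq_zero_or_pos n with rfl | hn
    · simp
    · rw [hterm, norm_mul, Complex.norm_natCast_cpow_of_pos hn, Complex.neg_re, hs, neg_div]
      exact mul_le_of_le_one_left (by positivity) (hb n (by omega))
  have hle : ∀ n : ℕ, (n : ℝ) ^ (-(5 : ℝ) / 2) ≤ (n : ℝ) ^ (-(11 : ℝ) / 10) := fun n => by
    rcases Nat.eq_zero_or_pos n with rfl | hn
    · simp
    · exact Real.rpow_le_rpow_of_exponent_le (by exact_mod_cast hn) (by norm_num)
  have hA : ‖LSeries (fun n => (sqrtZeta n : ℂ)) s‖ ≤ B :=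
    tsum_of_norm_bounded hBs.hasSum fun n => (hnorm n).trans (hle n)
  have hS : ‖sqrtPoly N s‖ ≤ B := by
    refine (norm_sum_le_of_le _ fun n hn => ?_).trans (hBs.sum_le_tsum (Finset.Icc 1 N) fun n _ => by positivity)
    rw [← hterm]
    exact (hnorm n).trans (hle n)
  have hsplit := (show Summable (LSeries.term (fun n => (sqrtZeta n : ℂ)) s) from hsum).sum_add_tsum_compl
    (s := Finset.Icc 1 N)
  have hS' : ∑ n ∈ Finset.Icc 1 N, LSeries.term (fun n => (sqrtZeta n : ℂ)) s n = sqrtPoly N s :=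
    Finset.sum_congr rfl fun n _ => hterm n
  have hN0 : (0 : ℝ) < N := by exact_mod_cast hN
  have htail : ‖∑' n : ↑(↑(Finset.Icc 1 N) : Set ℕ)ᶜ,
      LSeries.term (fun n => (sqrtZeta n : ℂ)) s n‖ ≤ (N : ℝ) ^ (-(7 : ℝ) / 5) * B := by
    have h1 : ∑' n : ↑(↑(Finset.Icc 1 N) : Set ℕ)ᶜ, ((n : ℕ) : ℝ) ^ (-(11 : ℝ) / 10) ≤ B :=
      hBs.tsum_subtype_le _ _ (fun n => by positivity)
    refine le_trans ?_ (mul_le_mul_of_nonneg_left h1 (by positivity))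
    refine tsum_of_norm_bounded ((hBs.subtype _).hasSum.mul_left _) fun n => ?_
    obtain ⟨n, hn⟩ := n
    simp only
    rcases Nat.eq_zero_or_pos n with rfl | hn1
    · simp
    · have hnN : N < n := by
        by_contra hcon
        exact hn (by simp; omega)
      have hn0 : (0 : ℝ) < n := by exact_mod_cast hn1
      refine (hnorm n).trans ?_
      have h2 : (n : ℝ) ^ (-(5 : ℝ) / 2) = (n : ℝ) ^ (-(7 : ℝ) / 5) * (n : ℝ) ^ (-(11 : ℝ) / 10) := by
        rw [← Real.rpow_add hn0]; norm_num
      rw [h2]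
      show _ ≤ (N : ℝ) ^ (-(7 : ℝ) / 5) * (n : ℝ) ^ (-(11 : ℝ) / 10)
      refine mul_le_mul_of_nonneg_right ?_ (by positivity)
      exact Real.rpow_le_rpow_of_nonpos hN0 (by exact_mod_cast hnN.le) (by norm_num)
  set A := LSeries (fun n => (sqrtZeta n : ℂ)) s with hAdef
  have hdiff : ‖A - sqrtPoly N s‖ ≤ (N : ℝ) ^ (-(7 : ℝ) / 5) * B := by
    have : A - sqrtPoly N s = ∑' n : ↑(↑(Finset.Icc 1 N) : Set ℕ)ᶜ,
      LSeries.term (fun n => (sqrtZeta n : ℂ)) s n := by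
      rw [hAdef, LSeries, ← hsplit, hS']; ring
    rw [this]; exact htail
  have hfac : riemannZeta s - sqrtPoly N s ^ 2 = (A - sqrtPoly N s) * (A + sqrtPoly N s) := by
    rw [← LSeries_sqrtZeta_sq (s := s) (by rw [hs]; norm_num)]; ring
  rw [hfac, norm_mul]
  calc _ ≤ ((N : ℝ) ^ (-(7 : ℝ) / 5) * B) * (B + B) := by
        gcongr
        exact (norm_add_le _ _).trans (add_le_add hA hS)
    _ = _ := by ring

/-- The Gaussian weight centred at `X` with width `Δ`. -/
noncomputable def gaussWeight (Δ X t : ℝ) : ℝ := Real.exp (-((t - X) / Δ) ^ 2)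

lemma gaussWeight_pos (Δ X t : ℝ) : 0 < gaussWeight Δ X t := Real.exp_pos _

lemma gaussWeight_le_one (Δ X t : ℝ) : gaussWeight Δ X t ≤ 1 :=
  Real.exp_le_one_iff.2 (by have := sq_nonneg ((t - X) / Δ); linarith)

lemma continuous_gaussWeight (Δ X : ℝ) : Continuous (gaussWeight Δ X) := by
  unfold gaussWeight; fun_prop

lemma integral_cexp_gauss {Δ : ℝ} (hΔ : 0 < Δ) (X : ℝ) (c d : ℂ) :
    ∫ t : ℝ, cexp (-(((t - X : ℝ) : ℂ) / Δ) ^ 2 + c * ((t - X : ℝ) : ℂ) + d) =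
      (√Real.pi * Δ : ℝ) * cexp (d + c ^ 2 * Δ ^ 2 / 4) := by
  have hb : ((-(1 / Δ ^ 2) : ℝ) : ℂ).re < 0 := by
    rw [Complex.ofReal_re]; have : 0 < 1 / Δ ^ 2 := by positivity
    linarith
  have h := integral_cexp_quadratic hb c d
  rw [integral_sub_right_eq_self (fun u : ℝ => cexp (-((u : ℂ) / Δ) ^ 2 + c * (u : ℂ) + d)) X]
  have e1 : (fun u : ℝ => cexp (-((u : ℂ) / Δ) ^ 2 + c * (u : ℂ) + d)) =
      fun u : ℝ => cexp (((-(1 / Δ ^ 2) : ℝ) : ℂ) * (u : ℂ) ^ 2 + c * u + d) := by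
    funext u; congr 1; push_cast; ring
  rw [e1, h]
  have hΔc : (Δ : ℂ) ≠ 0 := by exact_mod_cast hΔ.ne'
  congr 1
  · have : (Real.pi : ℂ) / -((-(1 / Δ ^ 2) : ℝ) : ℂ) = ((Real.pi * Δ ^ 2 : ℝ) : ℂ) := by
      push_cast; field_simp
    rw [this, show (1 / 2 : ℂ) = ((1 / 2 : ℝ) : ℂ) by push_cast; rfl,
      ← Complex.ofReal_cpow (by positivity), ← Real.sqrt_eq_rpow, Real.sqrt_mul Real.pi_pos.le,
      Real.sqrt_sq hΔ.le]
  · congr 1; push_cast; field_simp; ring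

lemma integrable_cexp_gauss {Δ : ℝ} (hΔ : 0 < Δ) (X : ℝ) (c d : ℂ) :
    Integrable fun t : ℝ => cexp (-(((t - X : ℝ) : ℂ) / Δ) ^ 2 + c * ((t - X : ℝ) : ℂ) + d) := by
  have hb : ((-(1 / Δ ^ 2) : ℝ) : ℂ).re < 0 := by
    rw [Complex.ofReal_re]; have : 0 < 1 / Δ ^ 2 := by positivity
    linarith
  have h := (integrable_cexp_quadratic' hb c d).comp_sub_right X
  refine h.congr (ae_of_all _ fun u => ?_)
  simp only
  congr 1; push_cast; ring

lemma ofReal_gaussWeight (Δ X t : ℝ) :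
    (gaussWeight Δ X t : ℂ) = cexp (-(((t - X : ℝ) : ℂ) / Δ) ^ 2) := by
  unfold gaussWeight; push_cast; rfl

lemma integrable_gaussWeight {Δ : ℝ} (hΔ : 0 < Δ) (X : ℝ) : Integrable (gaussWeight Δ X) := by
  have h := (integrable_cexp_gauss hΔ X 0 0).re
  refine h.congr (ae_of_all _ fun t => ?_)
  show RCLike.re _ = _
  rw [zero_mul, add_zero, add_zero, ← ofReal_gaussWeight]
  simp

lemma integral_gaussWeight {Δ : ℝ} (hΔ : 0 < Δ) (X : ℝ) :
    ∫ t, gaussWeight Δ X t = √Real.pi * Δ := by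
  have h := integral_cexp_gauss hΔ X 0 0
  simp only [zero_mul, add_zero, ← ofReal_gaussWeight] at h
  have h2 : ((∫ t, gaussWeight Δ X t : ℝ) : ℂ) = ∫ t, (gaussWeight Δ X t : ℂ) :=
    integral_ofReal.symm
  rw [← h2, Complex.exp_eq_one_iff.2 ⟨0, by simp⟩, mul_one] at h
  exact_mod_cast h

lemma integral_cexp_mul_gaussWeight {Δ : ℝ} (hΔ : 0 < Δ) (X u : ℝ) :
    ∫ t : ℝ, cexp ((t * u : ℝ) * I) * gaussWeight Δ X t =
      (√Real.pi * Δ : ℝ) * (cexp ((X * u : ℝ) * I) * Real.exp (-(Δ ^ 2 * u ^ 2 / 4))) := by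
  have h := integral_cexp_gauss hΔ X (u * I) ((X * u : ℝ) * I)
  have e : (fun t : ℝ => cexp ((t * u : ℝ) * I) * gaussWeight Δ X t) = fun t : ℝ =>
      cexp (-(((t - X : ℝ) : ℂ) / Δ) ^ 2 + (u * I) * ((t - X : ℝ) : ℂ) + (X * u : ℝ) * I) := by
    funext t
    rw [ofReal_gaussWeight, ← Complex.exp_add]
    congr 1; push_cast; ring
  rw [e, h, Complex.exp_add]
  congr 2
  rw [Complex.ofReal_exp]
  congr 1; push_cast; rw [mul_pow, I_sq]; ring

lemma integrable_cexp_mul_gaussWeight {Δ : ℝ} (hΔ : 0 < Δ) (X u : ℝ) :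
    Integrable fun t : ℝ => cexp ((t * u : ℝ) * I) * gaussWeight Δ X t := by
  refine (integrable_cexp_gauss hΔ X (u * I) ((X * u : ℝ) * I)).congr (ae_of_all _ fun t => ?_)
  simp only
  rw [ofReal_gaussWeight, ← Complex.exp_add]
  congr 1; push_cast; ring

lemma one_div_le_abs_log_sub {m n N : ℕ} (hm : 1 ≤ m) (hn : 1 ≤ n) (hmN : m ≤ N) (hnN : n ≤ N)
    (hmn : m ≠ n) : 1 / (N : ℝ) ≤ |Real.log n - Real.log m| := by
  wlog h : m < n generalizing m n
  · rw [abs_sub_comm]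
    exact this hn hm hnN hmN hmn.symm (by omega)
  have hm0 : (0 : ℝ) < m := by exact_mod_cast hm
  have hn0 : (0 : ℝ) < n := by exact_mod_cast hn
  have hmn1 : (m : ℝ) + 1 ≤ n := by exact_mod_cast h
  refine le_trans ?_ (le_abs_self _)
  have h1 := Real.one_sub_inv_le_log_of_pos (x := n / m) (by positivity)
  rw [Real.log_div hn0.ne' hm0.ne', inv_div] at h1
  refine le_trans ?_ h1
  have h2 : 1 - (m : ℝ) / n = (n - m) / n := by field_simp
  rw [h2]
  calc 1 / (N : ℝ) ≤ 1 / n := by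
        gcongr
    _ ≤ _ := by gcongr; linarith

/-- The Gaussian mean square of `sqrtPoly` is dominated by the diagonal. -/
theorem sqrtPoly_mean_square {N : ℕ} (hN : 1 ≤ N) {Δ : ℝ} (hΔ : 0 < Δ) (X : ℝ) {σ : ℝ}
    (hσ : 0 ≤ σ) : Integrable (fun t : ℝ => ‖sqrtPoly N (σ + t * I)‖ ^ 2 * gaussWeight Δ X t) ∧
    |(∫ t : ℝ, ‖sqrtPoly N (σ + t * I)‖ ^ 2 * gaussWeight Δ X t) -
      √Real.pi * Δ * ∑ n ∈ Finset.Icc 1 N, sqrtZeta n ^ 2 * (n : ℝ) ^ (-(2 * σ))| ≤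
      √Real.pi * Δ * (N ^ 2 * Real.exp (-(Δ ^ 2 / (4 * N ^ 2)))) := by
  set b : ℕ → ℝ := fun n => sqrtZeta n * (n : ℝ) ^ (-σ) with hb
  have hb0 : ∀ n, 0 ≤ b n := fun n => mul_nonneg (sqrtZeta_nonneg n) (by positivity)
  have hb1 : ∀ n ∈ Finset.Icc 1 N, b n ≤ 1 := fun n hn => by
    rw [Finset.mem_Icc] at hn
    exact mul_le_one₀ (sqrtZeta_le_one n) (by positivity)
      (Real.rpow_le_one_of_one_le_of_nonpos (by exact_mod_cast hn.1) (by linarith))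
  have hS : ∀ t : ℝ, sqrtPoly N (σ + t * I) =
      ∑ n ∈ Finset.Icc 1 N, (b n : ℂ) * cexp (-(t * Real.log n : ℝ) * I) := by
    intro t
    refine Finset.sum_congr rfl fun n hn => ?_
    rw [Finset.mem_Icc] at hn
    have hn0 : (n : ℂ) ≠ 0 := by exact_mod_cast (show n ≠ 0 by omega)
    rw [neg_add, Complex.cpow_add _ _ hn0]
    simp only [hb]
    push_cast
    rw [mul_assoc, Complex.ofReal_cpow (by positivity)]
    congr 2
    · push_cast; rfl
    · rw [Complex.cpow_def_of_ne_zero hn0]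
      congr 1; ring
  have hexpand : ∀ t : ℝ, ((‖sqrtPoly N (σ + t * I)‖ ^ 2 * gaussWeight Δ X t : ℝ) : ℂ) =
      ∑ m ∈ Finset.Icc 1 N, ∑ n ∈ Finset.Icc 1 N, ((b m * b n : ℝ) : ℂ) *
        (cexp ((t * (Real.log n - Real.log m) : ℝ) * I) * gaussWeight Δ X t) := by
    intro t
    push_cast
    rw [← Complex.mul_conj', hS, map_sum, Finset.sum_mul_sum, Finset.sum_mul]
    refine Finset.sum_congr rfl fun m _ => ?_
    rw [Finset.sum_mul]
    refine Finset.sum_congr rfl fun n _ => ?_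
    rw [map_mul, Complex.conj_ofReal, ← Complex.exp_conj]
    have : cexp (((t : ℂ) * (Complex.log n - Complex.log m)) * I) =
        cexp (-(t * Real.log m : ℝ) * I) * cexp ((starRingEnd ℂ) (-(t * Real.log n : ℝ) * I)) := by
      rw [← Complex.exp_add]
      congr 1
      simp only [map_mul, map_neg, Complex.conj_ofReal, Complex.conj_I]
      push_cast; ring
    rw [this]
    ring
  have hInt : ∀ m n : ℕ, Integrable fun t : ℝ => ((b m * b n : ℝ) : ℂ) *
        (cexp ((t * (Real.log n - Real.log m) : ℝ) * I) * gaussWeight Δ X t) :=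
    fun m n => (integrable_cexp_mul_gaussWeight hΔ X _).const_mul _
  have hI : Integrable fun t : ℝ => ((‖sqrtPoly N (σ + t * I)‖ ^ 2 * gaussWeight Δ X t : ℝ) : ℂ) := by
    simp only [hexpand]
    exact integrable_finsetSum _ fun m _ => integrable_finsetSum _ fun n _ => hInt m n
  refine ⟨hI.re.congr (ae_of_all _ fun t => Complex.ofReal_re _), ?_⟩
  have hval : ((∫ t : ℝ, ‖sqrtPoly N (σ + t * I)‖ ^ 2 * gaussWeight Δ X t : ℝ) : ℂ) =
      ∑ m ∈ Finset.Icc 1 N, ∑ n ∈ Finset.Icc 1 N, ((b m * b n : ℝ) : ℂ) *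
        ((√Real.pi * Δ : ℝ) * (cexp ((X * (Real.log n - Real.log m) : ℝ) * I) *
          Real.exp (-(Δ ^ 2 * (Real.log n - Real.log m) ^ 2 / 4)))) := by
    have h2 : ((∫ t : ℝ, ‖sqrtPoly N (σ + t * I)‖ ^ 2 * gaussWeight Δ X t : ℝ) : ℂ) =
        ∫ t : ℝ, ((‖sqrtPoly N (σ + t * I)‖ ^ 2 * gaussWeight Δ X t : ℝ) : ℂ) :=
      integral_ofReal.symm
    rw [h2]
    simp only [hexpand]
    rw [integral_finsetSum _ fun m _ => integrable_finsetSum _ fun n _ => hInt m n]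
    refine Finset.sum_congr rfl fun m _ => ?_
    rw [integral_finsetSum _ fun n _ => hInt m n]
    refine Finset.sum_congr rfl fun n _ => ?_
    rw [integral_const_mul, integral_cexp_mul_gaussWeight hΔ]
  have hdiag : ((√Real.pi * Δ * ∑ n ∈ Finset.Icc 1 N, sqrtZeta n ^ 2 * (n : ℝ) ^ (-(2 * σ)) : ℝ) : ℂ) =
      ∑ m ∈ Finset.Icc 1 N, ∑ n ∈ Finset.Icc 1 N,
        if m = n then ((b m * b n : ℝ) : ℂ) * ((√Real.pi * Δ : ℝ) : ℂ) else 0 := by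
    rw [Complex.ofReal_mul, Complex.ofReal_sum, Finset.mul_sum]
    refine Finset.sum_congr rfl fun m hm => ?_
    rw [Finset.sum_ite_eq, if_pos hm, ← Complex.ofReal_mul, ← Complex.ofReal_mul]
    congr 1
    have : (m : ℝ) ^ (-(2 * σ)) = (m : ℝ) ^ (-σ) * (m : ℝ) ^ (-σ) := by
      rw [Finset.mem_Icc] at hm
      rw [← Real.rpow_add (by exact_mod_cast hm.1)]; congr 1; ring
    simp only [hb]
    rw [this]; ring
  rw [← Real.norm_eq_abs, ← Complex.norm_real, Complex.ofReal_sub, hval, hdiag,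
    ← Finset.sum_sub_distrib]
  have hterm : ∀ m ∈ Finset.Icc 1 N, ∀ n ∈ Finset.Icc 1 N,
      ‖((b m * b n : ℝ) : ℂ) *
        ((√Real.pi * Δ : ℝ) * (cexp ((X * (Real.log n - Real.log m) : ℝ) * I) *
          Real.exp (-(Δ ^ 2 * (Real.log n - Real.log m) ^ 2 / 4)))) -
        (if m = n then ((b m * b n : ℝ) : ℂ) * ((√Real.pi * Δ : ℝ) : ℂ) else 0)‖ ≤
      √Real.pi * Δ * Real.exp (-(Δ ^ 2 / (4 * N ^ 2))) := by
    intro m hm n hn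
    split_ifs with h
    · subst h
      have : (0 : ℝ) ≤ √Real.pi * Δ * Real.exp (-(Δ ^ 2 / (4 * N ^ 2))) := by positivity
      simpa using this
    · rw [sub_zero, norm_mul, norm_mul, norm_mul, Complex.norm_exp_ofReal_mul_I, one_mul,
        Complex.norm_real, Complex.norm_real, Complex.norm_real,
        Real.norm_of_nonneg (mul_nonneg (hb0 m) (hb0 n)),
        Real.norm_of_nonneg (by positivity), Real.norm_of_nonneg (Real.exp_pos _).le]
      have h1 : b m * b n ≤ 1 := mul_le_one₀ (hb1 m hm) (hb0 n) (hb1 n hn)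
      rw [Finset.mem_Icc] at hm hn
      have hl := one_div_le_abs_log_sub hm.1 hn.1 hm.2 hn.2 h
      have hN0 : (0 : ℝ) < N := by exact_mod_cast hN
      have h2 : Real.exp (-(Δ ^ 2 * (Real.log n - Real.log m) ^ 2 / 4)) ≤
          Real.exp (-(Δ ^ 2 / (4 * N ^ 2))) := by
        refine Real.exp_le_exp.2 (neg_le_neg ?_)
        have h3 : (1 / (N : ℝ)) ^ 2 ≤ (Real.log n - Real.log m) ^ 2 := by
          rw [← sq_abs (Real.log n - Real.log m)]; gcongr
        calc Δ ^ 2 / (4 * N ^ 2) = Δ ^ 2 * (1 / (N : ℝ)) ^ 2 / 4 := by field_simp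
          _ ≤ _ := by gcongr
      calc _ ≤ 1 * (√Real.pi * Δ * Real.exp (-(Δ ^ 2 / (4 * N ^ 2)))) := by gcongr
        _ = _ := one_mul _
  calc _ ≤ ∑ m ∈ Finset.Icc 1 N, ∑ n ∈ Finset.Icc 1 N,
        √Real.pi * Δ * Real.exp (-(Δ ^ 2 / (4 * N ^ 2))) := by
        refine norm_sum_le_of_le _ fun m hm => ?_
        rw [← Finset.sum_sub_distrib]
        exact norm_sum_le_of_le _ fun n hn => hterm m hm n hn
    _ = _ := by simp; ring

lemma one_add_abs_pow_mul_exp_le (k : ℕ) (hk : 1 ≤ k) (v : ℝ) :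
    (1 + |v|) ^ (2 * k) * Real.exp (-v ^ 2) ≤ (2 * k) ^ k := by
  have hk0 : (0 : ℝ) < k := by exact_mod_cast hk
  have hk1 : (1 : ℝ) ≤ k := by exact_mod_cast hk
  have h1 : (1 + |v|) ^ 2 ≤ 2 * k * (v ^ 2 / k + 1) := by
    have : 2 * k * (v ^ 2 / k + 1) = 2 * v ^ 2 + 2 * k := by field_simp
    rw [this]
    nlinarith [sq_abs v, sq_nonneg (|v| - 1), abs_nonneg v]
  have h2 : (v ^ 2 / k + 1) ^ k ≤ Real.exp (v ^ 2) := by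
    calc (v ^ 2 / k + 1) ^ k ≤ (Real.exp (v ^ 2 / k)) ^ k := by
          gcongr; exact Real.add_one_le_exp _
      _ = _ := by rw [← Real.exp_nat_mul]; congr 1; field_simp
  calc (1 + |v|) ^ (2 * k) * Real.exp (-v ^ 2)
      ≤ (2 * k * (v ^ 2 / k + 1)) ^ k * Real.exp (-v ^ 2) := by
        rw [pow_mul]; gcongr
    _ = (2 * k) ^ k * ((v ^ 2 / k + 1) ^ k * Real.exp (-v ^ 2)) := by rw [mul_pow]; ring
    _ ≤ (2 * k) ^ k * (Real.exp (v ^ 2) * Real.exp (-v ^ 2)) := by gcongr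
    _ = _ := by rw [← Real.exp_add]; simp

lemma exists_one_add_abs_pow_mul_gaussWeight_le {Δ : ℝ} (hΔ : 0 < Δ) (X : ℝ) :
    ∃ C > 0, ∀ t, (1 + |t|) ^ 4 * gaussWeight Δ X t ≤ C := by
  refine ⟨(1 + |X| + Δ) ^ 4 * (2 * (2 : ℕ)) ^ 2, by positivity, fun t => ?_⟩
  set v := (t - X) / Δ with hv
  have ht : t = X + Δ * v := by rw [hv]; field_simp; ring
  have h1 : 1 + |t| ≤ (1 + |X| + Δ) * (1 + |v|) := by
    have : |t| ≤ |X| + Δ * |v| := by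
      rw [ht]; refine (abs_add_le _ _).trans ?_
      rw [abs_mul, abs_of_pos hΔ]
    nlinarith [abs_nonneg X, abs_nonneg v]
  have h2 := one_add_abs_pow_mul_exp_le 2 (by norm_num) v
  have hg : gaussWeight Δ X t = Real.exp (-v ^ 2) := rfl
  rw [hg]
  calc (1 + |t|) ^ 4 * Real.exp (-v ^ 2)
      ≤ ((1 + |X| + Δ) * (1 + |v|)) ^ 4 * Real.exp (-v ^ 2) := by gcongr
    _ = (1 + |X| + Δ) ^ 4 * ((1 + |v|) ^ (2 * 2) * Real.exp (-v ^ 2)) := by ring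
    _ ≤ _ := by gcongr

/-- The entire function whose modulus on vertical lines is a Gaussian weight. -/
noncomputable def gaussKernel (Δ X : ℝ) (s : ℂ) : ℂ := cexp (((s - 1 / 2 - X * I) / Δ) ^ 2)

lemma differentiable_gaussKernel (Δ X : ℝ) : Differentiable ℂ (gaussKernel Δ X) := by
  unfold gaussKernel; fun_prop

lemma norm_gaussKernel (Δ X : ℝ) (s : ℂ) :
    ‖gaussKernel Δ X s‖ = Real.exp (((s.re - 1 / 2) / Δ) ^ 2) * gaussWeight Δ X s.im := by
  have h : (s - 1 / 2 - X * I) / Δ =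
      (((s.re - 1 / 2) / Δ : ℝ) : ℂ) + (((s.im - X) / Δ : ℝ) : ℂ) * I := by
    conv_lhs => rw [← Complex.re_add_im s]
    push_cast; ring
  rw [gaussKernel, Complex.norm_exp, gaussWeight, ← Real.exp_add, h]
  congr 1
  generalize (s.re - 1 / 2) / Δ = a
  generalize (s.im - X) / Δ = b
  simp [sq]; ring

lemma norm_gaussKernel_line (Δ X σ t : ℝ) :
    ‖gaussKernel Δ X (σ + t * I)‖ = Real.exp (((σ - 1 / 2) / Δ) ^ 2) * gaussWeight Δ X t := by
  rw [norm_gaussKernel]; simp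

lemma exp_kernel_le {Δ σ : ℝ} (hΔ : 2 ≤ Δ) (h : |σ - 1 / 2| ≤ 2) :
    Real.exp (((σ - 1 / 2) / Δ) ^ 2) ≤ 3 := by
  have : ((σ - 1 / 2) / Δ) ^ 2 ≤ 1 := by
    rw [sq_le_one_iff_abs_le_one, abs_div, abs_of_pos (by linarith : (0 : ℝ) < Δ),
      div_le_one (by linarith)]
    linarith
  calc _ ≤ Real.exp 1 := Real.exp_le_exp.2 this
    _ ≤ 3 := by have := Real.exp_one_lt_d9; linarith

lemma gaussWeight_le_norm_gaussKernel (Δ X σ t : ℝ) :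
    gaussWeight Δ X t ≤ ‖gaussKernel Δ X (σ + t * I)‖ := by
  rw [norm_gaussKernel_line]
  exact le_mul_of_one_le_left (gaussWeight_pos _ _ _).le (Real.one_le_exp (sq_nonneg _))

lemma norm_gaussKernel_le {Δ X σ t : ℝ} (hΔ : 2 ≤ Δ) (h : |σ - 1 / 2| ≤ 2) :
    ‖gaussKernel Δ X (σ + t * I)‖ ≤ 3 * gaussWeight Δ X t := by
  rw [norm_gaussKernel_line]
  exact mul_le_mul_of_nonneg_right (exp_kernel_le hΔ h) (gaussWeight_pos _ _ _).le

lemma norm_gaussKernel_half (Δ X t : ℝ) :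
    ‖gaussKernel Δ X ((1 / 2 : ℝ) + t * I)‖ = gaussWeight Δ X t := by
  rw [norm_gaussKernel_line]; simp

/-- A function of linear growth times the Gaussian kernel decays quadratically in the strip. -/
lemma exists_norm_mul_gaussKernel_le {Δ : ℝ} (hΔ : 2 ≤ Δ) (X : ℝ) {g : ℂ → ℂ} {A : ℝ}
    (hA : 0 ≤ A) (hg : ∀ z : ℂ, 1 / 8 ≤ z.re → z.re ≤ 5 / 2 → ‖g z‖ ≤ A * (1 + ‖z‖)) :
    ∃ C, ∀ z : ℂ, 1 / 8 ≤ z.re → z.re ≤ 5 / 2 →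
      ‖g z * gaussKernel Δ X z‖ ≤ C / (1 + z.im ^ 2) := by
  obtain ⟨C, hC, h⟩ := exists_one_add_abs_pow_mul_gaussWeight_le (by linarith : 0 < Δ) X
  refine ⟨A * 4 * 3 * C, fun z hz1 hz2 => ?_⟩
  have h1 : ‖z‖ ≤ 5 / 2 + |z.im| := by
    refine (Complex.norm_le_abs_re_add_abs_im z).trans ?_
    rw [abs_of_nonneg (by linarith : 0 ≤ z.re)]; linarith
  have h2 : ‖gaussKernel Δ X z‖ ≤ 3 * gaussWeight Δ X z.im := by
    have := norm_gaussKernel_le (X := X) (t := z.im) hΔ (σ := z.re)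
      (abs_le.2 ⟨by linarith, by linarith⟩)
    rwa [Complex.re_add_im] at this
  have hw := (gaussWeight_pos Δ X z.im).le
  rw [norm_mul, le_div_iff₀ (by positivity)]
  have h0 := abs_nonneg z.im
  calc ‖g z‖ * ‖gaussKernel Δ X z‖ * (1 + z.im ^ 2)
      ≤ (A * (4 * (1 + |z.im|))) * (3 * gaussWeight Δ X z.im) * ((1 + |z.im|) ^ 3) := by
        gcongr
        · refine (hg z hz1 hz2).trans ?_
          gcongr; linarith
        · rw [← sq_abs]; nlinarith [pow_nonneg h0 3, sq_nonneg |z.im|]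
    _ = A * 4 * 3 * ((1 + |z.im|) ^ 4 * gaussWeight Δ X z.im) := by ring
    _ ≤ _ := by gcongr; exact h _

/-- Away from its centre, the weight of width `T^{9/10}` is negligible. -/
theorem exists_gaussWeight_tail_le : ∃ T₀ : ℝ, 1 ≤ T₀ ∧ ∀ T X t : ℝ, T₀ ≤ T → T ≤ X → X ≤ 2 * T →
    T / 4 ≤ |t - X| → gaussWeight (T ^ ((9 : ℝ) / 10)) X t ≤ ((1 + |t|) ^ 6)⁻¹ := by
  set K : ℝ := 13 ^ 6 * 4 ^ 54 * (2 * (31 : ℕ)) ^ 31 with hK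
  have hK1 : 1 ≤ K := by rw [hK]; norm_num
  refine ⟨(4 * K) ^ 10, one_le_pow₀ (by linarith), fun T X t hT hX1 hX2 ht => ?_⟩
  have hT1 : 1 ≤ T := le_trans (one_le_pow₀ (by linarith)) hT
  set Y : ℝ := T ^ ((1 : ℝ) / 10) with hY
  have hY0 : 0 < Y := by positivity
  have hYT : Y ^ 10 = T := by
    rw [hY, ← Real.rpow_natCast, ← Real.rpow_mul (by linarith)]; norm_num
  have hΔ : T ^ ((9 : ℝ) / 10) = Y ^ 9 := by
    rw [hY, ← Real.rpow_natCast, ← Real.rpow_mul (by linarith)]; norm_num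
  have hYK : 4 * K ≤ Y := by
    rw [← hYT] at hT
    exact le_of_pow_le_pow_left₀ (by norm_num) hY0.le hT
  set v := (t - X) / Y ^ 9 with hv
  have hvabs : |v| = |t - X| / Y ^ 9 := by rw [hv, abs_div, abs_of_pos (by positivity : 0 < Y ^ 9)]
  have hv1 : Y / 4 ≤ |v| := by
    rw [hvabs, le_div_iff₀ (by positivity)]
    calc Y / 4 * Y ^ 9 = Y ^ 10 / 4 := by ring
      _ ≤ _ := by rw [hYT]; exact ht
  have hvK : K ≤ |v| := by linarith
  have h1 : 1 + |t| ≤ 13 * (4 ^ 9 * |v| ^ 10) := by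
    have ha : |t| ≤ |t - X| + X := by
      have := abs_sub_abs_le_abs_sub t X
      rw [abs_of_nonneg (by linarith : 0 ≤ X)] at this; linarith
    have hb : |t - X| = |v| * Y ^ 9 := by rw [hvabs]; field_simp
    have hc : Y ^ 9 ≤ (4 * |v|) ^ 9 := by gcongr; linarith
    calc 1 + |t| ≤ 13 * |t - X| := by linarith
      _ = 13 * (|v| * Y ^ 9) := by rw [hb]
      _ ≤ 13 * (|v| * (4 * |v|) ^ 9) := by gcongr
      _ = _ := by ring
  have h2 := one_add_abs_pow_mul_exp_le 31 (by norm_num) v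
  have hg : gaussWeight (T ^ ((9 : ℝ) / 10)) X t = Real.exp (-v ^ 2) := by
    rw [gaussWeight, hΔ]
  rw [hg, ← one_div, le_div_iff₀ (by positivity)]
  have hv0 : 0 < |v| := by linarith
  have h3 : |v| ^ 62 * Real.exp (-v ^ 2) ≤ (2 * (31 : ℕ)) ^ 31 := by
    refine le_trans ?_ h2
    have : |v| ≤ 1 + |v| := by linarith
    gcongr
  have h4 : Real.exp (-v ^ 2) * (1 + |t|) ^ 6 * |v| ^ 2 ≤ K := by
    calc Real.exp (-v ^ 2) * (1 + |t|) ^ 6 * |v| ^ 2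
        ≤ Real.exp (-v ^ 2) * (13 * (4 ^ 9 * |v| ^ 10)) ^ 6 * |v| ^ 2 := by gcongr
      _ = 13 ^ 6 * 4 ^ 54 * (|v| ^ 62 * Real.exp (-v ^ 2)) := by ring
      _ ≤ K := by rw [hK]; gcongr
  by_contra! hcon
  have : K < Real.exp (-v ^ 2) * (1 + |t|) ^ 6 * |v| ^ 2 := by
    have h5 : K ≤ |v| ^ 2 := by nlinarith
    have h6 : 0 < |v| ^ 2 := by positivity
    nlinarith
  linarith

/-- The smoothed first moment of `etaFun` on the line `Re s = σ`. -/
noncomputable def etaMoment (Δ X σ : ℝ) : ℝ :=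
  ∫ t : ℝ, ‖etaFun (σ + t * I) * gaussKernel Δ X (σ + t * I)‖

/-- The error in approximating `etaFun` by a squared Dirichlet polynomial. -/
noncomputable def approxError (N : ℕ) (s : ℂ) : ℂ := etaFun s - etaFactor s * sqrtPoly N s ^ 2

/-- The smoothed first moment of `approxError` on the line `Re s = σ`. -/
noncomputable def errorMoment (N : ℕ) (Δ X σ : ℝ) : ℝ :=
  ∫ t : ℝ, ‖approxError N (σ + t * I) * gaussKernel Δ X (σ + t * I)‖

/-- The smoothed mean square of `sqrtPoly` on the line `Re s = σ`. -/
noncomputable def polyMoment (N : ℕ) (Δ X σ : ℝ) : ℝ :=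
  ∫ t : ℝ, ‖sqrtPoly N (σ + t * I)‖ ^ 2 * gaussWeight Δ X t

lemma differentiable_approxError (N : ℕ) : Differentiable ℂ (approxError N) :=
  differentiable_etaFun.sub (differentiable_etaFactor.mul ((differentiable_sqrtPoly N).pow 2))

lemma exists_norm_etaFun_linear : ∃ A ≥ 0, ∀ z : ℂ, 1 / 8 ≤ z.re → z.re ≤ 5 / 2 →
    ‖etaFun z‖ ≤ A * (1 + ‖z‖) := by
  obtain ⟨C, hC, h⟩ := exists_norm_etaFun_le
  refine ⟨C, hC.le, fun z hz _ => (h z hz).trans ?_⟩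
  gcongr; linarith

lemma exists_norm_approxError_linear (N : ℕ) : ∃ A ≥ 0, ∀ z : ℂ, 1 / 8 ≤ z.re → z.re ≤ 5 / 2 →
    ‖approxError N z‖ ≤ A * (1 + ‖z‖) := by
  obtain ⟨C, hC, h⟩ := exists_norm_etaFun_linear
  refine ⟨C + 3 * N ^ 2, by positivity, fun z hz1 hz2 => ?_⟩
  have h1 : ‖etaFactor z * sqrtPoly N z ^ 2‖ ≤ 3 * N ^ 2 := by
    rw [norm_mul, norm_pow]
    gcongr
    · exact norm_etaFactor_le (s := z) (by linarith)
    · exact norm_sqrtPoly_le N (by linarith)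
  have h2 := h z hz1 hz2
  have h3 : (3 * N ^ 2 : ℝ) ≤ 3 * N ^ 2 * (1 + ‖z‖) :=
    le_mul_of_one_le_right (by positivity) (by linarith [norm_nonneg z])
  calc _ ≤ ‖etaFun z‖ + ‖etaFactor z * sqrtPoly N z ^ 2‖ := norm_sub_le _ _
    _ ≤ C * (1 + ‖z‖) + 3 * N ^ 2 * (1 + ‖z‖) := add_le_add h2 (h1.trans h3)
    _ = _ := by ring

lemma integrable_line_mul_gaussKernel {Δ : ℝ} (hΔ : 2 ≤ Δ) (X : ℝ) {g : ℂ → ℂ}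
    (hd : Differentiable ℂ g) {A : ℝ} (hA : 0 ≤ A)
    (hg : ∀ z : ℂ, 1 / 8 ≤ z.re → z.re ≤ 5 / 2 → ‖g z‖ ≤ A * (1 + ‖z‖)) {σ : ℝ}
    (h1 : 1 / 8 ≤ σ) (h2 : σ ≤ 5 / 2) :
    Integrable fun t : ℝ => g (σ + t * I) * gaussKernel Δ X (σ + t * I) := by
  obtain ⟨C, hC⟩ := exists_norm_mul_gaussKernel_le hΔ X hA hg
  have hc : Continuous fun z => g z * gaussKernel Δ X z :=
    hd.continuous.mul (differentiable_gaussKernel Δ X).continuous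
  refine integrable_of_norm_le_div (C := C)
    (hc.comp (by fun_prop : Continuous fun t : ℝ => (σ : ℂ) + t * I)) fun t => ?_
  have := hC (σ + t * I) (by simpa using h1) (by simpa using h2)
  simpa using this

lemma integral_norm_mul_gaussKernel_interp {Δ : ℝ} (hΔ : 2 ≤ Δ) (X : ℝ) {g : ℂ → ℂ}
    (hd : Differentiable ℂ g) {A : ℝ} (hA : 0 ≤ A)
    (hg : ∀ z : ℂ, 1 / 8 ≤ z.re → z.re ≤ 5 / 2 → ‖g z‖ ≤ A * (1 + ‖z‖)) {l u σ : ℝ}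
    (hl : 1 / 8 ≤ l) (hu : u ≤ 5 / 2) (hlu : l < u) (h1 : l ≤ σ) (h2 : σ ≤ u) :
    ∫ t : ℝ, ‖g (σ + t * I) * gaussKernel Δ X (σ + t * I)‖ ≤
      (∫ t : ℝ, ‖g (l + t * I) * gaussKernel Δ X (l + t * I)‖) ^ (1 - (σ - l) / (u - l)) *
      (∫ t : ℝ, ‖g (u + t * I) * gaussKernel Δ X (u + t * I)‖) ^ ((σ - l) / (u - l)) := by
  obtain ⟨C, hC⟩ := exists_norm_mul_gaussKernel_le hΔ X hA hg
  exact integral_norm_le_interp (f := fun z => g z * gaussKernel Δ X z)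
    (hd.mul (differentiable_gaussKernel Δ X)) hlu
    (fun z hz1 hz2 => hC z (by linarith) (by linarith)) h1 h2

lemma etaMoment_nonneg (Δ X σ : ℝ) : 0 ≤ etaMoment Δ X σ := integral_nonneg fun _ => norm_nonneg _

lemma errorMoment_nonneg (N : ℕ) (Δ X σ : ℝ) : 0 ≤ errorMoment N Δ X σ :=
  integral_nonneg fun _ => norm_nonneg _

lemma integrable_etaMoment {Δ : ℝ} (hΔ : 2 ≤ Δ) (X : ℝ) {σ : ℝ} (h1 : 1 / 8 ≤ σ) (h2 : σ ≤ 5 / 2) :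
    Integrable fun t : ℝ => ‖etaFun (σ + t * I) * gaussKernel Δ X (σ + t * I)‖ := by
  obtain ⟨A, hA, h⟩ := exists_norm_etaFun_linear
  exact (integrable_line_mul_gaussKernel hΔ X differentiable_etaFun hA h h1 h2).norm

lemma integrable_errorMoment (N : ℕ) {Δ : ℝ} (hΔ : 2 ≤ Δ) (X : ℝ) {σ : ℝ} (h1 : 1 / 8 ≤ σ)
    (h2 : σ ≤ 5 / 2) :
    Integrable fun t : ℝ => ‖approxError N (σ + t * I) * gaussKernel Δ X (σ + t * I)‖ := by
  obtain ⟨A, hA, h⟩ := exists_norm_approxError_linear N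
  exact (integrable_line_mul_gaussKernel hΔ X (differentiable_approxError N) hA h h1 h2).norm

lemma etaMoment_half_le {Δ : ℝ} (hΔ : 2 ≤ Δ) (X : ℝ) {δ : ℝ} (h0 : 0 < δ) (h1 : δ ≤ 1 / 4) :
    etaMoment Δ X (1 / 2) ≤
      etaMoment Δ X (1 / 2 - δ) ^ ((1 : ℝ) / 2) * etaMoment Δ X (1 / 2 + δ) ^ ((1 : ℝ) / 2) := by
  obtain ⟨A, hA, h⟩ := exists_norm_etaFun_linear
  have := integral_norm_mul_gaussKernel_interp hΔ X differentiable_etaFun hA h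
    (l := 1 / 2 - δ) (u := 1 / 2 + δ) (σ := 1 / 2) (by linarith) (by linarith) (by linarith)
    (by linarith) (by linarith)
  have e : (1 / 2 - (1 / 2 - δ)) / (1 / 2 + δ - (1 / 2 - δ)) = (1 : ℝ) / 2 := by
    field_simp; ring
  rw [e] at this
  norm_num at this ⊢
  simpa [etaMoment] using this

lemma etaMoment_le_interp {Δ : ℝ} (hΔ : 2 ≤ Δ) (X : ℝ) {δ : ℝ} (h0 : 0 ≤ δ) (h1 : δ ≤ 1 / 4) :
    etaMoment Δ X (1 / 2 + δ) ≤
      etaMoment Δ X (1 / 2) ^ (1 - δ / 2) * etaMoment Δ X (5 / 2) ^ (δ / 2) := by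
  obtain ⟨A, hA, h⟩ := exists_norm_etaFun_linear
  have := integral_norm_mul_gaussKernel_interp hΔ X differentiable_etaFun hA h
    (l := 1 / 2) (u := 5 / 2) (σ := 1 / 2 + δ) (by linarith) (by linarith) (by linarith)
    (by linarith) (by linarith)
  have e : (1 / 2 + δ - 1 / 2) / (5 / 2 - 1 / 2) = δ / 2 := by ring
  rw [e] at this
  exact this

lemma errorMoment_le_interp (N : ℕ) {Δ : ℝ} (hΔ : 2 ≤ Δ) (X : ℝ) {δ : ℝ} (h0 : 0 ≤ δ)
    (h1 : δ ≤ 1 / 4) : errorMoment N Δ X (1 / 2 + δ) ≤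
      errorMoment N Δ X (1 / 2) ^ (1 - δ / 2) * errorMoment N Δ X (5 / 2) ^ (δ / 2) := by
  obtain ⟨A, hA, h⟩ := exists_norm_approxError_linear N
  have := integral_norm_mul_gaussKernel_interp hΔ X (differentiable_approxError N) hA h
    (l := 1 / 2) (u := 5 / 2) (σ := 1 / 2 + δ) (by linarith) (by linarith) (by linarith)
    (by linarith) (by linarith)
  have e : (1 / 2 + δ - 1 / 2) / (5 / 2 - 1 / 2) = δ / 2 := by ring
  rw [e] at this
  exact this

lemma errorMoment_le {N : ℕ} (hN : 1 ≤ N) {Δ : ℝ} (hΔ : 2 ≤ Δ) (X : ℝ) {σ : ℝ} (h1 : 1 / 2 ≤ σ)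
    (h2 : σ ≤ 5 / 2) : errorMoment N Δ X σ ≤ etaMoment Δ X σ + 9 * polyMoment N Δ X σ := by
  have hS := (sqrtPoly_mean_square hN (by linarith : 0 < Δ) X (by linarith : 0 ≤ σ)).1
  have hJ := integrable_etaMoment hΔ X (σ := σ) (by linarith) h2
  have hK := integrable_errorMoment N hΔ X (σ := σ) (by linarith) h2
  rw [errorMoment, etaMoment, polyMoment, ← integral_const_mul, ← integral_add hJ (hS.const_mul 9)]
  refine integral_mono hK (hJ.add (hS.const_mul 9)) fun t => ?_
  have hk : ‖gaussKernel Δ X (σ + t * I)‖ ≤ 3 * gaussWeight Δ X t :=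
    norm_gaussKernel_le hΔ (abs_le.2 ⟨by linarith, by linarith⟩)
  have hf : ‖etaFactor (σ + t * I)‖ ≤ 3 := norm_etaFactor_le (by simp; linarith)
  simp only [norm_mul, approxError]
  calc _ ≤ (‖etaFun (σ + t * I)‖ + ‖etaFactor (σ + t * I) * sqrtPoly N (σ + t * I) ^ 2‖) *
        ‖gaussKernel Δ X (σ + t * I)‖ := by gcongr; exact norm_sub_le _ _
    _ = ‖etaFun (σ + t * I)‖ * ‖gaussKernel Δ X (σ + t * I)‖ +
      ‖etaFactor (σ + t * I)‖ * ‖sqrtPoly N (σ + t * I)‖ ^ 2 *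
        ‖gaussKernel Δ X (σ + t * I)‖ := by rw [add_mul, norm_mul, norm_pow]
    _ ≤ ‖etaFun (σ + t * I)‖ * ‖gaussKernel Δ X (σ + t * I)‖ +
      3 * ‖sqrtPoly N (σ + t * I)‖ ^ 2 * (3 * gaussWeight Δ X t) := by gcongr
    _ = _ := by ring

lemma etaMoment_le {N : ℕ} (hN : 1 ≤ N) {Δ : ℝ} (hΔ : 2 ≤ Δ) (X : ℝ) {σ : ℝ} (h1 : 1 / 2 ≤ σ)
    (h2 : σ ≤ 5 / 2) : etaMoment Δ X σ ≤ errorMoment N Δ X σ + 9 * polyMoment N Δ X σ := by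
  have hS := (sqrtPoly_mean_square hN (by linarith : 0 < Δ) X (by linarith : 0 ≤ σ)).1
  have hJ := integrable_etaMoment hΔ X (σ := σ) (by linarith) h2
  have hK := integrable_errorMoment N hΔ X (σ := σ) (by linarith) h2
  rw [errorMoment, etaMoment, polyMoment, ← integral_const_mul, ← integral_add hK (hS.const_mul 9)]
  refine integral_mono hJ (hK.add (hS.const_mul 9)) fun t => ?_
  have hk : ‖gaussKernel Δ X (σ + t * I)‖ ≤ 3 * gaussWeight Δ X t :=
    norm_gaussKernel_le hΔ (abs_le.2 ⟨by linarith, by linarith⟩)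
  have hf : ‖etaFactor (σ + t * I)‖ ≤ 3 := norm_etaFactor_le (by simp; linarith)
  have e : etaFun (σ + t * I) = approxError N (σ + t * I) +
    etaFactor (σ + t * I) * sqrtPoly N (σ + t * I) ^ 2 := by rw [approxError]; ring
  simp only [norm_mul]
  calc _ ≤ (‖approxError N (σ + t * I)‖ + ‖etaFactor (σ + t * I) * sqrtPoly N (σ + t * I) ^ 2‖) *
        ‖gaussKernel Δ X (σ + t * I)‖ := by rw [e]; gcongr; exact norm_add_le _ _
    _ = ‖approxError N (σ + t * I)‖ * ‖gaussKernel Δ X (σ + t * I)‖ +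
      ‖etaFactor (σ + t * I)‖ * ‖sqrtPoly N (σ + t * I)‖ ^ 2 *
        ‖gaussKernel Δ X (σ + t * I)‖ := by rw [add_mul, norm_mul, norm_pow]
    _ ≤ ‖approxError N (σ + t * I)‖ * ‖gaussKernel Δ X (σ + t * I)‖ +
      3 * ‖sqrtPoly N (σ + t * I)‖ ^ 2 * (3 * gaussWeight Δ X t) := by gcongr
    _ = _ := by ring

lemma polyMoment_le {N : ℕ} (hN : 1 ≤ N) {Δ : ℝ} (hΔ : 2 ≤ Δ) (X : ℝ) {σ : ℝ} (h1 : 1 / 2 ≤ σ)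
    (h2 : σ ≤ 3 / 4) : 1 / 10 * polyMoment N Δ X σ ≤ etaMoment Δ X σ + errorMoment N Δ X σ := by
  have hS := (sqrtPoly_mean_square hN (by linarith : 0 < Δ) X (by linarith : 0 ≤ σ)).1
  have hJ := integrable_etaMoment hΔ X (σ := σ) (by linarith) (by linarith)
  have hK := integrable_errorMoment N hΔ X (σ := σ) (by linarith) (by linarith)
  rw [errorMoment, etaMoment, polyMoment, ← integral_const_mul, ← integral_add hJ hK]
  refine integral_mono (hS.const_mul _) (hJ.add hK) fun t => ?_
  have hk := gaussWeight_le_norm_gaussKernel Δ X σ t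
  have hf : 1 / 10 ≤ ‖etaFactor (σ + t * I)‖ := le_norm_etaFactor (by simp; linarith)
  have e : etaFactor (σ + t * I) * sqrtPoly N (σ + t * I) ^ 2 =
    etaFun (σ + t * I) - approxError N (σ + t * I) := by rw [approxError]; ring
  have hg := (gaussWeight_pos Δ X t).le
  simp only [norm_mul]
  calc 1 / 10 * (‖sqrtPoly N (σ + t * I)‖ ^ 2 * gaussWeight Δ X t)
      ≤ ‖etaFactor (σ + t * I)‖ * (‖sqrtPoly N (σ + t * I)‖ ^ 2 *
        ‖gaussKernel Δ X (σ + t * I)‖) := by gcongr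
    _ = ‖etaFactor (σ + t * I) * sqrtPoly N (σ + t * I) ^ 2‖ * ‖gaussKernel Δ X (σ + t * I)‖ := by
      rw [norm_mul, norm_pow]; ring
    _ ≤ (‖etaFun (σ + t * I)‖ + ‖approxError N (σ + t * I)‖) * ‖gaussKernel Δ X (σ + t * I)‖ := by
      rw [e]; gcongr; exact norm_sub_le _ _
    _ = _ := add_mul _ _ _

lemma exists_norm_zeta_five_half_le : ∃ C > 0, ∀ s : ℂ, s.re = 5 / 2 → ‖riemannZeta s‖ ≤ C := by
  obtain ⟨C, hC, h⟩ := exists_norm_zeta_sub_sqrtPoly_sq_le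
  refine ⟨C + 1, by positivity, fun s hs => ?_⟩
  have h1 := h 1 s le_rfl hs
  have h2 : ‖sqrtPoly 1 s ^ 2‖ ≤ 1 := by
    rw [norm_pow]
    have := norm_sqrtPoly_le 1 (s := s) (by linarith)
    exact pow_le_one₀ (norm_nonneg _) (by simpa using this)
  have h3 : ‖riemannZeta s‖ ≤ ‖riemannZeta s - sqrtPoly 1 s ^ 2‖ + ‖sqrtPoly 1 s ^ 2‖ := by
    have := norm_add_le (riemannZeta s - sqrtPoly 1 s ^ 2) (sqrtPoly 1 s ^ 2)
    rwa [sub_add_cancel] at this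
  simp at h1
  linarith

lemma exists_etaMoment_five_half_le : ∃ C ≥ 1, ∀ Δ X : ℝ, 2 ≤ Δ → etaMoment Δ X (5 / 2) ≤ C * Δ := by
  obtain ⟨C, hC, h⟩ := exists_norm_zeta_five_half_le
  refine ⟨9 * C * √Real.pi + 1, by linarith [show 0 < 9 * C * √Real.pi by positivity],
    fun Δ X hΔ => ?_⟩
  have hg := integrable_gaussWeight (by linarith : 0 < Δ) X
  calc etaMoment Δ X (5 / 2) ≤ ∫ t, 9 * C * gaussWeight Δ X t := by
        refine integral_mono (integrable_etaMoment hΔ X (by norm_num) le_rfl) (hg.const_mul _)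
          fun t => ?_
        have hre : (((5 / 2 : ℝ) : ℂ) + t * I).re = 5 / 2 := by simp
        have h1 : (((5 / 2 : ℝ) : ℂ) + t * I) ≠ 1 := fun h => by
          have := congrArg Complex.re h; rw [hre] at this; norm_num at this
        simp only
        rw [norm_mul, etaFun_eq h1, norm_mul]
        calc _ ≤ 3 * C * (3 * gaussWeight Δ X t) := by
              gcongr
              · exact norm_etaFactor_le (by rw [hre]; norm_num)
              · exact h _ hre
              · exact norm_gaussKernel_le hΔ (by norm_num)
          _ = _ := by ring
    _ = 9 * C * √Real.pi * Δ := by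
        rw [integral_const_mul, integral_gaussWeight (by linarith)]; ring
    _ ≤ _ := by nlinarith

lemma exists_errorMoment_five_half_le : ∃ C ≥ 1, ∀ (N : ℕ) (Δ X : ℝ), 1 ≤ N → 2 ≤ Δ →
    errorMoment N Δ X (5 / 2) ≤ C * Δ * (N : ℝ) ^ (-(7 : ℝ) / 5) := by
  obtain ⟨C, hC, h⟩ := exists_norm_zeta_sub_sqrtPoly_sq_le
  refine ⟨9 * C * √Real.pi + 1, by linarith [show 0 < 9 * C * √Real.pi by positivity],
    fun N Δ X hN hΔ => ?_⟩
  have hg := integrable_gaussWeight (by linarith : 0 < Δ) X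
  have hP : 0 ≤ (N : ℝ) ^ (-(7 : ℝ) / 5) := by positivity
  calc errorMoment N Δ X (5 / 2) ≤ ∫ t, 9 * C * (N : ℝ) ^ (-(7 : ℝ) / 5) * gaussWeight Δ X t := by
        refine integral_mono (integrable_errorMoment N hΔ X (by norm_num) le_rfl) (hg.const_mul _)
          fun t => ?_
        have hre : (((5 / 2 : ℝ) : ℂ) + t * I).re = 5 / 2 := by simp
        have h1 : (((5 / 2 : ℝ) : ℂ) + t * I) ≠ 1 := fun h => by
          have := congrArg Complex.re h; rw [hre] at this; norm_num at this
        simp only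
        rw [norm_mul, approxError, etaFun_eq h1, ← mul_sub, norm_mul]
        calc _ ≤ 3 * (C * (N : ℝ) ^ (-(7 : ℝ) / 5)) * (3 * gaussWeight Δ X t) := by
              gcongr
              · exact norm_etaFactor_le (by rw [hre]; norm_num)
              · exact h _ _ hN hre
              · exact norm_gaussKernel_le hΔ (by norm_num)
          _ = _ := by ring
    _ = 9 * C * √Real.pi * Δ * (N : ℝ) ^ (-(7 : ℝ) / 5) := by
        rw [integral_const_mul, integral_gaussWeight (by linarith)]; ring
    _ ≤ _ := by gcongr; linarith

/-- The functional equation relates the moments on symmetric lines. -/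
theorem exists_etaMoment_half_sub_le : ∃ C T₀ : ℝ, 1 ≤ C ∧ 10 ≤ T₀ ∧ ∀ T X δ : ℝ, T₀ ≤ T → T ≤ X →
    X ≤ 2 * T → 0 ≤ δ → δ ≤ 1 / 4 → etaMoment (T ^ ((9 : ℝ) / 10)) X (1 / 2 - δ) ≤
      C * (T ^ δ * etaMoment (T ^ ((9 : ℝ) / 10)) X (1 / 2 + δ) + 1) := by
  obtain ⟨C₁, hC₁, h₁⟩ := exists_norm_etaFun_half_sub_le
  obtain ⟨C₂, hC₂, h₂⟩ := exists_norm_etaFun_le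
  obtain ⟨T₁, hT₁, htail⟩ := exists_gaussWeight_tail_le
  refine ⟨4 * C₁ + 3 * C₂ * Real.pi + 1, max T₁ 10, by
    linarith [show 0 < 3 * C₂ * Real.pi by positivity], le_max_right _ _,
    fun T X δ hT hX1 hX2 hδ0 hδ1 => ?_⟩
  have hT1 : T₁ ≤ T := (le_max_left _ _).trans hT
  have hT10 : 10 ≤ T := (le_max_right _ _).trans hT
  set Δ := T ^ ((9 : ℝ) / 10) with hΔdef
  have hΔ : 2 ≤ Δ := by
    calc (2 : ℝ) ≤ 10 ^ ((1 : ℝ) / 2) := by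
          rw [← Real.sqrt_eq_rpow]; exact Real.le_sqrt_of_sq_le (by norm_num)
      _ ≤ 10 ^ ((9 : ℝ) / 10) := Real.rpow_le_rpow_of_exponent_le (by norm_num) (by norm_num)
      _ ≤ Δ := Real.rpow_le_rpow (by norm_num) hT10 (by norm_num)
  have hJ₁ := integrable_etaMoment hΔ X (σ := 1 / 2 - δ) (by linarith) (by linarith)
  have hJ₂ := integrable_etaMoment hΔ X (σ := 1 / 2 + δ) (by linarith) (by linarith)
  have hTδ : 0 < T ^ δ := by positivity
  have hpt : ∀ t : ℝ, ‖etaFun ((1 / 2 - δ : ℝ) + t * I) * gaussKernel Δ X ((1 / 2 - δ : ℝ) + t * I)‖ ≤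
      4 * C₁ * T ^ δ * ‖etaFun ((1 / 2 + δ : ℝ) + t * I) * gaussKernel Δ X ((1 / 2 + δ : ℝ) + t * I)‖ +
        3 * C₂ * (1 + t ^ 2)⁻¹ := by
    intro t
    have hsym : ‖gaussKernel Δ X ((1 / 2 - δ : ℝ) + t * I)‖ =
        ‖gaussKernel Δ X ((1 / 2 + δ : ℝ) + t * I)‖ := by
      rw [norm_gaussKernel_line, norm_gaussKernel_line]
      congr 2; ring
    rcases lt_or_ge |t - X| (T / 4) with h | h
    · have ht : 1 + |t| ≤ 4 * T := by
        have := abs_sub_abs_le_abs_sub t X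
        rw [abs_of_nonneg (by linarith : 0 ≤ X)] at this; linarith
      have h4 : (1 + |t|) ^ δ ≤ 4 * T ^ δ := by
        calc (1 + |t|) ^ δ ≤ (4 * T) ^ δ := by gcongr
          _ = 4 ^ δ * T ^ δ := Real.mul_rpow (by norm_num) (by linarith)
          _ ≤ 4 ^ (1 : ℝ) * T ^ δ := by
            gcongr
            · norm_num
            · linarith
          _ = _ := by norm_num
      have h5 : 0 ≤ 3 * C₂ * (1 + t ^ 2)⁻¹ := by positivity
      rw [norm_mul, norm_mul, hsym]
      calc _ ≤ C₁ * (4 * T ^ δ) * ‖etaFun ((1 / 2 + δ : ℝ) + t * I)‖ *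
            ‖gaussKernel Δ X ((1 / 2 + δ : ℝ) + t * I)‖ := by
            gcongr
            exact (h₁ δ t hδ0 hδ1).trans (by gcongr)
        _ ≤ _ := by linarith
    · have hw := htail T X t hT1 hX1 hX2 h
      have hk : ‖gaussKernel Δ X ((1 / 2 - δ : ℝ) + t * I)‖ ≤ 3 * gaussWeight Δ X t :=
        norm_gaussKernel_le hΔ (abs_le.2 ⟨by linarith, by linarith⟩)
      have he : ‖etaFun ((1 / 2 - δ : ℝ) + t * I)‖ ≤ C₂ * (1 + |t|) := by
        refine (h₂ _ (by simp; linarith)).trans ?_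
        gcongr
        refine (norm_add_le _ _).trans ?_
        rw [norm_mul, Complex.norm_I, mul_one, Complex.norm_real, Complex.norm_real,
          Real.norm_of_nonneg (by linarith), Real.norm_eq_abs]
        linarith
      have h6 : 0 ≤ 4 * C₁ * T ^ δ * ‖etaFun ((1 / 2 + δ : ℝ) + t * I) *
        gaussKernel Δ X ((1 / 2 + δ : ℝ) + t * I)‖ := by positivity
      have h7 : (1 + |t|) * ((1 + |t|) ^ 6)⁻¹ ≤ (1 + t ^ 2)⁻¹ := by
        have h0 : 0 < 1 + |t| := by positivity
        have : (1 + |t|) * ((1 + |t|) ^ 6)⁻¹ = ((1 + |t|) ^ 5)⁻¹ := by field_simp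
        rw [this]
        have ha := abs_nonneg t
        gcongr
        rw [← sq_abs]
        calc 1 + |t| ^ 2 ≤ (1 + |t|) ^ 2 := by nlinarith
          _ ≤ (1 + |t|) ^ 5 := pow_le_pow_right₀ (by linarith) (by norm_num)
      rw [norm_mul]
      calc _ ≤ C₂ * (1 + |t|) * (3 * ((1 + |t|) ^ 6)⁻¹) := by
            gcongr
            exact hk.trans (by gcongr)
        _ = 3 * C₂ * ((1 + |t|) * ((1 + |t|) ^ 6)⁻¹) := by ring
        _ ≤ 3 * C₂ * (1 + t ^ 2)⁻¹ := by gcongr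
        _ ≤ _ := by linarith
  have hInt2 : Integrable fun t : ℝ => 3 * C₂ * (1 + t ^ 2)⁻¹ := integrable_inv_one_add_sq.const_mul _
  calc etaMoment Δ X (1 / 2 - δ)
      ≤ ∫ t : ℝ, (4 * C₁ * T ^ δ * ‖etaFun ((1 / 2 + δ : ℝ) + t * I) *
          gaussKernel Δ X ((1 / 2 + δ : ℝ) + t * I)‖ + 3 * C₂ * (1 + t ^ 2)⁻¹) :=
        integral_mono hJ₁ ((hJ₂.const_mul _).add hInt2) hpt
    _ = 4 * C₁ * (T ^ δ * etaMoment Δ X (1 / 2 + δ)) + 3 * C₂ * Real.pi := by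
        rw [integral_add (hJ₂.const_mul _) hInt2, integral_const_mul, integral_const_mul,
          integral_univ_inv_one_add_sq, etaMoment, mul_assoc (4 * C₁)]
    _ ≤ _ := by
        have h1 : 0 ≤ T ^ δ * etaMoment Δ X (1 / 2 + δ) :=
          mul_nonneg hTδ.le (etaMoment_nonneg _ _ _)
        have h2 : 0 < 3 * C₂ * Real.pi := by positivity
        nlinarith

/-- The width of the Gaussian weights. -/
noncomputable def width (T : ℝ) : ℝ := T ^ ((9 : ℝ) / 10)

/-- The length of the approximating Dirichlet polynomial. -/
noncomputable def polyLength (T : ℝ) : ℕ := ⌊T ^ ((4 : ℝ) / 5)⌋₊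

lemma eventually_params : ∀ᶠ T : ℝ in atTop, 2 ≤ width T ∧ 1 ≤ polyLength T ∧
    3 / 4 * Real.log T ≤ Real.log (polyLength T) ∧ Real.log (polyLength T) ≤ Real.log T ∧
    (polyLength T : ℝ) ^ 2 * Real.exp (-(width T ^ 2 / (4 * (polyLength T : ℝ) ^ 2))) ≤ 1 := by
  have hx : Tendsto (fun T : ℝ => T ^ ((1 : ℝ) / 5) / 4) atTop atTop :=
    (tendsto_rpow_atTop (by norm_num)).atTop_div_const (by norm_num)
  have he := (Real.tendsto_pow_mul_exp_neg_atTop_nhds_zero 8).comp hx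
  have he' := he.eventually (gt_mem_nhds (show (0 : ℝ) < 1 / 4 ^ 8 by norm_num))
  have hL := Real.tendsto_log_atTop.eventually_ge_atTop (20 * Real.log 2)
  have hw : Tendsto width atTop atTop := tendsto_rpow_atTop (by norm_num)
  filter_upwards [he', hL, eventually_ge_atTop 1, hw.eventually_ge_atTop 2] with T h1 h2 hT hw2
  have hT0 : 0 < T := by linarith
  have h45 : 1 ≤ T ^ ((4 : ℝ) / 5) := Real.one_le_rpow hT (by norm_num)
  have hN1 : 1 ≤ polyLength T := Nat.le_floor (by simpa using h45)
  have hN0 : (0 : ℝ) < polyLength T := by exact_mod_cast hN1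
  have hNle : (polyLength T : ℝ) ≤ T ^ ((4 : ℝ) / 5) := Nat.floor_le (by positivity)
  have hNge : T ^ ((4 : ℝ) / 5) / 2 ≤ polyLength T := by
    have := Nat.lt_floor_add_one (T ^ ((4 : ℝ) / 5))
    have h3 : (1 : ℝ) ≤ polyLength T := by exact_mod_cast hN1
    change _ < (polyLength T : ℝ) + 1 at this
    linarith
  have hlog0 : 0 ≤ Real.log T := Real.log_nonneg hT
  refine ⟨hw2, hN1, ?_, ?_, ?_⟩
  · have := Real.log_le_log (by positivity) hNge
    rw [Real.log_div (by positivity) (by norm_num), Real.log_rpow hT0] at this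
    linarith
  · have := Real.log_le_log hN0 hNle
    rw [Real.log_rpow hT0] at this
    linarith
  · set x := T ^ ((1 : ℝ) / 5) with hxdef
    have hx0 : 0 < x := by positivity
    have e8 : (T ^ ((4 : ℝ) / 5)) ^ 2 = x ^ 8 := by
      rw [hxdef, ← Real.rpow_natCast, ← Real.rpow_mul hT0.le, ← Real.rpow_natCast,
        ← Real.rpow_mul hT0.le]
      norm_num
    have e9 : width T ^ 2 = x ^ 9 := by
      rw [hxdef, width, ← Real.rpow_natCast, ← Real.rpow_mul hT0.le, ← Real.rpow_natCast,
        ← Real.rpow_mul hT0.le]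
      norm_num
    have hN8 : (polyLength T : ℝ) ^ 2 ≤ x ^ 8 := by rw [← e8]; gcongr
    have h3 : x / 4 ≤ width T ^ 2 / (4 * (polyLength T : ℝ) ^ 2) := by
      rw [e9, le_div_iff₀ (by positivity)]
      calc x / 4 * (4 * (polyLength T : ℝ) ^ 2) = x * (polyLength T : ℝ) ^ 2 := by ring
        _ ≤ x * x ^ 8 := by gcongr
        _ = _ := by ring
    simp only [Function.comp] at h1
    calc _ ≤ x ^ 8 * Real.exp (-(x / 4)) := by gcongr
      _ = 4 ^ 8 * ((x / 4) ^ 8 * Real.exp (-(x / 4))) := by ring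
      _ ≤ 4 ^ 8 * (1 / 4 ^ 8) := by gcongr
      _ = 1 := by norm_num

lemma exists_polyMoment_le : ∃ C ≥ 1, ∀ᶠ T : ℝ in atTop, ∀ X σ : ℝ, 1 / 2 ≤ σ →
    polyMoment (polyLength T) (width T) X σ ≤ C * (width T * Real.log T ^ ((1 : ℝ) / 4)) := by
  obtain ⟨C, y₀, hC, h⟩ := exists_sum_sqrtZeta_sq_div_le
  refine ⟨√Real.pi * (C + 1) + 1, by
    linarith [show 0 < √Real.pi * (C + 1) by positivity], ?_⟩
  filter_upwards [eventually_params, Real.tendsto_log_atTop.eventually_ge_atTop (max y₀ 1)]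
    with T ⟨hw, hN, hN2, hN3, hN4⟩ hL X σ hσ
  have hL1 : 1 ≤ Real.log T := (le_max_right _ _).trans hL
  have hs := h (Real.log T) (polyLength T) ((le_max_left _ _).trans hL) hN3
  have hms := (sqrtPoly_mean_square hN (by linarith : 0 < width T) X (by linarith : 0 ≤ σ)).2
  have h1 := (abs_le.1 hms).2
  have hle : ∑ n ∈ Finset.Icc 1 (polyLength T), sqrtZeta n ^ 2 * (n : ℝ) ^ (-(2 * σ)) ≤
      C * Real.log T ^ ((1 : ℝ) / 4) := by
    refine le_trans (Finset.sum_le_sum fun n hn => ?_) hs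
    rw [Finset.mem_Icc] at hn
    gcongr
    · exact_mod_cast hn.1
    · linarith
  have hL4 : 1 ≤ Real.log T ^ ((1 : ℝ) / 4) := Real.one_le_rpow hL1 (by norm_num)
  have hpw : 0 < √Real.pi * width T := by have : 0 < width T := by linarith
                                          positivity
  have hwL : 0 ≤ width T * Real.log T ^ ((1 : ℝ) / 4) := by
    have : 0 < width T := by linarith
    positivity
  have h2 : polyMoment (polyLength T) (width T) X σ ≤
      √Real.pi * width T * (C * Real.log T ^ ((1 : ℝ) / 4)) +
        √Real.pi * width T * Real.log T ^ ((1 : ℝ) / 4) := by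
    have h3 := mul_le_mul_of_nonneg_left hle hpw.le
    have h4 := mul_le_mul_of_nonneg_left (hN4.trans hL4) hpw.le
    unfold polyMoment
    linarith
  refine h2.trans ?_
  linarith

lemma exists_le_polyMoment : ∃ a c₀ : ℝ, 0 < a ∧ ∀ c ≥ c₀, 0 < c → ∀ᶠ T : ℝ in atTop, ∀ X : ℝ,
    a * c ^ (-(1 : ℝ) / 4) * (width T * Real.log T ^ ((1 : ℝ) / 4)) ≤
      polyMoment (polyLength T) (width T) X (1 / 2 + c / Real.log T) := by
  obtain ⟨a, c₀, ha, h⟩ := exists_le_sum_sqrtZeta_sq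
  refine ⟨√Real.pi * a / 2, c₀, by positivity, fun c hc hc0 => ?_⟩
  obtain ⟨y₀, hy⟩ := h c hc
  have hbig : Tendsto (fun T : ℝ => a * c ^ (-(1 : ℝ) / 4) / 2 * Real.log T ^ ((1 : ℝ) / 4))
      atTop atTop :=
    ((tendsto_rpow_atTop (by norm_num)).comp Real.tendsto_log_atTop).const_mul_atTop
      (by positivity)
  filter_upwards [eventually_params, Real.tendsto_log_atTop.eventually_ge_atTop (max y₀ 1),
    hbig.eventually_ge_atTop 1] with T ⟨hw, hN, hN2, hN3, hN4⟩ hL hb X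
  have hL1 : 1 ≤ Real.log T := (le_max_right _ _).trans hL
  have hs := hy (Real.log T) (polyLength T) ((le_max_left _ _).trans hL) (by linarith)
  have hms := (sqrtPoly_mean_square hN (by linarith : 0 < width T) X
    (by positivity : 0 ≤ 1 / 2 + c / Real.log T)).2
  have h1 := (abs_le.1 hms).1
  have hpw : 0 < √Real.pi * width T := by have : 0 < width T := by linarith
                                          positivity
  have e : (fun n : ℕ => sqrtZeta n ^ 2 * (n : ℝ) ^ (-(2 * (1 / 2 + c / Real.log T)))) =
      fun n : ℕ => sqrtZeta n ^ 2 * (n : ℝ) ^ (-(1 + 2 * (c / Real.log T))) := by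
    funext n; congr 2; ring
  rw [e] at h1
  have e2 : (Real.log T / c) ^ ((1 : ℝ) / 4) = c ^ (-(1 : ℝ) / 4) * Real.log T ^ ((1 : ℝ) / 4) := by
    rw [Real.div_rpow (by linarith) hc0.le, div_eq_mul_inv, ← Real.rpow_neg hc0.le, mul_comm]
    congr 2; norm_num
  rw [e2] at hs
  have h3 := mul_le_mul_of_nonneg_left hs hpw.le
  have h4 := mul_le_mul_of_nonneg_left (hN4.trans hb) hpw.le
  unfold polyMoment
  linarith

lemma width_pos {T : ℝ} (hT : 0 < T) : 0 < width T := Real.rpow_pos_of_pos hT _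

/-- The approximation error is small on the line `Re s = 1/2 + c/log T`. -/
lemma exists_errorMoment_le : ∃ C ≥ 1, ∀ c > 0, ∀ᶠ T : ℝ in atTop, ∀ X : ℝ,
    errorMoment (polyLength T) (width T) X (1 / 2 + c / Real.log T) ≤
      C * (etaMoment (width T) X (1 / 2) + width T * Real.log T ^ ((1 : ℝ) / 4)) *
        Real.exp (-(21 / 40 * c)) := by
  obtain ⟨C₁, hC₁, h₁⟩ := exists_polyMoment_le
  obtain ⟨C₂, hC₂, h₂⟩ := exists_errorMoment_five_half_le
  refine ⟨9 * C₁ * C₂, by nlinarith, fun c hc => ?_⟩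
  filter_upwards [h₁, eventually_params, Real.tendsto_log_atTop.eventually_ge_atTop (max 1 (4 * c)),
    eventually_ge_atTop 1] with T hP ⟨hw, hN, hN2, hN3, hN4⟩ hL hT X
  have hL1 : 1 ≤ Real.log T := (le_max_left _ _).trans hL
  have hLc : 4 * c ≤ Real.log T := (le_max_right _ _).trans hL
  set L := Real.log T with hLdef
  set W := width T
  set N := polyLength T
  have hW0 : 0 < W := by linarith
  set δ := c / L with hδ
  have hδ0 : 0 < δ := by positivity
  have hδ1 : δ ≤ 1 / 4 := by rw [hδ, div_le_iff₀ (by linarith)]; linarith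
  set M := 9 * C₁ * (etaMoment W X (1 / 2) + W * L ^ ((1 : ℝ) / 4)) with hM
  have hL4 : 1 ≤ L ^ ((1 : ℝ) / 4) := Real.one_le_rpow hL1 (by norm_num)
  have hJ0 := etaMoment_nonneg W X (1 / 2)
  have hWL : W ≤ W * L ^ ((1 : ℝ) / 4) := le_mul_of_one_le_right hW0.le hL4
  have hMW : W ≤ M := by rw [hM]; nlinarith
  have hM0 : 0 < M := by linarith
  have hK1 : errorMoment N W X (1 / 2) ≤ M := by
    have := errorMoment_le hN hw X (σ := 1 / 2) le_rfl (by norm_num)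
    have h3 := hP X (1 / 2) le_rfl
    rw [hM]; nlinarith
  have hK2 : errorMoment N W X (5 / 2) ≤ M * (C₂ * Real.exp (-(21 / 20 * L))) := by
    refine (h₂ N W X hN hw).trans ?_
    have hN0 : (0 : ℝ) < N := by exact_mod_cast hN
    have : (N : ℝ) ^ (-(7 : ℝ) / 5) ≤ Real.exp (-(21 / 20 * L)) := by
      rw [Real.rpow_def_of_pos hN0]
      exact Real.exp_le_exp.2 (by linarith)
    calc C₂ * W * (N : ℝ) ^ (-(7 : ℝ) / 5) ≤ C₂ * M * Real.exp (-(21 / 20 * L)) := by gcongr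
      _ = _ := by ring
  have hfac : (C₂ * Real.exp (-(21 / 20 * L))) ^ (δ / 2) ≤ C₂ * Real.exp (-(21 / 40 * c)) := by
    rw [Real.mul_rpow (by linarith) (Real.exp_pos _).le, ← Real.exp_mul]
    have e : -(21 / 20 * L) * (δ / 2) = -(21 / 40 * c) := by
      rw [hδ]; field_simp; norm_num
    rw [e]
    gcongr
    exact Real.rpow_le_self_of_one_le hC₂ (by linarith)
  calc errorMoment N W X (1 / 2 + δ)
      ≤ errorMoment N W X (1 / 2) ^ (1 - δ / 2) * errorMoment N W X (5 / 2) ^ (δ / 2) :=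
        errorMoment_le_interp N hw X hδ0.le hδ1
    _ ≤ M ^ (1 - δ / 2) * (M * (C₂ * Real.exp (-(21 / 20 * L)))) ^ (δ / 2) := by
        have h5 := errorMoment_nonneg N W X (1 / 2)
        have h6 := errorMoment_nonneg N W X (5 / 2)
        gcongr
        linarith
    _ = M * (C₂ * Real.exp (-(21 / 20 * L))) ^ (δ / 2) := by
        rw [Real.mul_rpow hM0.le (by positivity), ← mul_assoc, ← Real.rpow_add hM0]
        norm_num
    _ ≤ M * (C₂ * Real.exp (-(21 / 40 * c))) := by gcongr
    _ = _ := by rw [hM]; ring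

/-- Upper bound for the smoothed first moment on the critical line. -/
theorem exists_etaMoment_half_le : ∃ A ≥ 1, ∀ᶠ T : ℝ in atTop, ∀ X : ℝ, T ≤ X → X ≤ 2 * T →
    etaMoment (width T) X (1 / 2) ≤ A * (width T * Real.log T ^ ((1 : ℝ) / 4)) := by
  obtain ⟨C₁, hC₁, h₁⟩ := exists_polyMoment_le
  obtain ⟨C₂, hC₂, h₂⟩ := exists_errorMoment_le
  obtain ⟨C₃, T₃, hC₃, hT₃, h₃⟩ := exists_etaMoment_half_sub_le
  obtain ⟨c, hc1, hc⟩ : ∃ c : ℝ, 1 ≤ c ∧ C₃ * C₂ * Real.exp (-(c / 40)) ≤ 1 / 2 := by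
    have h : Tendsto (fun c : ℝ => C₃ * C₂ * Real.exp (-(c / 40))) atTop (𝓝 (C₃ * C₂ * 0)) :=
      (Real.tendsto_exp_neg_atTop_nhds_zero.comp
        (tendsto_id.atTop_div_const (by norm_num))).const_mul _
    rw [mul_zero] at h
    obtain ⟨c, h1, h2⟩ :=
      ((eventually_ge_atTop 1).and (h.eventually (ge_mem_nhds (by norm_num : (0 : ℝ) < 1 / 2)))).exists
    exact ⟨c, h1, h2⟩
  have hc0 : 0 < c := by linarith
  refine ⟨2 * (C₃ * Real.exp (c / 2) * (9 * C₁ + C₂ + 1)), ?_, ?_⟩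
  · have h1 : 1 ≤ Real.exp (c / 2) := Real.one_le_exp (by linarith)
    have h2 : 1 ≤ C₃ * Real.exp (c / 2) := one_le_mul_of_one_le_of_one_le hC₃ h1
    nlinarith
  filter_upwards [h₁, h₂ c hc0, eventually_params, eventually_ge_atTop T₃,
    Real.tendsto_log_atTop.eventually_ge_atTop (max 1 (4 * c)), eventually_ge_atTop 1]
    with T hP hE ⟨hw, hN, hN2, hN3, hN4⟩ hT3 hL hT X hX1 hX2
  have hL1 : 1 ≤ Real.log T := (le_max_left _ _).trans hL
  have hLc : 4 * c ≤ Real.log T := (le_max_right _ _).trans hL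
  have hsub := h₃ T X (c / Real.log T) hT3 hX1 hX2 (by positivity)
    (by rw [div_le_iff₀ (by linarith)]; linarith)
  have hTδ : T ^ (c / Real.log T) = Real.exp c := by
    rw [Real.rpow_def_of_pos (by linarith)]; congr 1; field_simp
  rw [hTδ] at hsub
  change etaMoment (width T) X _ ≤ C₃ * (_ * etaMoment (width T) X _ + 1) at hsub
  have hE := hE X
  have hP := hP X (1 / 2 + c / Real.log T) (by linarith [show 0 < c / Real.log T by positivity])
  set L := Real.log T with hLdef
  set W := width T
  set N := polyLength T
  have hW0 : 0 < W := by linarith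
  set δ := c / L with hδ
  have hδ0 : 0 < δ := by positivity
  have hδ1 : δ ≤ 1 / 4 := by rw [hδ, div_le_iff₀ (by linarith)]; linarith
  have hL4 : 1 ≤ L ^ ((1 : ℝ) / 4) := Real.one_le_rpow hL1 (by norm_num)
  have hJ0 := etaMoment_nonneg W X (1 / 2)
  set Q := W * L ^ ((1 : ℝ) / 4)
  have hQ1 : 1 ≤ Q := by nlinarith
  set J := etaMoment W X (1 / 2)
  set Jp := etaMoment W X (1 / 2 + δ) with hJp
  have hJp0 : 0 ≤ Jp := etaMoment_nonneg _ _ _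
  have hJp1 : Jp ≤ C₂ * (J + Q) * Real.exp (-(21 / 40 * c)) + 9 * (C₁ * Q) := by
    have := etaMoment_le hN hw X (σ := 1 / 2 + δ) (by linarith) (by linarith)
    linarith
  have hstep : J ≤ C₃ * Real.exp (c / 2) * (Jp + 1) := by
    have h5 := etaMoment_half_le hw X hδ0 hδ1
    have h6 : etaMoment W X (1 / 2 - δ) ≤ (C₃ * Real.exp (c / 2)) ^ 2 * (Jp + 1) := by
      refine hsub.trans ?_
      have e : (C₃ * Real.exp (c / 2)) ^ 2 = C₃ ^ 2 * Real.exp c := by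
        rw [mul_pow, ← Real.exp_nat_mul]; congr 2; push_cast; ring
      rw [e]
      have h7 : 1 ≤ Real.exp c := Real.one_le_exp hc0.le
      calc C₃ * (Real.exp c * Jp + 1) ≤ C₃ * (Real.exp c * Jp + Real.exp c) := by gcongr
        _ = C₃ * 1 * Real.exp c * (Jp + 1) := by ring
        _ ≤ C₃ * C₃ * Real.exp c * (Jp + 1) := by gcongr
        _ = _ := by ring
    have h8 := etaMoment_nonneg W X (1 / 2 - δ)
    calc J ≤ _ := h5
      _ ≤ ((C₃ * Real.exp (c / 2)) ^ 2 * (Jp + 1)) ^ ((1 : ℝ) / 2) * (Jp + 1) ^ ((1 : ℝ) / 2) := by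
        gcongr
        linarith
      _ = _ := by
        rw [Real.mul_rpow (by positivity) (by positivity), mul_assoc,
          ← Real.rpow_add (by positivity), ← Real.sqrt_eq_rpow, Real.sqrt_sq (by positivity)]
        norm_num
  have hexp : Real.exp (c / 2) * Real.exp (-(21 / 40 * c)) = Real.exp (-(c / 40)) := by
    rw [← Real.exp_add]; congr 1; ring
  have hexp1 : Real.exp (-(21 / 40 * c)) ≤ 1 := Real.exp_le_one_iff.2 (by linarith)
  have he0 : 0 < Real.exp (c / 2) := Real.exp_pos _
  have hmain : J ≤ 1 / 2 * J + C₃ * Real.exp (c / 2) * (9 * C₁ + C₂ + 1) * Q := by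
    calc J ≤ C₃ * Real.exp (c / 2) * (Jp + 1) := hstep
      _ ≤ C₃ * Real.exp (c / 2) *
          (C₂ * (J + Q) * Real.exp (-(21 / 40 * c)) + 9 * (C₁ * Q) + Q) := by gcongr
      _ = C₃ * C₂ * (Real.exp (c / 2) * Real.exp (-(21 / 40 * c))) * J +
          C₃ * Real.exp (c / 2) * (9 * C₁ + C₂ * Real.exp (-(21 / 40 * c)) + 1) * Q := by ring
      _ ≤ 1 / 2 * J + C₃ * Real.exp (c / 2) * (9 * C₁ + C₂ * 1 + 1) * Q := by
        rw [hexp]; gcongr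
      _ = _ := by ring
  linarith

/-- Lower bound for the smoothed first moment on the critical line. -/
theorem exists_le_etaMoment_half : ∃ a > 0, ∀ᶠ T : ℝ in atTop, ∀ X : ℝ, T ≤ X → X ≤ 2 * T →
    a * (width T * Real.log T ^ ((1 : ℝ) / 4)) ≤ etaMoment (width T) X (1 / 2) := by
  obtain ⟨a, c₀, ha, h₁⟩ := exists_le_polyMoment
  obtain ⟨C₂, hC₂, h₂⟩ := exists_errorMoment_le
  obtain ⟨A, hA, h₃⟩ := exists_etaMoment_half_le
  obtain ⟨B, hB, h₄⟩ := exists_etaMoment_five_half_le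
  obtain ⟨c, hc1, hcc, hc⟩ : ∃ c : ℝ, 1 ≤ c ∧ c₀ ≤ c ∧
      C₂ * (A + 1) * Real.exp (-(21 / 40 * c)) ≤ a * c ^ (-(1 : ℝ) / 4) / 20 := by
    have h := tendsto_rpow_mul_exp_neg_mul_atTop_nhds_zero ((1 : ℝ) / 4) (21 / 40) (by norm_num)
    have h' := h.eventually (ge_mem_nhds (by positivity : 0 < a / 20 / (C₂ * (A + 1))))
    obtain ⟨c, h1, h2, h3⟩ :=
      ((eventually_ge_atTop 1).and ((eventually_ge_atTop c₀).and h')).exists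
    refine ⟨c, h1, h2, ?_⟩
    have hc0 : 0 < c := by linarith
    rw [le_div_iff₀ (by positivity)] at h3
    have h4 : c ^ ((1 : ℝ) / 4) * c ^ (-(1 : ℝ) / 4) = 1 := by
      rw [← Real.rpow_add hc0]; norm_num
    have h5 : 0 < c ^ (-(1 : ℝ) / 4) := by positivity
    have e : -(21 / 40 * c) = -(21 / 40) * c := by ring
    rw [e]
    calc C₂ * (A + 1) * Real.exp (-(21 / 40) * c)
        = (c ^ ((1 : ℝ) / 4) * Real.exp (-(21 / 40) * c) * (C₂ * (A + 1))) * c ^ (-(1 : ℝ) / 4) := by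
          linear_combination (-(C₂ * (A + 1) * Real.exp (-(21 / 40) * c))) * h4
      _ ≤ a / 20 * c ^ (-(1 : ℝ) / 4) := by gcongr
      _ = _ := by ring
  have hc0 : 0 < c := by linarith
  set b := a * c ^ (-(1 : ℝ) / 4) / 20 with hb
  have hb0 : 0 < b := by positivity
  set a' := min 1 ((b / B) ^ 2 / 4) with ha'
  have ha'0 : 0 < a' := lt_min one_pos (by positivity)
  have ha'1 : a' ≤ 1 := min_le_left _ _
  have hsq : √a' * B < b := by
    have h1 : √a' ≤ (b / B) / 2 := by
      rw [Real.sqrt_le_left (by positivity)]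
      exact (min_le_right _ _).trans (by ring_nf; rfl)
    calc √a' * B ≤ b / B / 2 * B := by gcongr
      _ = b / 2 := by field_simp
      _ < b := by linarith
  refine ⟨a', ha'0, ?_⟩
  filter_upwards [h₁ c hcc hc0, h₂ c hc0, h₃, eventually_params,
    Real.tendsto_log_atTop.eventually_ge_atTop (max 1 (4 * c)), eventually_ge_atTop 1]
    with T hP hE hU ⟨hw, hN, hN2, hN3, hN4⟩ hL hT X hX1 hX2
  have hL1 : 1 ≤ Real.log T := (le_max_left _ _).trans hL
  have hLc : 4 * c ≤ Real.log T := (le_max_right _ _).trans hL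
  have hE := hE X
  have hP := hP X
  have hU := hU X hX1 hX2
  have hF := h₄ (width T) X hw
  set L := Real.log T with hLdef
  set W := width T
  set N := polyLength T
  have hW0 : 0 < W := by linarith
  set δ := c / L with hδ
  have hδ0 : 0 < δ := by positivity
  have hδ1 : δ ≤ 1 / 4 := by rw [hδ, div_le_iff₀ (by linarith)]; linarith
  have hL4 : 1 ≤ L ^ ((1 : ℝ) / 4) := Real.one_le_rpow hL1 (by norm_num)
  have hJ0 := etaMoment_nonneg W X (1 / 2)
  have hWL : W ≤ W * L ^ ((1 : ℝ) / 4) := le_mul_of_one_le_right hW0.le hL4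
  set Q := W * L ^ ((1 : ℝ) / 4)
  have hQ0 : 0 < Q := by linarith
  set J := etaMoment W X (1 / 2)
  have hlow : b * Q ≤ etaMoment W X (1 / 2 + δ) := by
    have h5 := polyMoment_le hN hw X (σ := 1 / 2 + δ) (by linarith) (by linarith)
    have h6 : errorMoment N W X (1 / 2 + δ) ≤ b * Q := by
      calc _ ≤ C₂ * (J + Q) * Real.exp (-(21 / 40 * c)) := hE
        _ ≤ C₂ * (A * Q + Q) * Real.exp (-(21 / 40 * c)) := by gcongr
        _ = C₂ * (A + 1) * Real.exp (-(21 / 40 * c)) * Q := by ring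
        _ ≤ b * Q := by gcongr
    have h7 : 1 / 10 * (a * c ^ (-(1 : ℝ) / 4) * Q) = 2 * b * Q := by rw [hb]; ring
    linarith
  by_contra! hcon
  have hInt := etaMoment_le_interp hw X hδ0.le hδ1
  have h8 := etaMoment_nonneg W X (5 / 2)
  have : etaMoment W X (1 / 2 + δ) ≤ √a' * B * Q := by
    calc _ ≤ _ := hInt
      _ ≤ (a' * Q) ^ (1 - δ / 2) * (B * Q) ^ (δ / 2) := by
        have h9 : etaMoment W X (5 / 2) ≤ B * Q := hF.trans (by gcongr)
        gcongr
        linarith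
      _ = a' ^ (1 - δ / 2) * B ^ (δ / 2) * Q := by
        have e : Q ^ (1 - δ / 2) * Q ^ (δ / 2) = Q := by
          rw [← Real.rpow_add hQ0]; norm_num
        rw [Real.mul_rpow ha'0.le hQ0.le, Real.mul_rpow (by linarith) hQ0.le]
        linear_combination (a' ^ (1 - δ / 2) * B ^ (δ / 2)) * e
      _ ≤ √a' * B * Q := by
        gcongr
        · rw [Real.sqrt_eq_rpow]
          exact Real.rpow_le_rpow_of_exponent_ge ha'0 ha'1 (by linarith)
        · exact Real.rpow_le_self_of_one_le hB (by linarith)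
  have h10 : √a' * B * Q < b * Q := by gcongr
  linarith

lemma integrableOn_cpow_mul_exp_neg {a r : ℂ} (ha : 0 < a.re) (hr : 0 < r.re) :
    IntegrableOn (fun x : ℝ => (x : ℂ) ^ (a - 1) * cexp (-(r * x))) (Ioi 0) := by
  have hm : IntegrableOn (fun x : ℝ => x ^ (a.re - 1) * Real.exp (-(r.re * x))) (Ioi 0) := by
    have := integrableOn_rpow_mul_exp_neg_mul_rpow (p := 1) (s := a.re - 1) (b := r.re)
      (by linarith) one_pos hr
    refine this.congr_fun (fun x _ => ?_) measurableSet_Ioi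
    simp
  refine Integrable.mono' hm ?_ ?_
  · refine ContinuousOn.aestronglyMeasurable ?_ measurableSet_Ioi
    refine ContinuousOn.mul (fun x hx => ?_) (by fun_prop)
    have : ContinuousAt (fun x : ℝ => (x : ℂ) ^ (a - 1)) x :=
      Complex.continuousAt_ofReal_cpow_const x _ (Or.inr (ne_of_gt hx))
    exact this.continuousWithinAt
  · refine (ae_restrict_mem measurableSet_Ioi).mono fun x hx => ?_
    rw [norm_mul, Complex.norm_cpow_eq_rpow_re_of_pos hx, Complex.norm_exp]
    simp

/-- The Laplace transform of a power, for complex parameters. -/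
theorem integral_cpow_mul_exp_neg_mul_Ioi_complex {a r : ℂ} (ha : 0 < a.re) (hr : 0 < r.re) :
    ∫ x : ℝ in Ioi 0, (x : ℂ) ^ (a - 1) * cexp (-(r * x)) = r ^ (-a) * Complex.Gamma a := by
  set U : Set ℂ := {z | 0 < z.re}
  have hU : IsOpen U := isOpen_lt continuous_const Complex.continuous_re
  have hUc : IsPreconnected U := (convex_halfSpace_re_gt 0).isPreconnected
  have hd1 : DifferentiableOn ℂ
      (fun r : ℂ => ∫ x : ℝ in Ioi 0, (x : ℂ) ^ (a - 1) * cexp (-(r * x))) U := by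
    intro r₀ hr₀
    have hr₀' : 0 < r₀.re := hr₀
    have hb0 : 0 < ((r₀.re / 2 : ℝ) : ℂ).re := by rw [Complex.ofReal_re]; linarith
    have ha1 : 0 < (a + 1).re := by simp; linarith
    have hbound := (integrableOn_cpow_mul_exp_neg ha1 hb0).norm
    have := hasDerivAt_integral_of_dominated_loc_of_deriv_le (μ := volume.restrict (Ioi (0 : ℝ)))
      (F := fun (r : ℂ) (x : ℝ) => (x : ℂ) ^ (a - 1) * cexp (-(r * x)))
      (F' := fun (r : ℂ) (x : ℝ) => (x : ℂ) ^ (a - 1) * (cexp (-(r * x)) * (-x)))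
      (x₀ := r₀) (s := Metric.ball r₀ (r₀.re / 2))
      (bound := fun x : ℝ => ‖(x : ℂ) ^ (a + 1 - 1) * cexp (-(((r₀.re / 2 : ℝ) : ℂ) * x))‖)
      (Metric.ball_mem_nhds _ (by linarith)) ?_ ?_ ?_ ?_ hbound ?_
    · exact this.2.differentiableAt.differentiableWithinAt
    · filter_upwards [hU.mem_nhds hr₀] with r hr
      exact (integrableOn_cpow_mul_exp_neg ha hr).aestronglyMeasurable
    · exact integrableOn_cpow_mul_exp_neg ha hr₀
    · refine ContinuousOn.aestronglyMeasurable ?_ measurableSet_Ioi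
      refine ContinuousOn.mul (fun x hx => ?_) (by fun_prop)
      have : ContinuousAt (fun x : ℝ => (x : ℂ) ^ (a - 1)) x :=
        Complex.continuousAt_ofReal_cpow_const x _ (Or.inr (ne_of_gt hx))
      exact this.continuousWithinAt
    · refine (ae_restrict_mem measurableSet_Ioi).mono fun x hx r hr => ?_
      have hx0 : (0 : ℝ) < x := hx
      have hre : r₀.re / 2 ≤ r.re := by
        rw [Metric.mem_ball, dist_eq_norm] at hr
        have := (abs_le.1 (Complex.abs_re_le_norm (r - r₀))).1
        rw [Complex.sub_re] at this; linarith
      have e1 : (x : ℂ) ^ (a + 1 - 1) = (x : ℂ) ^ (a - 1) * x := by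
        rw [show a + 1 - 1 = a - 1 + 1 by ring,
          Complex.cpow_add _ _ (by exact_mod_cast hx0.ne'), Complex.cpow_one]
      rw [e1]
      simp only [norm_mul, norm_neg, Complex.norm_exp]
      have : (-(r * x)).re ≤ (-(((r₀.re / 2 : ℝ) : ℂ) * x)).re := by
        simp
        nlinarith
      have h2 := Real.exp_le_exp.2 this
      calc _ = ‖(x : ℂ) ^ (a - 1)‖ * ‖(x : ℂ)‖ * Real.exp (-(r * x)).re := by ring
        _ ≤ _ := by gcongr
    · refine ae_of_all _ fun x r _ => ?_
      refine HasDerivAt.const_mul _ ?_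
      have h1 : HasDerivAt (fun r : ℂ => -(r * x)) (-x) r := by
        have := ((hasDerivAt_id r).mul_const (x : ℂ)).neg
        rw [one_mul] at this
        exact this
      exact h1.cexp
  have hd2 : DifferentiableOn ℂ (fun r : ℂ => r ^ (-a) * Complex.Gamma a) U := by
    intro z hz
    refine (DifferentiableAt.mul_const ?_ _).differentiableWithinAt
    exact differentiableAt_id.cpow_const (Or.inl hz)
  have heq := (hd1.analyticOnNhd hU).eqOn_of_preconnected_of_frequently_eq (hd2.analyticOnNhd hU)
    hUc (z₀ := 1) (by simp [U]) ?_
  · exact heq hr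
  have hT : Tendsto (fun n : ℕ => ((1 + 1 / ((n : ℝ) + 1) : ℝ) : ℂ)) atTop (𝓝[≠] 1) := by
    refine tendsto_nhdsWithin_iff.2 ⟨?_, Eventually.of_forall fun n => ?_⟩
    · have := (tendsto_one_div_add_atTop_nhds_zero_nat (𝕜 := ℝ)).const_add 1
      rw [add_zero] at this
      have h2 := (Complex.continuous_ofReal.tendsto 1).comp this
      simpa [Function.comp_def] using h2
    · have : (0 : ℝ) < 1 / ((n : ℝ) + 1) := by positivity
      intro h
      have h2 : (1 + 1 / ((n : ℝ) + 1) : ℝ) = 1 := by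
        have h := Set.mem_singleton_iff.1 h
        exact_mod_cast h
      linarith
  refine hT.frequently (Frequently.of_forall fun n => ?_)
  have hp : (0 : ℝ) < 1 + 1 / ((n : ℝ) + 1) := by positivity
  generalize 1 + 1 / ((n : ℝ) + 1) = ρ at hp
  have := Complex.integral_cpow_mul_exp_neg_mul_Ioi ha hp
  rw [this, one_div, Complex.inv_cpow _ _ (by
    rw [Complex.arg_ofReal_of_nonneg hp.le]; exact Real.pi_pos.ne), Complex.cpow_neg]

lemma GammaR_half_ne_zero (t : ℝ) : Gammaℝ (1 / 2 + t * I) ≠ 0 :=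
  Gammaℝ_ne_zero_of_re_pos (by simp)

lemma half_line_ne (t : ℝ) : (1 / 2 + t * I : ℂ) ≠ 0 ∧ (1 / 2 + t * I : ℂ) ≠ 1 := by
  constructor
  · intro h; have := congrArg Complex.re h; simp at this
  · intro h; have := congrArg Complex.re h; norm_num at this

lemma completedZeta_eq (t : ℝ) : completedRiemannZeta (1 / 2 + t * I) =
    Gammaℝ (1 / 2 + t * I) * riemannZeta (1 / 2 + t * I) := by
  rw [riemannZeta_def_of_ne_zero (half_line_ne t).1]
  rw [mul_comm (Gammaℝ _), div_mul_cancel₀ _ (GammaR_half_ne_zero t)]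

lemma GammaR_conj (s : ℂ) : Gammaℝ ((starRingEnd ℂ) s) = (starRingEnd ℂ) (Gammaℝ s) := by
  have h2 : (starRingEnd ℂ) s / 2 = (starRingEnd ℂ) (s / 2) := by
    rw [map_div₀, Complex.conj_ofNat]
  have hpi : (Real.pi : ℂ) ≠ 0 := by exact_mod_cast Real.pi_ne_zero
  rw [Gammaℝ_def, Gammaℝ_def, map_mul, h2, Complex.Gamma_conj, Complex.cpow_def_of_ne_zero hpi,
    Complex.cpow_def_of_ne_zero hpi, ← Complex.exp_conj, map_mul, ← Complex.ofReal_log Real.pi_pos.le,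
    Complex.conj_ofReal, map_div₀, map_neg, Complex.conj_ofNat]

/-- The product of `ζ` with its Gamma factor is real on the critical line. -/
lemma completedZeta_im (t : ℝ) : (completedRiemannZeta (1 / 2 + t * I)).im = 0 := by
  have h1 : (starRingEnd ℂ) (completedRiemannZeta (1 / 2 + t * I)) =
      completedRiemannZeta (1 / 2 + t * I) := by
    have hc : (starRingEnd ℂ) (1 / 2 + t * I : ℂ) = 1 - (1 / 2 + t * I) := by
      simp [Complex.conj_ofReal, map_ofNat]; ring
    have hc2 : (1 - (1 / 2 + t * I) : ℂ) = 1 / 2 + (-t : ℝ) * I := by push_cast; ring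
    have := completedZeta_eq (-t)
    rw [← hc2, ← hc, GammaR_conj, riemannZeta_conj, ← map_mul, ← completedZeta_eq] at this
    rw [← this, hc, completedRiemannZeta_one_sub]
  exact Complex.conj_eq_iff_im.1 h1

lemma eTheta_eq (t : ℝ) :
    eTheta t = Gammaℝ (1 / 2 + t * I) / ‖Gammaℝ (1 / 2 + t * I)‖ := by
  have hs : (1 / 2 + t * I : ℂ) / 2 = 1 / 4 + I * t / 2 := by ring
  have hpi : (Real.pi : ℂ) ≠ 0 := by exact_mod_cast Real.pi_ne_zero
  have h1 : (Real.pi : ℂ) ^ (-(1 / 2 + t * I : ℂ) / 2) =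
      ((Real.pi ^ (-(1 : ℝ) / 4) : ℝ) : ℂ) * (Real.pi : ℂ) ^ (-(I * t) / 2) := by
    rw [Complex.ofReal_cpow Real.pi_pos.le, ← Complex.cpow_add _ _ hpi]
    congr 1; push_cast; ring
  have h2 : ‖Gammaℝ (1 / 2 + t * I)‖ =
      Real.pi ^ (-(1 : ℝ) / 4) * ‖Complex.Gamma (1 / 4 + I * t / 2)‖ := by
    rw [norm_GammaR, hs]; congr 2; simp; norm_num
  have h3 : ((Real.pi ^ (-(1 : ℝ) / 4) : ℝ) : ℂ) ≠ 0 := by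
    exact_mod_cast (by positivity : Real.pi ^ (-(1 : ℝ) / 4) ≠ 0)
  rw [h2, Gammaℝ_def, h1, hs, eTheta]
  push_cast
  rw [mul_assoc, mul_div_mul_left _ _ (by exact_mod_cast h3)]
  ring

lemma hardyZ_eq (t : ℝ) :
    HardyZ t = (completedRiemannZeta (1 / 2 + t * I)).re / ‖Gammaℝ (1 / 2 + t * I)‖ := by
  rw [HardyZ, eTheta_eq, show (1 / 2 + I * t : ℂ) = 1 / 2 + t * I by ring, div_mul_eq_mul_div,
    ← completedZeta_eq, Complex.div_ofReal_re]

lemma completedZeta_eq_hardyZ (t : ℝ) : completedRiemannZeta (1 / 2 + t * I) =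
    ((HardyZ t * ‖Gammaℝ (1 / 2 + t * I)‖ : ℝ) : ℂ) := by
  rw [hardyZ_eq, div_mul_cancel₀ _ (norm_ne_zero_iff.2 (GammaR_half_ne_zero t))]
  exact Complex.ext (by rw [Complex.ofReal_re]) (by rw [completedZeta_im, Complex.ofReal_im])

lemma abs_hardyZ (t : ℝ) : |HardyZ t| = ‖riemannZeta (1 / 2 + t * I)‖ := by
  have h := congrArg norm (completedZeta_eq_hardyZ t)
  have h0 := norm_pos_iff.2 (GammaR_half_ne_zero t)
  rw [completedZeta_eq, Complex.norm_real, norm_mul, norm_mul, norm_norm, Real.norm_eq_abs,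
    mul_comm] at h
  exact (mul_right_cancel₀ h0.ne' h).symm

lemma continuous_zeta_half : Continuous fun t : ℝ => riemannZeta (1 / 2 + t * I) := by
  refine continuous_iff_continuousAt.2 fun t => ?_
  exact ContinuousAt.comp (f := fun t : ℝ => (1 / 2 + t * I : ℂ))
    (differentiableAt_riemannZeta (half_line_ne t).2).continuousAt (by fun_prop)

lemma continuous_completedZeta_half :
    Continuous fun t : ℝ => completedRiemannZeta (1 / 2 + t * I) := by
  refine continuous_iff_continuousAt.2 fun t => ?_
  exact ContinuousAt.comp (f := fun t : ℝ => (1 / 2 + t * I : ℂ))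
    (differentiableAt_completedZeta (half_line_ne t).1 (half_line_ne t).2).continuousAt
    (by fun_prop)

lemma continuous_norm_GammaR_half : Continuous fun t : ℝ => ‖Gammaℝ (1 / 2 + t * I)‖ := by
  refine Continuous.norm (continuous_iff_continuousAt.2 fun t => ?_)
  have h : DifferentiableAt ℂ Gammaℝ (1 / 2 + t * I) := by
    have := (differentiable_Gammaℝ_inv (1 / 2 + t * I)).inv (inv_ne_zero (GammaR_half_ne_zero t))
    have e : (fun s => (Gammaℝ s)⁻¹)⁻¹ = Gammaℝ := by funext s; simp
    rwa [e] at this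
  exact ContinuousAt.comp (f := fun t : ℝ => (1 / 2 + t * I : ℂ)) h.continuousAt (by fun_prop)

lemma continuous_hardyZ : Continuous HardyZ := by
  have : HardyZ = fun t : ℝ =>
      (completedRiemannZeta (1 / 2 + t * I)).re / ‖Gammaℝ (1 / 2 + t * I)‖ := funext hardyZ_eq
  rw [this]
  exact (Complex.continuous_re.comp continuous_completedZeta_half).div continuous_norm_GammaR_half
    fun t => norm_ne_zero_iff.2 (GammaR_half_ne_zero t)

lemma exists_norm_completedZeta₀_le (l u : ℝ) : ∃ C, ∀ s : ℂ, l ≤ s.re → s.re ≤ u →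
    ‖completedRiemannZeta₀ s‖ ≤ C := by
  set P := HurwitzZeta.hurwitzEvenFEPair 0
  have hconv : ∀ σ : ℝ, IntegrableOn (fun x : ℝ => x ^ (σ / 2 - 1) * ‖P.f_modif x‖) (Ioi 0) := by
    intro σ
    have h := (P.isStrongFEPair_toStrongFEPair.hasMellin ((σ / 2 : ℝ) : ℂ)).1.norm
    refine IntegrableOn.congr_fun h (fun x hx => ?_) measurableSet_Ioi
    have hx0 : (0 : ℝ) < x := hx
    simp only [norm_smul]
    rw [Complex.norm_cpow_eq_rpow_re_of_pos hx0, Complex.sub_re, Complex.ofReal_re, Complex.one_re]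
    rfl
  refine ⟨∫ x in Ioi (0 : ℝ), (x ^ (l / 2 - 1) * ‖P.f_modif x‖ + x ^ (u / 2 - 1) * ‖P.f_modif x‖),
    fun s hl hu => ?_⟩
  have e : completedRiemannZeta₀ s =
      (∫ x in Ioi (0 : ℝ), (x : ℂ) ^ (s / 2 - 1) • P.f_modif x) / 2 := rfl
  have h2 : ‖∫ x in Ioi (0 : ℝ), (x : ℂ) ^ (s / 2 - 1) • P.f_modif x‖ ≤
      ∫ x in Ioi (0 : ℝ), (x ^ (l / 2 - 1) * ‖P.f_modif x‖ + x ^ (u / 2 - 1) * ‖P.f_modif x‖) := by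
    refine norm_integral_le_of_norm_le ((hconv l).add (hconv u)) ?_
    refine (ae_restrict_mem measurableSet_Ioi).mono fun x hx => ?_
    have hx0 : (0 : ℝ) < x := hx
    have hre : (s / 2 - 1).re = s.re / 2 - 1 := by simp
    rw [norm_smul, Complex.norm_cpow_eq_rpow_re_of_pos hx0, hre, ← add_mul]
    gcongr
    have hl0 := (Real.rpow_pos_of_pos hx0 (l / 2 - 1)).le
    have hu0 := (Real.rpow_pos_of_pos hx0 (u / 2 - 1)).le
    rcases le_total x 1 with h | h
    · have := Real.rpow_le_rpow_of_exponent_ge hx0 h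
        (show l / 2 - 1 ≤ s.re / 2 - 1 by linarith)
      linarith
    · have := Real.rpow_le_rpow_of_exponent_le h
        (show s.re / 2 - 1 ≤ u / 2 - 1 by linarith)
      linarith
  rw [e, norm_div, Complex.norm_ofNat]
  linarith [norm_nonneg (∫ x in Ioi (0 : ℝ), (x : ℂ) ^ (s / 2 - 1) • P.f_modif x)]

/-- The Gaussian-smoothed first moment of `|ζ|` on the critical line. -/
noncomputable def zetaMoment (Δ X : ℝ) : ℝ :=
  ∫ t : ℝ, ‖riemannZeta (1 / 2 + t * I)‖ * gaussWeight Δ X t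

lemma norm_etaFun_half (Δ X t : ℝ) :
    1 / 10 * (‖riemannZeta (1 / 2 + t * I)‖ * gaussWeight Δ X t) ≤
      ‖etaFun ((1 / 2 : ℝ) + t * I) * gaussKernel Δ X ((1 / 2 : ℝ) + t * I)‖ ∧
    ‖etaFun ((1 / 2 : ℝ) + t * I) * gaussKernel Δ X ((1 / 2 : ℝ) + t * I)‖ ≤
      3 * (‖riemannZeta (1 / 2 + t * I)‖ * gaussWeight Δ X t) := by
  have e : (((1 / 2 : ℝ) : ℂ) + t * I) = 1 / 2 + t * I := by push_cast; ring
  have h1 := norm_gaussKernel_half Δ X t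
  have h2 : ‖etaFactor (1 / 2 + t * I)‖ ≤ 3 := norm_etaFactor_le (by simp)
  have h3 : 1 / 10 ≤ ‖etaFactor (1 / 2 + t * I)‖ := le_norm_etaFactor (by simp; norm_num)
  have hg := (gaussWeight_pos Δ X t).le
  rw [norm_mul, h1, e, etaFun_eq (half_line_ne t).2, norm_mul, mul_assoc]
  constructor <;> gcongr

lemma integrable_zetaMoment {Δ : ℝ} (hΔ : 2 ≤ Δ) (X : ℝ) :
    Integrable fun t : ℝ => ‖riemannZeta (1 / 2 + t * I)‖ * gaussWeight Δ X t := by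
  have h := (integrable_etaMoment hΔ X (σ := 1 / 2) (by norm_num) (by norm_num)).const_mul 10
  refine h.mono' (continuous_zeta_half.norm.mul (continuous_gaussWeight Δ X)).aestronglyMeasurable
    (ae_of_all _ fun t => ?_)
  have := (norm_etaFun_half Δ X t).1
  rw [Real.norm_of_nonneg (mul_nonneg (norm_nonneg _) (gaussWeight_pos Δ X t).le)]
  linarith

lemma zetaMoment_bounds {Δ : ℝ} (hΔ : 2 ≤ Δ) (X : ℝ) :
    1 / 10 * zetaMoment Δ X ≤ etaMoment Δ X (1 / 2) ∧ etaMoment Δ X (1 / 2) ≤ 3 * zetaMoment Δ X := by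
  have h := integrable_etaMoment hΔ X (σ := 1 / 2) (by norm_num) (by norm_num)
  have h2 := integrable_zetaMoment hΔ X
  rw [zetaMoment, etaMoment, ← integral_const_mul, ← integral_const_mul]
  exact ⟨integral_mono (h2.const_mul _) h fun t => (norm_etaFun_half Δ X t).1,
    integral_mono h (h2.const_mul _) fun t => (norm_etaFun_half Δ X t).2⟩

theorem exists_zetaMoment_bounds : ∃ a A : ℝ, 0 < a ∧ 0 < A ∧ ∀ᶠ T : ℝ in atTop, ∀ X : ℝ,
    T ≤ X → X ≤ 2 * T → a * (width T * Real.log T ^ ((1 : ℝ) / 4)) ≤ zetaMoment (width T) X ∧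
      zetaMoment (width T) X ≤ A * (width T * Real.log T ^ ((1 : ℝ) / 4)) := by
  obtain ⟨A, hA, hup⟩ := exists_etaMoment_half_le
  obtain ⟨a, ha, hlo⟩ := exists_le_etaMoment_half
  refine ⟨a / 3, 10 * A, by positivity, by positivity, ?_⟩
  filter_upwards [hup, hlo, eventually_params] with T h1 h2 h3 X hX1 hX2
  have h4 := zetaMoment_bounds h3.1 X
  have h5 := h1 X hX1 hX2
  have h6 := h2 X hX1 hX2
  exact ⟨by linarith [h4.2], by linarith [h4.1]⟩

lemma gaussKernel_two_mul_cpow {Δ : ℝ} (hΔ : 0 < Δ) (X t : ℝ) {x : ℝ} (hx : 0 < x) :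
    gaussKernel Δ X (2 + t * I) * (x : ℂ) ^ ((2 + t * I) / 2 - 1) =
      cexp (-(((t - X : ℝ) : ℂ) / Δ) ^ 2 +
        (((3 / Δ ^ 2 + Real.log x / 2 : ℝ) : ℂ) * I) * ((t - X : ℝ) : ℂ) +
        (((9 / (4 * Δ ^ 2) : ℝ) : ℂ) + ((X * Real.log x / 2 : ℝ) : ℂ) * I)) := by
  have hx' : (x : ℂ) ≠ 0 := by exact_mod_cast hx.ne'
  have hΔ' : (Δ : ℂ) ≠ 0 := by exact_mod_cast hΔ.ne'
  have hI : I ^ 2 = -1 := Complex.I_sq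
  rw [gaussKernel, Complex.cpow_def_of_ne_zero hx', ← Complex.exp_add, ← Complex.ofReal_log hx.le]
  congr 1
  generalize Real.log x = l
  push_cast
  field_simp
  ring_nf
  simp only [hI]
  ring

lemma norm_integral_gaussKernel_two_mul_cpow {Δ : ℝ} (hΔ : 0 < Δ) (X : ℝ) {x : ℝ} (hx : 0 < x) :
    ‖∫ t : ℝ, gaussKernel Δ X (2 + t * I) * (x : ℂ) ^ ((2 + t * I) / 2 - 1)‖ =
      √Real.pi * Δ * Real.exp (-(Δ ^ 2 * Real.log x ^ 2 / 16) - 3 / 4 * Real.log x) := by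
  simp_rw [gaussKernel_two_mul_cpow hΔ X _ hx]
  rw [integral_cexp_gauss hΔ, norm_mul, Complex.norm_real, Real.norm_of_nonneg (by positivity),
    Complex.norm_exp]
  congr 2
  have h : (((3 / Δ ^ 2 + Real.log x / 2 : ℝ) : ℂ) * I) ^ 2 * (Δ : ℂ) ^ 2 / 4 =
      ((-((3 / Δ ^ 2 + Real.log x / 2) ^ 2 * Δ ^ 2 / 4) : ℝ) : ℂ) := by
    rw [mul_pow, Complex.I_sq]; push_cast; ring
  rw [h, Complex.add_re, Complex.add_re, Complex.ofReal_re, Complex.ofReal_re,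
    Complex.re_ofReal_mul, Complex.I_re]
  field_simp
  ring

lemma integral_exp_gauss {D : ℝ} (hD : 0 < D) (c : ℝ) :
    Integrable (fun l : ℝ => Real.exp (-(l / D) ^ 2 + c * l)) ∧
      ∫ l : ℝ, Real.exp (-(l / D) ^ 2 + c * l) = √Real.pi * D * Real.exp (c ^ 2 * D ^ 2 / 4) := by
  have e : ∀ l : ℝ, cexp (-(((l - 0 : ℝ) : ℂ) / D) ^ 2 + (c : ℂ) * ((l - 0 : ℝ) : ℂ) + 0) =
      ((Real.exp (-(l / D) ^ 2 + c * l) : ℝ) : ℂ) := by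
    intro l; push_cast; congr 1; ring
  have h1 := integrable_cexp_gauss hD 0 (c : ℂ) 0
  have h2 := integral_cexp_gauss hD 0 (c : ℂ) 0
  simp_rw [e] at h1 h2
  constructor
  · exact h1.re.congr (ae_of_all _ fun t => Complex.ofReal_re _)
  · have h4 : ((∫ l : ℝ, Real.exp (-(l / D) ^ 2 + c * l) : ℝ) : ℂ) =
        ∫ l : ℝ, ((Real.exp (-(l / D) ^ 2 + c * l) : ℝ) : ℂ) := integral_ofReal.symm
    rw [← h4] at h2
    have h3 : ((√Real.pi * D : ℝ) : ℂ) * cexp (0 + (c : ℂ) ^ 2 * (D : ℂ) ^ 2 / 4) =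
        ((√Real.pi * D * Real.exp (c ^ 2 * D ^ 2 / 4) : ℝ) : ℂ) := by
      push_cast; congr 2; ring
    rw [h3] at h2
    exact_mod_cast h2

/-- Change of variables `x = exp l` for the Gaussian in `log x`. -/
lemma integral_exp_log_le {Δ : ℝ} (hΔ : 2 ≤ Δ) :
    IntegrableOn (fun x : ℝ => Real.exp (-(Δ ^ 2 * Real.log x ^ 2 / 16) - 11 / 8 * Real.log x))
      (Ioi 0) ∧
    ∫ x in Ioi (0 : ℝ), Real.exp (-(Δ ^ 2 * Real.log x ^ 2 / 16) - 11 / 8 * Real.log x) ≤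
      8 * √Real.pi / Δ := by
  have hΔ0 : 0 < Δ := by linarith
  have him : Real.exp '' univ = Ioi 0 := by rw [image_univ, Real.range_exp]
  have hd : ∀ x ∈ (univ : Set ℝ), HasDerivWithinAt Real.exp (Real.exp x) univ x :=
    fun x _ => (Real.hasDerivAt_exp x).hasDerivWithinAt
  have hinj : InjOn Real.exp univ := Real.exp_injective.injOn
  obtain ⟨h1, h2⟩ := integral_exp_gauss (D := 4 / Δ) (by positivity) (-(3 / 8))
  have e : ∀ l : ℝ, |Real.exp l| • Real.exp (-(Δ ^ 2 * Real.log (Real.exp l) ^ 2 / 16) -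
      11 / 8 * Real.log (Real.exp l)) = Real.exp (-(l / (4 / Δ)) ^ 2 + -(3 / 8) * l) := by
    intro l
    rw [abs_of_pos (Real.exp_pos l), Real.log_exp, smul_eq_mul, ← Real.exp_add]
    congr 1
    field_simp
    ring
  constructor
  · rw [← him, integrableOn_image_iff_integrableOn_abs_deriv_smul MeasurableSet.univ hd hinj]
    simp_rw [e]
    exact h1.integrableOn
  · rw [← him, integral_image_eq_integral_abs_deriv_smul MeasurableSet.univ hd hinj]
    simp_rw [e]
    rw [setIntegral_univ, h2]
    have h3 : Real.exp ((-(3 / 8)) ^ 2 * (4 / Δ) ^ 2 / 4) ≤ 2 := by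
      have h4 : (-(3 / 8) : ℝ) ^ 2 * (4 / Δ) ^ 2 / 4 ≤ 1 / 2 := by
        have : (4 / Δ) ≤ 2 := by rw [div_le_iff₀ hΔ0]; linarith
        have h0 : 0 < 4 / Δ := by positivity
        nlinarith
      have h5 : Real.exp (1 / 2) ≤ 2 := by
        have := Real.exp_one_lt_three
        have h6 : Real.exp (1 / 2) * Real.exp (1 / 2) = Real.exp 1 := by
          rw [← Real.exp_add]; norm_num
        nlinarith [Real.exp_pos (1 / 2)]
      exact (Real.exp_le_exp.2 h4).trans h5
    calc √Real.pi * (4 / Δ) * Real.exp ((-(3 / 8)) ^ 2 * (4 / Δ) ^ 2 / 4)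
        ≤ √Real.pi * (4 / Δ) * 2 := by gcongr
      _ = 8 * √Real.pi / Δ := by ring

lemma exp_neg_le_rpow {y : ℝ} (hy : 0 < y) : Real.exp (-y) ≤ y ^ (-(5 : ℝ) / 8) := by
  rw [Real.rpow_def_of_pos hy]
  refine Real.exp_le_exp.2 ?_
  have := Real.log_le_sub_one_of_pos hy
  nlinarith

lemma integrable_gaussKernel_two {Δ : ℝ} (hΔ : 2 ≤ Δ) (X : ℝ) :
    Integrable fun t : ℝ => gaussKernel Δ X (2 + t * I) := by
  have h := integrable_line_mul_gaussKernel (σ := 2) hΔ X (g := fun _ => 1) (A := 1)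
    (differentiable_const _) zero_le_one (fun z _ _ => by simp) (by norm_num) (by norm_num)
  simpa using h

lemma norm_two_line_cpow {x : ℝ} (hx : 0 < x) (t : ℝ) :
    ‖(x : ℂ) ^ ((2 + t * I : ℂ) / 2 - 1)‖ = 1 := by
  rw [Complex.norm_cpow_eq_rpow_re_of_pos hx]
  simp

lemma integrable_prod_kernel {Δ : ℝ} (hΔ : 2 ≤ Δ) (X : ℝ) {r : ℂ} (hr : 0 < r.re) :
    Integrable (Function.uncurry fun (t x : ℝ) => gaussKernel Δ X (2 + t * I) *
      ((x : ℂ) ^ ((2 + t * I : ℂ) / 2 - 1) * cexp (-(r * x))))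
      (volume.prod (volume.restrict (Ioi (0 : ℝ)))) := by
  have hE : Integrable (fun x : ℝ => Real.exp (-(r.re * x))) (volume.restrict (Ioi 0)) := by
    have := integrableOn_exp_mul_Ioi (a := -r.re) (by linarith) 0
    refine this.congr (ae_of_all _ fun x => ?_)
    simp
  refine ((integrable_gaussKernel_two hΔ X).norm.mul_prod hE).mono' ?_ ?_
  · refine Measurable.aestronglyMeasurable ?_
    have hk : Measurable fun p : ℝ × ℝ => gaussKernel Δ X (2 + p.1 * I) := by
      refine Continuous.measurable ?_
      exact (differentiable_gaussKernel Δ X).continuous.comp (by fun_prop)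
    have hp : Measurable fun p : ℝ × ℝ => (p.2 : ℂ) ^ ((2 + p.1 * I : ℂ) / 2 - 1) := by
      fun_prop
    have he : Measurable fun p : ℝ × ℝ => cexp (-(r * p.2)) := by fun_prop
    exact hk.mul (hp.mul he)
  · have h : ∀ᵐ z ∂(volume.prod (volume.restrict (Ioi (0 : ℝ)))), z.2 ∈ Ioi (0 : ℝ) :=
      (Measure.quasiMeasurePreserving_snd (μ := (volume : Measure ℝ))).ae
        (ae_restrict_mem measurableSet_Ioi)
    refine h.mono fun z hz => ?_
    simp only [Function.uncurry]
    rw [norm_mul, norm_mul, norm_two_line_cpow hz, one_mul, Complex.norm_exp]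
    simp

lemma norm_integral_kernel_Gamma_le {Δ : ℝ} (hΔ : 2 ≤ Δ) (X : ℝ) {r : ℂ} (hr : 0 < r.re) :
    ‖∫ t : ℝ, gaussKernel Δ X (2 + t * I) *
      (r ^ (-((2 + t * I : ℂ) / 2)) * Complex.Gamma ((2 + t * I) / 2))‖ ≤
      8 * Real.pi * r.re ^ (-(5 : ℝ) / 8) := by
  have hΔ0 : 0 < Δ := by linarith
  have e1 : ∀ t : ℝ, gaussKernel Δ X (2 + t * I) *
      (r ^ (-((2 + t * I : ℂ) / 2)) * Complex.Gamma ((2 + t * I) / 2)) =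
      ∫ x in Ioi (0 : ℝ), gaussKernel Δ X (2 + t * I) *
        ((x : ℂ) ^ ((2 + t * I : ℂ) / 2 - 1) * cexp (-(r * x))) := by
    intro t
    rw [← integral_cpow_mul_exp_neg_mul_Ioi_complex (by simp) hr, integral_const_mul]
  simp_rw [e1]
  rw [integral_integral_swap (integrable_prod_kernel hΔ X hr)]
  have e2 : ∀ x : ℝ, ∫ t : ℝ, gaussKernel Δ X (2 + t * I) *
        ((x : ℂ) ^ ((2 + t * I : ℂ) / 2 - 1) * cexp (-(r * x))) =
      (∫ t : ℝ, gaussKernel Δ X (2 + t * I) * (x : ℂ) ^ ((2 + t * I : ℂ) / 2 - 1)) *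
        cexp (-(r * x)) := by
    intro x
    rw [← integral_mul_const]
    simp_rw [mul_assoc]
  simp_rw [e2]
  obtain ⟨h1, h2⟩ := integral_exp_log_le hΔ
  refine (norm_integral_le_of_norm_le
    (h1.const_mul (√Real.pi * Δ * r.re ^ (-(5 : ℝ) / 8))) ?_).trans ?_
  · refine (ae_restrict_mem measurableSet_Ioi).mono fun x hx => ?_
    have hx0 : (0 : ℝ) < x := hx
    rw [norm_mul, norm_integral_gaussKernel_two_mul_cpow hΔ0 X hx0, Complex.norm_exp]
    have h3 := exp_neg_le_rpow (mul_pos hr hx0)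
    have h4 : (-(r * x)).re = -(r.re * x) := by simp
    rw [h4]
    have h5 : x ^ (-(5 : ℝ) / 8) = Real.exp (-(5 / 8) * Real.log x) := by
      rw [Real.rpow_def_of_pos hx0]; congr 1; ring
    rw [Real.mul_rpow hr.le hx0.le, h5] at h3
    calc _ ≤ √Real.pi * Δ * Real.exp (-(Δ ^ 2 * Real.log x ^ 2 / 16) - 3 / 4 * Real.log x) *
          (r.re ^ (-(5 : ℝ) / 8) * Real.exp (-(5 / 8) * Real.log x)) := by gcongr
      _ = √Real.pi * Δ * r.re ^ (-(5 : ℝ) / 8) *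
          (Real.exp (-(Δ ^ 2 * Real.log x ^ 2 / 16) - 3 / 4 * Real.log x) *
            Real.exp (-(5 / 8) * Real.log x)) := by ring
      _ = _ := by rw [← Real.exp_add]; congr 2; ring
  · rw [integral_const_mul]
    have hr5 := Real.rpow_nonneg hr.le (-(5 : ℝ) / 8)
    calc _ ≤ √Real.pi * Δ * r.re ^ (-(5 : ℝ) / 8) * (8 * √Real.pi / Δ) := by gcongr
      _ = 8 * (√Real.pi * √Real.pi) * r.re ^ (-(5 : ℝ) / 8) * (Δ / Δ) := by ring
      _ = _ := by rw [Real.mul_self_sqrt Real.pi_pos.le, div_self hΔ0.ne', mul_one]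

/-- The Gaussian kernel tilted by an exponential compensating the decay of the Gamma factor. -/
noncomputable def tiltKernel (φ Δ X : ℝ) (s : ℂ) : ℂ :=
  gaussKernel Δ X s * cexp (-(φ * I * (s - 1 / 2) / 2))

lemma tiltKernel_eq {Δ : ℝ} (hΔ : 0 < Δ) (φ X : ℝ) (s : ℂ) :
    tiltKernel φ Δ X s = ((Real.exp (((X + φ * Δ ^ 2 / 4) ^ 2 - X ^ 2) / Δ ^ 2) : ℝ) : ℂ) *
      gaussKernel Δ (X + φ * Δ ^ 2 / 4) s := by
  have hΔ' : (Δ : ℂ) ≠ 0 := by exact_mod_cast hΔ.ne'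
  have hI : I ^ 2 = -1 := Complex.I_sq
  rw [tiltKernel, gaussKernel, gaussKernel, Complex.ofReal_exp, ← Complex.exp_add, ← Complex.exp_add]
  congr 1
  push_cast
  field_simp
  ring_nf
  simp only [hI]
  ring

lemma tiltKernel_half (φ Δ X t : ℝ) : tiltKernel φ Δ X (1 / 2 + t * I) =
    ((Real.exp (φ * t / 2) * gaussWeight Δ X t : ℝ) : ℂ) := by
  have hI : I ^ 2 = -1 := Complex.I_sq
  rw [tiltKernel, gaussKernel, gaussWeight, ← Complex.exp_add, ← Real.exp_add, Complex.ofReal_exp]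
  congr 1
  push_cast
  ring_nf
  simp only [hI]
  ring

lemma norm_tiltKernel_one_le {φ Δ : ℝ} (hΔ : 2 ≤ Δ) (X : ℝ) : ‖tiltKernel φ Δ X 1‖ ≤ 3 := by
  have h : ‖cexp (-(φ * I * (1 - 1 / 2) / 2))‖ = 1 := by
    rw [show (-(φ * I * (1 - 1 / 2) / 2) : ℂ) = ((-(φ / 4) : ℝ) : ℂ) * I by push_cast; ring]
    exact Complex.norm_exp_ofReal_mul_I _
  rw [tiltKernel, norm_mul, h, mul_one]
  have := norm_gaussKernel_le (X := X) (t := 0) hΔ (σ := 1)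
    (abs_le.2 ⟨by linarith, by linarith⟩)
  simp only [Complex.ofReal_one, Complex.ofReal_zero, zero_mul, add_zero] at this
  exact this.trans (by linarith [gaussWeight_le_one Δ X 0])

lemma differentiable_tiltKernel (φ Δ X : ℝ) : Differentiable ℂ (tiltKernel φ Δ X) := by
  unfold tiltKernel
  exact (differentiable_gaussKernel Δ X).mul (by fun_prop)

lemma integrable_tiltKernel_two {Δ : ℝ} (hΔ : 2 ≤ Δ) (φ X : ℝ) :
    Integrable fun t : ℝ => tiltKernel φ Δ X (2 + t * I) := by
  simp_rw [tiltKernel_eq (by linarith : 0 < Δ)]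
  exact (integrable_gaussKernel_two hΔ _).const_mul _

lemma norm_GammaR_two_le (t : ℝ) : ‖Gammaℝ (2 + t * I)‖ ≤ 1 := by
  rw [norm_GammaR]
  have h : ‖Complex.Gamma ((2 + t * I) / 2)‖ ≤ 1 := by
    rw [Complex.Gamma_eq_integral (by simp)]
    refine (norm_integral_le_of_norm_le (integrableOn_exp_neg_Ioi 0) ?_).trans ?_
    · refine (ae_restrict_mem measurableSet_Ioi).mono fun x hx => ?_
      rw [norm_mul, norm_two_line_cpow hx, mul_one, Complex.norm_real,
        Real.norm_of_nonneg (Real.exp_pos _).le]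
    · rw [integral_exp_neg_Ioi_zero]
  have h2 : Real.pi ^ (-(2 + t * I : ℂ).re / 2) ≤ 1 := by
    refine Real.rpow_le_one_of_one_le_of_nonpos (by linarith [Real.pi_gt_three]) ?_
    simp
  calc _ ≤ (1 : ℝ) * 1 := by gcongr
    _ = 1 := one_mul 1

lemma GammaR_mul_tiltKernel {φ : ℝ} (h0 : 0 < φ) (h1 : φ < Real.pi) (Δ X : ℝ) {n : ℕ} (hn : n ≠ 0)
    (s : ℂ) : Gammaℝ s * (1 / (n : ℂ) ^ s) * tiltKernel φ Δ X s = cexp (φ * I / 4) *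
      (gaussKernel Δ X s * ((((Real.pi * n ^ 2 : ℝ) : ℂ) * cexp (φ * I)) ^ (-(s / 2)) *
        Complex.Gamma (s / 2))) := by
  have hpi : (Real.pi : ℂ) ≠ 0 := by exact_mod_cast Real.pi_ne_zero
  have hn0 : (0 : ℝ) < n := by exact_mod_cast Nat.pos_of_ne_zero hn
  have hnc : (n : ℂ) ≠ 0 := by exact_mod_cast hn
  have hρ : 0 < Real.pi * (n : ℝ) ^ 2 := by positivity
  have hr : ((Real.pi * n ^ 2 : ℝ) : ℂ) * cexp (φ * I) ≠ 0 :=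
    mul_ne_zero (by exact_mod_cast hρ.ne') (Complex.exp_ne_zero _)
  have hlog : Complex.log (((Real.pi * n ^ 2 : ℝ) : ℂ) * cexp (φ * I)) =
      ((Real.log Real.pi + 2 * Real.log n : ℝ) : ℂ) + φ * I := by
    rw [Complex.log_ofReal_mul hρ (Complex.exp_ne_zero _), Complex.log_exp (by simp; linarith)
      (by simp; linarith), Real.log_mul Real.pi_ne_zero (by positivity), Real.log_pow]
    push_cast; ring
  have hln : Complex.log (n : ℂ) = ((Real.log n : ℝ) : ℂ) := by
    rw [Complex.ofReal_log hn0.le]; simp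
  have hlp : Complex.log (Real.pi : ℂ) = ((Real.log Real.pi : ℝ) : ℂ) :=
    (Complex.ofReal_log Real.pi_pos.le).symm
  rw [Gammaℝ_def, tiltKernel, Complex.cpow_def_of_ne_zero hr, hlog, Complex.cpow_def_of_ne_zero hnc,
    Complex.cpow_def_of_ne_zero hpi, one_div, ← Complex.exp_neg, hln, hlp]
  have e : ∀ a b c d e f g h : ℂ, c + d + f = g + h → cexp c * a * cexp d * (b * cexp f) =
      cexp g * (b * (cexp h * a)) := by
    intro a b c d e f g h hh
    calc _ = a * b * (cexp c * cexp d * cexp f) := by ring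
      _ = a * b * (cexp g * cexp h) := by
        rw [← Complex.exp_add, ← Complex.exp_add, hh, Complex.exp_add]
      _ = _ := by ring
  refine e _ _ _ _ 0 _ _ _ ?_
  generalize Real.log Real.pi = a
  generalize Real.log n = b
  push_cast
  ring

lemma le_cos_pi_div_two_sub {T : ℝ} (hT : 1 ≤ T) : 1 / (Real.pi * T) ≤ Real.cos (Real.pi / 2 - 1 / T) := by
  rw [Real.cos_pi_div_two_sub]
  have h1 : 1 / T ≤ 1 := by rw [div_le_one (by linarith)]; exact hT
  have h0 : 0 ≤ 1 / T := by positivity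
  have h := Real.mul_le_sin h0 (by linarith [Real.pi_gt_three])
  refine le_trans ?_ h
  have : 2 / Real.pi * (1 / T) = 2 * (1 / (Real.pi * T)) := by field_simp
  rw [this]
  have : 0 < 1 / (Real.pi * T) := by have := Real.pi_pos; positivity
  linarith

lemma norm_integral_GammaR_term_le {Δ T : ℝ} (hΔ : 2 ≤ Δ) (hT : 1 ≤ T) (X : ℝ) {n : ℕ} (hn : n ≠ 0) :
    ‖∫ t : ℝ, Gammaℝ (2 + t * I) * (1 / (n : ℂ) ^ (2 + t * I : ℂ)) *
      tiltKernel (Real.pi / 2 - 1 / T) Δ X (2 + t * I)‖ ≤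
      8 * Real.pi * T ^ ((5 : ℝ) / 8) * (1 / (n : ℝ) ^ ((5 : ℝ) / 4)) := by
  have hT0 : 0 < T := by linarith
  have h1T : 1 / T ≤ 1 := by rw [div_le_one hT0]; exact hT
  have h1T0 : 0 < 1 / T := by positivity
  have hpi := Real.pi_gt_three
  have hn0 : (0 : ℝ) < n := by exact_mod_cast Nat.pos_of_ne_zero hn
  set φ := Real.pi / 2 - 1 / T with hφ
  set r : ℂ := ((Real.pi * n ^ 2 : ℝ) : ℂ) * cexp (φ * I)
  have hre : r.re = Real.pi * n ^ 2 * Real.cos φ := by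
    rw [Complex.re_ofReal_mul, Complex.exp_ofReal_mul_I_re]
  have hr : (n : ℝ) ^ 2 / T ≤ r.re := by
    rw [hre]
    have := le_cos_pi_div_two_sub hT
    calc (n : ℝ) ^ 2 / T = Real.pi * n ^ 2 * (1 / (Real.pi * T)) := by field_simp
      _ ≤ _ := by gcongr
  have hq : 0 < (n : ℝ) ^ 2 / T := by positivity
  simp_rw [GammaR_mul_tiltKernel (φ := φ) (by rw [hφ]; linarith) (by rw [hφ]; linarith) Δ X hn]
  rw [integral_const_mul, norm_mul]
  have he : ‖cexp (φ * I / 4)‖ = 1 := by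
    rw [show (φ * I / 4 : ℂ) = ((φ / 4 : ℝ) : ℂ) * I by push_cast; ring]
    exact Complex.norm_exp_ofReal_mul_I _
  rw [he, one_mul]
  refine (norm_integral_kernel_Gamma_le hΔ X (hq.trans_le hr)).trans ?_
  have h2 : r.re ^ (-(5 : ℝ) / 8) ≤ ((n : ℝ) ^ 2 / T) ^ (-(5 : ℝ) / 8) :=
    Real.rpow_le_rpow_of_nonpos hq hr (by norm_num)
  have h3 : ((n : ℝ) ^ 2 / T) ^ (-(5 : ℝ) / 8) = T ^ ((5 : ℝ) / 8) * (1 / (n : ℝ) ^ ((5 : ℝ) / 4)) := by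
    rw [Real.div_rpow (by positivity) hT0.le, ← Real.rpow_natCast, ← Real.rpow_mul hn0.le,
      show -(5 : ℝ) / 8 = -(5 / 8) by norm_num, Real.rpow_neg hT0.le, div_inv_eq_mul,
      show ((2 : ℕ) : ℝ) * -(5 / 8) = -(5 / 4) by norm_num, Real.rpow_neg hn0.le]
    ring
  calc _ ≤ 8 * Real.pi * (((n : ℝ) ^ 2 / T) ^ (-(5 : ℝ) / 8)) := by gcongr
    _ = _ := by rw [h3]; ring

lemma completedZeta_eq_of_one_lt {s : ℂ} (hs : 1 < s.re) :
    completedRiemannZeta s = Gammaℝ s * ∑' n : ℕ, 1 / ((n + 1 : ℕ) : ℂ) ^ s := by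
  have h0 : s ≠ 0 := by rintro rfl; simp at hs; linarith
  have h := zeta_eq_tsum_one_div_nat_add_one_cpow hs
  rw [riemannZeta_def_of_ne_zero h0] at h
  push_cast
  rw [← h, mul_comm, div_mul_cancel₀ _ (Gammaℝ_ne_zero_of_re_pos (by linarith))]

lemma exists_norm_integral_two_le : ∃ C, 0 ≤ C ∧ ∀ Δ T X : ℝ, 2 ≤ Δ → 1 ≤ T →
    ‖∫ t : ℝ, completedRiemannZeta (2 + t * I) *
      tiltKernel (Real.pi / 2 - 1 / T) Δ X (2 + t * I)‖ ≤ C * T ^ ((5 : ℝ) / 8) := by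
  have hsum54 : Summable fun n : ℕ => 1 / ((n + 1 : ℕ) : ℝ) ^ ((5 : ℝ) / 4) :=
    (summable_nat_add_iff 1).2 (Real.summable_one_div_nat_rpow.2 (by norm_num))
  have hsum2 : Summable fun n : ℕ => 1 / ((n + 1 : ℕ) : ℝ) ^ 2 :=
    (summable_nat_add_iff 1).2 (Real.summable_one_div_nat_pow.2 (by norm_num))
  refine ⟨8 * Real.pi * ∑' n : ℕ, 1 / ((n + 1 : ℕ) : ℝ) ^ ((5 : ℝ) / 4),
    by have := Real.pi_pos; exact mul_nonneg (by positivity) (tsum_nonneg fun n => by positivity),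
    fun Δ T X hΔ hT => ?_⟩
  set φ := Real.pi / 2 - 1 / T
  set F : ℕ → ℝ → ℂ := fun n t => Gammaℝ (2 + t * I) * (1 / ((n + 1 : ℕ) : ℂ) ^ (2 + t * I : ℂ)) *
      tiltKernel φ Δ X (2 + t * I)
  have hn2 : ∀ (n : ℕ) (t : ℝ), ‖1 / ((n + 1 : ℕ) : ℂ) ^ (2 + t * I : ℂ)‖ = 1 / ((n + 1 : ℕ) : ℝ) ^ 2 := by
    intro n t
    rw [norm_div, norm_one, Complex.norm_natCast_cpow_of_pos (Nat.succ_pos n)]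
    simp
  have hG := (integrable_tiltKernel_two hΔ φ X)
  have hbound : ∀ n t, ‖F n t‖ ≤ 1 / ((n + 1 : ℕ) : ℝ) ^ 2 * ‖tiltKernel φ Δ X (2 + t * I)‖ := by
    intro n t
    simp only [F]
    rw [norm_mul, norm_mul, hn2]
    have := norm_GammaR_two_le t
    calc _ ≤ 1 * (1 / ((n + 1 : ℕ) : ℝ) ^ 2) * ‖tiltKernel φ Δ X (2 + t * I)‖ := by gcongr
      _ = _ := by rw [one_mul]
  have hcont : ∀ n, Continuous (F n) := by
    intro n
    refine (Continuous.mul ?_ ?_).mul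
      ((differentiable_tiltKernel φ Δ X).continuous.comp (by fun_prop))
    · refine continuous_iff_continuousAt.2 fun t => ?_
      have hne : Gammaℝ (2 + t * I) ≠ 0 := Gammaℝ_ne_zero_of_re_pos (by simp)
      have h : DifferentiableAt ℂ Gammaℝ (2 + t * I) := by
        have := (differentiable_Gammaℝ_inv (2 + t * I)).inv (inv_ne_zero hne)
        have e : (fun s => (Gammaℝ s)⁻¹)⁻¹ = Gammaℝ := by funext s; simp
        rwa [e] at this
      exact ContinuousAt.comp (f := fun t : ℝ => (2 + t * I : ℂ)) h.continuousAt (by fun_prop)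
    · have hne : ((n + 1 : ℕ) : ℂ) ≠ 0 := by exact_mod_cast Nat.succ_ne_zero n
      refine continuous_const.div ?_ fun t => ?_
      · exact Continuous.const_cpow (by fun_prop) (Or.inl hne)
      · rw [Complex.cpow_def_of_ne_zero hne]; exact Complex.exp_ne_zero _
  have hInt : ∀ n, Integrable (F n) := fun n =>
    (hG.norm.const_mul _).mono' (hcont n).aestronglyMeasurable (ae_of_all _ (hbound n))
  have hs : Summable fun n => ∫ t, ‖F n t‖ := by
    refine Summable.of_nonneg_of_le (fun n => integral_nonneg fun _ => norm_nonneg _) (fun n => ?_)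
      (hsum2.mul_right (∫ t : ℝ, ‖tiltKernel φ Δ X (2 + t * I)‖))
    rw [← integral_const_mul]
    exact integral_mono (hInt n).norm (hG.norm.const_mul _) (hbound n)
  have h := hasSum_integral_of_summable_integral_norm hInt hs
  have e : ∀ t : ℝ, completedRiemannZeta (2 + t * I) * tiltKernel φ Δ X (2 + t * I) =
      ∑' n, F n t := by
    intro t
    simp only [F]
    rw [completedZeta_eq_of_one_lt (by simp), tsum_mul_right, tsum_mul_left]
  simp_rw [e]
  rw [← h.tsum_eq, mul_right_comm, ← tsum_mul_left]
  exact tsum_of_norm_bounded (hsum54.mul_left _).hasSum fun n =>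
    norm_integral_GammaR_term_le hΔ hT X (Nat.succ_ne_zero n)

lemma integrable_pole_kernel {σ : ℝ} (h1 : 1 / 8 ≤ σ) (h2 : σ ≤ 5 / 2) (hσ : σ ≠ 1) :
    Integrable fun t : ℝ => gaussKernel 2 0 (σ + t * I) / (σ + t * I - 1) := by
  obtain ⟨C, hC⟩ := exists_norm_mul_gaussKernel_le (le_refl (2 : ℝ)) 0 (g := fun _ => 1) (A := 1)
    zero_le_one (fun z _ _ => by simp)
  have hσ' : 0 < |σ - 1| := abs_pos.2 (sub_ne_zero.2 hσ)
  have hne : ∀ t : ℝ, (σ + t * I - 1 : ℂ) ≠ 0 := fun t h => by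
    have := congrArg Complex.re h
    simp [sub_eq_zero] at this
    exact hσ this
  refine integrable_of_norm_le_div (C := C / |σ - 1|) ?_ fun t => ?_
  · exact ((differentiable_gaussKernel 2 0).continuous.comp (by fun_prop)).div (by fun_prop) hne
  · have h := hC (σ + t * I) (by simpa using h1) (by simpa using h2)
    have h3 : |σ - 1| ≤ ‖(σ + t * I - 1 : ℂ)‖ := by
      have := Complex.abs_re_le_norm (σ + t * I - 1 : ℂ)
      simpa using this
    simp only [one_mul] at h
    have him : (σ + t * I : ℂ).im = t := by simp
    rw [him] at h
    rw [norm_div, div_right_comm]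
    exact div_le_div₀ ((norm_nonneg _).trans h) h hσ' h3

lemma completedZeta_mul_eq {s : ℂ} (hs : s ≠ 1) (G : ℂ → ℂ) (b : ℂ) (k : ℂ → ℂ)
    (hb : G 1 = b * k 1) : completedRiemannZeta s * G s =
      ((completedRiemannZeta₀ s - 1 / s) * G s + dslope (fun z => G z - b * k z) 1 s) +
        b * (k s / (s - 1)) := by
  have hs' : s - 1 ≠ 0 := sub_ne_zero.2 hs
  have hs2 : 1 - s ≠ 0 := sub_ne_zero.2 hs.symm
  rw [dslope_of_ne _ hs, slope_def_field, hb, sub_self, sub_zero, completedRiemannZeta_eq]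
  have : 1 / (1 - s) = -(1 / (s - 1)) := by rw [← neg_sub, div_neg]
  rw [this, sub_div]
  ring

theorem exists_norm_integral_completedZeta_le : ∃ C, 0 ≤ C ∧ ∀ Δ T X : ℝ, 2 ≤ Δ → 1 ≤ T →
    ‖∫ t : ℝ, completedRiemannZeta (1 / 2 + t * I) *
      tiltKernel (Real.pi / 2 - 1 / T) Δ X (1 / 2 + t * I)‖ ≤ C * T ^ ((5 : ℝ) / 8) := by
  obtain ⟨C, hC, hline⟩ := exists_norm_integral_two_le
  obtain ⟨C₀, hC₀⟩ := exists_norm_completedZeta₀_le (1 / 2) 2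
  set k := gaussKernel 2 0
  set M : ℝ → ℝ := fun σ => ‖∫ t : ℝ, k (σ + t * I) / (σ + t * I - 1)‖
  refine ⟨C + (3 * M (1 / 2) + 3 * M 2), by positivity, fun Δ T X hΔ hT => ?_⟩
  set φ := Real.pi / 2 - 1 / T
  set G := tiltKernel φ Δ X with hGdef
  set b := G 1 / k 1
  have hk1 : 1 ≤ ‖k 1‖ := by
    have := gaussWeight_le_norm_gaussKernel 2 0 1 0
    simpa [gaussWeight] using this
  have hk0 : k 1 ≠ 0 := norm_pos_iff.1 (by linarith)
  have hb : G 1 = b * k 1 := (div_mul_cancel₀ _ hk0).symm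
  have hb3 : ‖b‖ ≤ 3 := by
    rw [norm_div]
    exact (div_le_self (norm_nonneg _) hk1).trans (norm_tiltKernel_one_le hΔ X)
  have hGd : Differentiable ℂ G := differentiable_tiltKernel φ Δ X
  have hkd : Differentiable ℂ k := differentiable_gaussKernel 2 0
  set K : ℂ → ℂ := fun z => G z - b * k z
  have hKd : Differentiable ℂ (dslope K 1) := by
    have h := (Complex.differentiableOn_dslope (f := K) (c := 1) (s := univ) univ_mem).2
      (hGd.sub (hkd.const_mul b)).differentiableOn
    exact differentiableOn_univ.1 h
  set H : ℂ → ℂ := fun s => (completedRiemannZeta₀ s - 1 / s) * G s + dslope K 1 s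
  have hHd : ∀ z : ℂ, 1 / 2 ≤ z.re → z.re ≤ 2 → DifferentiableAt ℂ H z := by
    intro z h1 _
    have hz : z ≠ 0 := by rintro rfl; norm_num at h1
    refine DifferentiableAt.add (DifferentiableAt.mul ?_ (hGd z)) (hKd z)
    exact (differentiable_completedZeta₀ z).sub ((differentiableAt_const _).div differentiableAt_id hz)
  obtain ⟨C₁, hC₁⟩ := exists_norm_mul_gaussKernel_le hΔ (X + φ * Δ ^ 2 / 4) (g := fun _ => 1) (A := 1)
    zero_le_one (fun z _ _ => by simp)
  obtain ⟨C₂, hC₂⟩ := exists_norm_mul_gaussKernel_le (le_refl (2 : ℝ)) 0 (g := fun _ => 1) (A := 1)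
    zero_le_one (fun z _ _ => by simp)
  set E := Real.exp (((X + φ * Δ ^ 2 / 4) ^ 2 - X ^ 2) / Δ ^ 2)
  have hGle : ∀ z : ℂ, 1 / 2 ≤ z.re → z.re ≤ 2 → ‖G z‖ ≤ E * C₁ / (1 + z.im ^ 2) := by
    intro z h1 h2
    have h := hC₁ z (by linarith) (by linarith)
    rw [one_mul] at h
    rw [hGdef, tiltKernel_eq (by linarith : 0 < Δ), norm_mul, Complex.norm_real,
      Real.norm_of_nonneg (Real.exp_pos _).le, mul_div_assoc E]
    exact mul_le_mul_of_nonneg_left h (Real.exp_pos _).le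
  have hHle : ∀ z : ℂ, 1 / 2 ≤ z.re → z.re ≤ 2 → 1 ≤ |z.im| →
      ‖H z‖ ≤ ((C₀ + 1) * (E * C₁) + (E * C₁ + 3 * C₂)) / (1 + z.im ^ 2) := by
    intro z h1 h2 h3
    have hG := hGle z h1 h2
    have hk := hC₂ z (by linarith) (by linarith)
    rw [one_mul] at hk
    have hz : 1 ≤ ‖z‖ := h3.trans (Complex.abs_im_le_norm z)
    have hz1 : 1 ≤ ‖z - 1‖ := by
      have := Complex.abs_im_le_norm (z - 1)
      simp only [Complex.sub_im, Complex.one_im, sub_zero] at this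
      linarith
    have hz' : z ≠ 1 := by rintro rfl; simp at hz1; linarith
    have hK1 : ‖dslope K 1 z‖ ≤ (E * C₁ + 3 * C₂) / (1 + z.im ^ 2) := by
      have h0 : K 1 = 0 := by simp only [K]; rw [hb, sub_self]
      rw [dslope_of_ne _ hz', slope_def_field, h0, sub_zero, norm_div]
      refine (div_le_self (norm_nonneg _) hz1).trans ((norm_sub_le _ _).trans ?_)
      rw [norm_mul, add_div, mul_div_assoc 3]
      gcongr
    have hL : ‖completedRiemannZeta₀ z - 1 / z‖ ≤ C₀ + 1 := by
      refine (norm_sub_le _ _).trans (add_le_add (hC₀ z h1 h2) ?_)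
      rw [norm_div, norm_one]
      exact (div_le_one (by linarith)).2 hz
    refine (norm_add_le _ _).trans ?_
    rw [norm_mul, add_div, mul_div_assoc]
    gcongr
    exact (norm_nonneg _).trans hL
  have hshift := integral_line_eq (f := H) (l := 1 / 2) (u := 2) (by norm_num) hHd hHle
  have hInt : ∀ σ : ℝ, 1 / 2 ≤ σ → σ ≤ 2 → σ ≠ 1 →
      ∫ t : ℝ, completedRiemannZeta (σ + t * I) * G (σ + t * I) =
        (∫ t : ℝ, H (σ + t * I)) + b * ∫ t : ℝ, k (σ + t * I) / (σ + t * I - 1) := by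
    intro σ h1 h2 h3
    have hp := integrable_pole_kernel (σ := σ) (by linarith) (by linarith) h3
    have hH := integrable_line_of_strip (fun z a c => (hHd z a c).continuousAt) hHle h1 h2
    rw [← integral_const_mul, ← integral_add hH (hp.const_mul b)]
    refine integral_congr_ae (ae_of_all _ fun t => ?_)
    have hne : (σ + t * I : ℂ) ≠ 1 := fun h => by
      have := congrArg Complex.re h
      simp at this
      exact h3 this
    exact completedZeta_mul_eq hne G b k hb
  have hA := hInt (1 / 2) le_rfl (by norm_num) (by norm_num)
  have hB := hInt 2 (by norm_num) le_rfl (by norm_num)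
  have e2 : ((2 : ℝ) : ℂ) = 2 := by norm_num
  have hl := hline Δ T X hΔ hT
  have eA : (((1 / 2 : ℝ)) : ℂ) = 1 / 2 := by push_cast; rfl
  have hA2 : ∫ t : ℝ, completedRiemannZeta (1 / 2 + t * I) * G (1 / 2 + t * I) =
      (∫ t : ℝ, completedRiemannZeta (2 + t * I) * G (2 + t * I)) +
      (b * (∫ t : ℝ, k ((1 / 2 : ℝ) + t * I) / ((1 / 2 : ℝ) + t * I - 1)) -
        b * ∫ t : ℝ, k ((2 : ℝ) + t * I) / ((2 : ℝ) + t * I - 1)) := by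
    rw [hshift] at hA
    rw [← eA, hA, ← e2, hB]
    ring
  rw [hA2]
  have hT1 : 1 ≤ T ^ ((5 : ℝ) / 8) := Real.one_le_rpow hT (by norm_num)
  have hM1 : 0 ≤ M (1 / 2) := norm_nonneg _
  have hM2 : 0 ≤ M 2 := norm_nonneg _
  have h3 : ‖b * (∫ t : ℝ, k ((1 / 2 : ℝ) + t * I) / ((1 / 2 : ℝ) + t * I - 1)) -
        b * ∫ t : ℝ, k ((2 : ℝ) + t * I) / ((2 : ℝ) + t * I - 1)‖ ≤ 3 * M (1 / 2) + 3 * M 2 := by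
    refine (norm_sub_le _ _).trans ?_
    rw [norm_mul, norm_mul]
    exact add_le_add (mul_le_mul_of_nonneg_right hb3 hM1) (mul_le_mul_of_nonneg_right hb3 hM2)
  refine (norm_add_le _ _).trans ?_
  have h4 := add_le_add hl h3
  refine h4.trans ?_
  rw [add_mul]
  have h5 : 0 ≤ 3 * M (1 / 2) + 3 * M 2 := by positivity
  have := le_mul_of_one_le_right h5 hT1
  linarith

/-- The weight which, against Hardy's function, yields the completed zeta function. -/
noncomputable def hardyWeight (T Δ X t : ℝ) : ℝ :=
  ‖Gammaℝ (1 / 2 + t * I)‖ * Real.exp ((Real.pi / 2 - 1 / T) * t / 2) * gaussWeight Δ X t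

theorem exists_abs_integral_hardyZ_le : ∃ C, 0 ≤ C ∧ ∀ Δ T X : ℝ, 2 ≤ Δ → 1 ≤ T →
    |∫ t : ℝ, HardyZ t * hardyWeight T Δ X t| ≤ C * T ^ ((5 : ℝ) / 8) := by
  obtain ⟨C, hC, h⟩ := exists_norm_integral_completedZeta_le
  refine ⟨C, hC, fun Δ T X hΔ hT => ?_⟩
  have h1 := h Δ T X hΔ hT
  have e : ∀ t : ℝ, completedRiemannZeta (1 / 2 + t * I) *
      tiltKernel (Real.pi / 2 - 1 / T) Δ X (1 / 2 + t * I) =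
      ((HardyZ t * hardyWeight T Δ X t : ℝ) : ℂ) := by
    intro t
    rw [completedZeta_eq_hardyZ, tiltKernel_half, ← Complex.ofReal_mul, hardyWeight]
    congr 1
    ring
  simp_rw [e] at h1
  have h2 : ((∫ t : ℝ, HardyZ t * hardyWeight T Δ X t : ℝ) : ℂ) =
    ∫ t : ℝ, ((HardyZ t * hardyWeight T Δ X t : ℝ) : ℂ) := integral_ofReal.symm
  rwa [← h2, Complex.norm_real, Real.norm_eq_abs] at h1

/-- The negative part of Hardy's function. -/
noncomputable def hardyNeg (t : ℝ) : ℝ := (|HardyZ t| - HardyZ t) / 2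

lemma hardyNeg_nonneg (t : ℝ) : 0 ≤ hardyNeg t := by
  rw [hardyNeg]; linarith [le_abs_self (HardyZ t)]

lemma hardyNeg_le (t : ℝ) : hardyNeg t ≤ |HardyZ t| := by
  rw [hardyNeg]; linarith [neg_abs_le (HardyZ t)]

lemma continuous_hardyNeg : Continuous hardyNeg :=
  (continuous_hardyZ.abs.sub continuous_hardyZ).div_const 2

lemma neg_Iminus_eq (T : ℝ) : -Iminus T = ∫ t in Ioc T (2 * T), hardyNeg t := by
  have hs : {t : ℝ | t ∈ Ioc T (2 * T) ∧ HardyZ t < 0} = Ioc T (2 * T) ∩ {t | HardyZ t < 0} := rfl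
  have hm : MeasurableSet {t : ℝ | HardyZ t < 0} :=
    (isOpen_lt continuous_hardyZ continuous_const).measurableSet
  rw [Iminus, hs, ← setIntegral_indicator hm, ← integral_neg]
  refine integral_congr_ae (ae_of_all _ fun t => ?_)
  simp only [hardyNeg, Set.indicator_apply, Set.mem_ofPred_eq]
  split_ifs with h
  · rw [abs_of_neg h]; ring
  · rw [abs_of_nonneg (not_lt.1 h)]; ring

lemma setIntegral_Ioc_swap {f : ℝ → ℝ → ℝ} (hf : Continuous (Function.uncurry f)) (a b c d : ℝ) :
    ∫ x in Ioc a b, ∫ t in Ioc c d, f x t = ∫ t in Ioc c d, ∫ x in Ioc a b, f x t := by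
  refine integral_integral_swap ?_
  rw [Measure.prod_restrict]
  have h : IntegrableOn (Function.uncurry f) (Icc a b ×ˢ Icc c d) (volume.prod volume) :=
    hf.continuousOn.integrableOn_compact (isCompact_Icc.prod isCompact_Icc)
  exact h.mono_set (prod_mono Ioc_subset_Icc_self Ioc_subset_Icc_self)

lemma gaussWeight_comm (Δ X t : ℝ) : gaussWeight Δ X t = gaussWeight Δ t X := by
  rw [gaussWeight, gaussWeight, ← neg_sub X t, neg_div, neg_sq]

lemma continuous_uncurry_gaussWeight (Δ : ℝ) :
    Continuous (Function.uncurry fun X t : ℝ => gaussWeight Δ X t) := by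
  unfold gaussWeight Function.uncurry
  fun_prop

lemma setIntegral_gaussWeight_centre_le {Δ : ℝ} (hΔ : 0 < Δ) (a b t : ℝ) :
    ∫ X in Ioc a b, gaussWeight Δ X t ≤ √Real.pi * Δ := by
  simp_rw [gaussWeight_comm Δ _ t]
  rw [← integral_gaussWeight hΔ t]
  exact setIntegral_le_integral (integrable_gaussWeight hΔ t)
    (ae_of_all _ fun x => (gaussWeight_pos Δ t x).le)

lemma le_setIntegral_gaussWeight_centre {Δ T t : ℝ} (hΔ : 0 < Δ) (hΔT : Δ ≤ T)
    (ht : t ∈ Ioc T (2 * T)) : Δ / 6 ≤ ∫ X in Ioc T (2 * T), gaussWeight Δ X t := by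
  have hInt : IntegrableOn (fun X => gaussWeight Δ X t) (Ioc T (2 * T)) := by
    simp_rw [gaussWeight_comm Δ _ t]
    exact (integrable_gaussWeight hΔ t).integrableOn
  obtain ⟨u, hu, hut⟩ : ∃ u, Ioc u (u + Δ / 2) ⊆ Ioc T (2 * T) ∧
      ∀ x ∈ Ioc u (u + Δ / 2), |t - x| ≤ Δ := by
    obtain ⟨h1, h2⟩ := ht
    rcases le_total t (3 / 2 * T) with h | h
    · refine ⟨t, fun x hx => ⟨by linarith [hx.1], by linarith [hx.2]⟩, fun x hx => ?_⟩
      rw [abs_le]; constructor <;> linarith [hx.1, hx.2]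
    · refine ⟨t - Δ / 2, fun x hx => ⟨by linarith [hx.1], by linarith [hx.2]⟩, fun x hx => ?_⟩
      rw [abs_le]; constructor <;> linarith [hx.1, hx.2]
  have h1 : ∀ x ∈ Ioc u (u + Δ / 2), (1 : ℝ) / 3 ≤ gaussWeight Δ x t := by
    intro x hx
    have h2 : ((t - x) / Δ) ^ 2 ≤ 1 := by
      rw [div_pow, div_le_one (by positivity), ← sq_abs (t - x)]
      exact pow_le_pow_left₀ (abs_nonneg _) (hut x hx) 2
    have h3 : Real.exp (-1) ≤ gaussWeight Δ x t := by
      rw [gaussWeight]; exact Real.exp_le_exp.2 (by linarith)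
    have h4 : (1 : ℝ) / 3 ≤ Real.exp (-1) := by
      rw [Real.exp_neg, one_div]
      exact inv_anti₀ (Real.exp_pos 1) Real.exp_one_lt_three.le
    linarith
  calc Δ / 6 = ∫ _ in Ioc u (u + Δ / 2), (1 : ℝ) / 3 := by
        rw [setIntegral_const, smul_eq_mul, Real.volume_real_Ioc_of_le (by linarith)]
        ring
    _ ≤ ∫ X in Ioc u (u + Δ / 2), gaussWeight Δ X t :=
        setIntegral_mono_on (integrableOn_const (by simp)) (hInt.mono_set hu) measurableSet_Ioc h1
    _ ≤ _ := setIntegral_mono_set hInt (ae_of_all _ fun x => (gaussWeight_pos Δ x t).le)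
        (ae_of_all _ hu)

/-- The factor of `hardyWeight` that does not depend on the Gaussian. -/
noncomputable def hardyFactor (T t : ℝ) : ℝ :=
  ‖Gammaℝ (1 / 2 + t * I)‖ * Real.exp ((Real.pi / 2 - 1 / T) * t / 2)

lemma hardyFactor_nonneg (T t : ℝ) : 0 ≤ hardyFactor T t := by unfold hardyFactor; positivity

lemma continuous_hardyFactor (T : ℝ) : Continuous (hardyFactor T) :=
  continuous_norm_GammaR_half.mul (by fun_prop)

lemma exists_hardyFactor_bounds : ∃ c C : ℝ, 0 < c ∧ 0 < C ∧ ∀ T : ℝ, 1 ≤ T →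
    (∀ t, hardyFactor T t ≤ C) ∧ ∀ t ∈ Ioc T (2 * T),
      c * T ^ (-(1 : ℝ) / 4) ≤ hardyFactor T t ∧ hardyFactor T t ≤ C * T ^ (-(1 : ℝ) / 4) := by
  obtain ⟨c, C, hc, hC, h⟩ := exists_norm_GammaR_half_bounds
  refine ⟨c * 3 ^ (-(1 : ℝ) / 4) * Real.exp (-1), C, by positivity, hC, fun T hT => ?_⟩
  have hT0 : 0 < T := by linarith
  have h1T : 1 / T ≤ 1 := by rw [div_le_one hT0]; exact hT
  have h1T0 : 0 < 1 / T := by positivity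
  have hup : ∀ t, hardyFactor T t ≤ C * (1 + |t|) ^ (-(1 : ℝ) / 4) := by
    intro t
    have h1 : Real.exp (-(Real.pi * |t| / 4)) * Real.exp ((Real.pi / 2 - 1 / T) * t / 2) ≤ 1 := by
      rw [← Real.exp_add, Real.exp_le_one_iff]
      have hpi := Real.pi_gt_three
      have : (Real.pi / 2 - 1 / T) * t ≤ (Real.pi / 2) * |t| := by
        rcases le_total 0 t with h0 | h0
        · rw [abs_of_nonneg h0]; nlinarith
        · rw [abs_of_nonpos h0]; nlinarith
      linarith
    have hp : 0 ≤ C * (1 + |t|) ^ (-(1 : ℝ) / 4) := by positivity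
    calc hardyFactor T t ≤ C * (1 + |t|) ^ (-(1 : ℝ) / 4) * Real.exp (-(Real.pi * |t| / 4)) *
          Real.exp ((Real.pi / 2 - 1 / T) * t / 2) := by
          unfold hardyFactor
          exact mul_le_mul_of_nonneg_right (h t).2 (Real.exp_pos _).le
      _ = C * (1 + |t|) ^ (-(1 : ℝ) / 4) * (Real.exp (-(Real.pi * |t| / 4)) *
          Real.exp ((Real.pi / 2 - 1 / T) * t / 2)) := by ring
      _ ≤ _ := mul_le_of_le_one_right hp h1
  refine ⟨fun t => (hup t).trans ?_, fun t ht => ⟨?_, (hup t).trans ?_⟩⟩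
  · refine mul_le_of_le_one_right hC.le ?_
    exact Real.rpow_le_one_of_one_le_of_nonpos (by linarith [abs_nonneg t]) (by norm_num)
  · have ht0 : 0 < t := hT0.trans ht.1
    have h1 : (3 * T) ^ (-(1 : ℝ) / 4) ≤ (1 + |t|) ^ (-(1 : ℝ) / 4) := by
      rw [abs_of_pos ht0]
      exact Real.rpow_le_rpow_of_nonpos (by linarith) (by linarith [ht.2]) (by norm_num)
    rw [Real.mul_rpow (by norm_num) hT0.le] at h1
    have h2 : Real.exp (-1) ≤ Real.exp (-(Real.pi * |t| / 4)) *
        Real.exp ((Real.pi / 2 - 1 / T) * t / 2) := by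
      rw [← Real.exp_add, abs_of_pos ht0]
      refine Real.exp_le_exp.2 ?_
      have : 1 / T * t ≤ 2 := by
        rw [one_div, inv_mul_le_iff₀ hT0]; linarith [ht.2]
      linarith
    calc c * 3 ^ (-(1 : ℝ) / 4) * Real.exp (-1) * T ^ (-(1 : ℝ) / 4)
        = c * (3 ^ (-(1 : ℝ) / 4) * T ^ (-(1 : ℝ) / 4)) * Real.exp (-1) := by ring
      _ ≤ c * (1 + |t|) ^ (-(1 : ℝ) / 4) * (Real.exp (-(Real.pi * |t| / 4)) *
        Real.exp ((Real.pi / 2 - 1 / T) * t / 2)) := by gcongr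
      _ = c * (1 + |t|) ^ (-(1 : ℝ) / 4) * Real.exp (-(Real.pi * |t| / 4)) *
        Real.exp ((Real.pi / 2 - 1 / T) * t / 2) := by ring
      _ ≤ _ := by
          unfold hardyFactor
          exact mul_le_mul_of_nonneg_right (h t).1 (Real.exp_pos _).le
  · have ht0 : 0 < t := hT0.trans ht.1
    refine mul_le_mul_of_nonneg_left ?_ hC.le
    refine Real.rpow_le_rpow_of_nonpos hT0 ?_ (by norm_num)
    rw [abs_of_pos ht0]; linarith [ht.1]

lemma exists_abs_hardyZ_le : ∃ C > 0, ∀ t : ℝ, |HardyZ t| ≤ C * (1 + |t|) := by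
  obtain ⟨C, hC, h⟩ := exists_norm_etaFun_le
  refine ⟨10 * C, by positivity, fun t => ?_⟩
  have h1 := h (1 / 2 + t * I) (by simp; norm_num)
  have h3 : 1 / 10 ≤ ‖etaFactor (1 / 2 + t * I)‖ := le_norm_etaFactor (by simp; norm_num)
  rw [etaFun_eq (half_line_ne t).2, norm_mul] at h1
  have h4 : ‖(1 / 2 + t * I : ℂ)‖ ≤ 1 + |t| := by
    refine (norm_add_le _ _).trans ?_
    rw [norm_mul, Complex.norm_I, Complex.norm_real, mul_one, Real.norm_eq_abs]
    norm_num
  rw [abs_hardyZ]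
  have h5 : 1 / 10 * ‖riemannZeta (1 / 2 + t * I)‖ ≤ C * (1 + |t|) :=
    calc _ ≤ ‖etaFactor (1 / 2 + t * I)‖ * ‖riemannZeta (1 / 2 + t * I)‖ := by gcongr
      _ ≤ _ := h1.trans (by gcongr)
  linarith

/-- Hardy's function, smoothed at the middle of `(T, 2T]`, has negligible tails. -/
lemma exists_tail_le : ∃ D : ℝ, 0 ≤ D ∧ ∀ᶠ T : ℝ in atTop, ∀ X : ℝ, 5 / 4 * T ≤ X → X ≤ 7 / 4 * T →
    ∫ t in (Ioc T (2 * T))ᶜ, |HardyZ t| * gaussWeight (width T) X t ≤ D := by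
  obtain ⟨C, hC, hZ⟩ := exists_abs_hardyZ_le
  obtain ⟨T₀, hT₀, htail⟩ := exists_gaussWeight_tail_le
  refine ⟨∫ t : ℝ, C * (1 + t ^ 2)⁻¹, integral_nonneg fun t => by positivity, ?_⟩
  filter_upwards [eventually_ge_atTop T₀] with T hT X hX1 hX2
  have hT0 : 0 < T := by linarith
  have hi : Integrable fun t : ℝ => C * (1 + t ^ 2)⁻¹ := integrable_inv_one_add_sq.const_mul C
  refine (integral_mono_of_nonneg (ae_of_all _ fun t => ?_) hi.integrableOn ?_).trans
    (setIntegral_le_integral hi (ae_of_all _ fun t => by positivity))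
  · exact mul_nonneg (abs_nonneg _) (gaussWeight_pos _ _ _).le
  · refine (ae_restrict_mem measurableSet_Ioc.compl).mono fun t ht => ?_
    have h1 : T / 4 ≤ |t - X| := by
      by_contra! h
      rw [abs_lt] at h
      exact ht ⟨by linarith [h.1], by linarith [h.2]⟩
    have h2 := htail T X t hT (by linarith) (by linarith) h1
    have h0 := abs_nonneg t
    have h3 : (1 + |t|) * ((1 + |t|) ^ 6)⁻¹ ≤ (1 + t ^ 2)⁻¹ := by
      rw [← div_eq_mul_inv, div_le_iff₀ (by positivity), inv_mul_eq_div, le_div_iff₀ (by positivity),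
        ← sq_abs t]
      have h4 : 1 + |t| ^ 2 ≤ (1 + |t|) ^ 5 := by
        have : (1 + |t|) ^ 2 ≤ (1 + |t|) ^ 5 := pow_le_pow_right₀ (by linarith) (by norm_num)
        nlinarith
      calc _ ≤ (1 + |t|) * (1 + |t|) ^ 5 := by gcongr
        _ = _ := by ring
    calc |HardyZ t| * gaussWeight (width T) X t ≤ C * (1 + |t|) * ((1 + |t|) ^ 6)⁻¹ := by
          exact mul_le_mul (hZ t) h2 (gaussWeight_pos _ _ _).le (by positivity)
      _ = C * ((1 + |t|) * ((1 + |t|) ^ 6)⁻¹) := by ring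
      _ ≤ _ := mul_le_mul_of_nonneg_left h3 hC.le

lemma integrable_abs_hardyZ_mul_gaussWeight {Δ : ℝ} (hΔ : 2 ≤ Δ) (X : ℝ) :
    Integrable fun t => |HardyZ t| * gaussWeight Δ X t := by
  simp_rw [abs_hardyZ]
  exact integrable_zetaMoment hΔ X

/-- Splitting `|Z| = Z + 2 Z₋` against a weight which is nearly constant on `s`. -/
lemma hardyNeg_moment_ge {Δ X T C c m : ℝ} {s : Set ℝ} (hs : MeasurableSet s) (hΔ : 2 ≤ Δ)
    (hC : ∀ t, hardyFactor T t ≤ C)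
    (hm : ∀ t ∈ s, c * m ≤ hardyFactor T t ∧ hardyFactor T t ≤ C * m) :
    c * m * (zetaMoment Δ X - ∫ t in sᶜ, |HardyZ t| * gaussWeight Δ X t) -
      |∫ t, HardyZ t * hardyWeight T Δ X t| - C * ∫ t in sᶜ, |HardyZ t| * gaussWeight Δ X t ≤
      2 * (C * m) * ∫ t in s, hardyNeg t * gaussWeight Δ X t := by
  have hi := integrable_abs_hardyZ_mul_gaussWeight hΔ X
  have hF0 := hardyFactor_nonneg T
  have hg0 : ∀ t, 0 ≤ gaussWeight Δ X t := fun t => (gaussWeight_pos Δ X t).le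
  have hgc := continuous_gaussWeight Δ X
  have hq : Integrable fun t => hardyNeg t * gaussWeight Δ X t :=
    hi.mono (continuous_hardyNeg.mul hgc).aestronglyMeasurable (ae_of_all _ fun t => by
      rw [Real.norm_of_nonneg (mul_nonneg (hardyNeg_nonneg t) (hg0 t)),
        Real.norm_of_nonneg (mul_nonneg (abs_nonneg _) (hg0 t))]
      exact mul_le_mul_of_nonneg_right (hardyNeg_le t) (hg0 t))
  have hAW : Integrable fun t => |HardyZ t| * hardyWeight T Δ X t := by
    refine (hi.const_mul C).mono ?_ (ae_of_all _ fun t => ?_)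
    · exact (continuous_hardyZ.abs.mul ((continuous_hardyFactor T).mul hgc)).aestronglyMeasurable
    · have h1 : |HardyZ t| * hardyWeight T Δ X t =
          hardyFactor T t * (|HardyZ t| * gaussWeight Δ X t) := by
        rw [hardyWeight, hardyFactor]; ring
      have h2 := mul_nonneg (abs_nonneg (HardyZ t)) (hg0 t)
      rw [h1, Real.norm_of_nonneg (mul_nonneg (hF0 t) h2)]
      exact (mul_le_mul_of_nonneg_right (hC t) h2).trans (Real.le_norm_self _)
  have hZW : Integrable fun t => HardyZ t * hardyWeight T Δ X t := by
    refine hAW.mono ?_ (ae_of_all _ fun t => ?_)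
    · exact (continuous_hardyZ.mul ((continuous_hardyFactor T).mul hgc)).aestronglyMeasurable
    · simp
  have hsplit := integral_add_compl hs hZW
  have hsplit2 : _ = zetaMoment Δ X := (integral_add_compl hs hi).trans (by
    simp_rw [zetaMoment, abs_hardyZ])
  have h1 : c * m * ∫ t in s, |HardyZ t| * gaussWeight Δ X t ≤
      ∫ t in s, |HardyZ t| * hardyWeight T Δ X t := by
    rw [← integral_const_mul]
    refine setIntegral_mono_on (hi.const_mul _).integrableOn hAW.integrableOn hs fun t ht => ?_
    have h2 := mul_le_mul_of_nonneg_right (hm t ht).1 (mul_nonneg (abs_nonneg (HardyZ t)) (hg0 t))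
    calc _ ≤ _ := h2
      _ = _ := by rw [hardyWeight, hardyFactor]; ring
  have h2 : |∫ t in sᶜ, HardyZ t * hardyWeight T Δ X t| ≤
      C * ∫ t in sᶜ, |HardyZ t| * gaussWeight Δ X t := by
    rw [← integral_const_mul]
    refine (abs_integral_le_integral_abs).trans ?_
    refine integral_mono hZW.abs.integrableOn (hi.const_mul _).integrableOn fun t => ?_
    change |HardyZ t * (hardyFactor T t * gaussWeight Δ X t)| ≤ _
    rw [abs_mul, abs_mul, abs_of_nonneg (hF0 t), abs_of_nonneg (hg0 t)]
    have := mul_le_mul_of_nonneg_right (hC t) (mul_nonneg (abs_nonneg (HardyZ t)) (hg0 t))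
    calc _ = hardyFactor T t * (|HardyZ t| * gaussWeight Δ X t) := by ring
      _ ≤ _ := this
  have h3 : (∫ t in s, |HardyZ t| * hardyWeight T Δ X t) - ∫ t in s, HardyZ t * hardyWeight T Δ X t
      ≤ 2 * (C * m) * ∫ t in s, hardyNeg t * gaussWeight Δ X t := by
    rw [← integral_sub hAW.integrableOn hZW.integrableOn, ← integral_const_mul]
    refine setIntegral_mono_on (hAW.sub hZW).integrableOn (hq.const_mul _).integrableOn hs
      fun t ht => ?_
    have h4 := mul_le_mul_of_nonneg_right (hm t ht).2 (mul_nonneg (hardyNeg_nonneg t) (hg0 t))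
    calc _ = 2 * (hardyFactor T t * (hardyNeg t * gaussWeight Δ X t)) := by
          rw [hardyWeight, hardyFactor, hardyNeg]; ring
      _ ≤ _ := by linarith
  have h5 := le_abs_self (∫ t, HardyZ t * hardyWeight T Δ X t)
  have h6 := neg_abs_le (∫ t in sᶜ, HardyZ t * hardyWeight T Δ X t)
  rw [← hsplit2, add_sub_cancel_right]
  linarith

lemma exists_hardyNeg_moment_ge : ∃ a : ℝ, 0 < a ∧ ∀ᶠ T : ℝ in atTop, ∀ X : ℝ,
    5 / 4 * T ≤ X → X ≤ 7 / 4 * T → a * (width T * Real.log T ^ ((1 : ℝ) / 4)) ≤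
      ∫ t in Ioc T (2 * T), hardyNeg t * gaussWeight (width T) X t := by
  obtain ⟨a, A, ha, hA, hbd⟩ := exists_zetaMoment_bounds
  obtain ⟨c, C, hc, hC, hF⟩ := exists_hardyFactor_bounds
  obtain ⟨K, hK, hZ⟩ := exists_abs_integral_hardyZ_le
  obtain ⟨D, hD, htail⟩ := exists_tail_le
  refine ⟨c * a / (4 * C), by positivity, ?_⟩
  have hlim : Tendsto (fun T : ℝ => T ^ ((1 : ℝ) / 40)) atTop atTop :=
    tendsto_rpow_atTop (by norm_num)
  filter_upwards [hbd, htail, eventually_params, eventually_ge_atTop 1,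
    hlim.eventually_ge_atTop (2 * (c * D + K + C * D) / (c * a)),
    Real.tendsto_log_atTop.eventually_ge_atTop 1] with T hbd htail hp hT hbig hlog X hX1 hX2
  have hT0 : 0 < T := by linarith
  obtain ⟨hF1, hF2⟩ := hF T hT
  have h := hardyNeg_moment_ge (X := X) (s := Ioc T (2 * T)) measurableSet_Ioc hp.1 hF1 hF2
  have hJ := (hbd X (by linarith) (by linarith)).1
  have ht := htail X hX1 hX2
  have hZ' := hZ (width T) T X hp.1 hT
  set Q := width T * Real.log T ^ ((1 : ℝ) / 4)
  set m := T ^ (-(1 : ℝ) / 4)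
  have hm0 : 0 < m := by positivity
  set S := ∫ t in Ioc T (2 * T), hardyNeg t * gaussWeight (width T) X t
  set E := ∫ t in (Ioc T (2 * T))ᶜ, |HardyZ t| * gaussWeight (width T) X t
  have e58 : T ^ ((5 : ℝ) / 8) = m * T ^ ((7 : ℝ) / 8) := by
    rw [← Real.rpow_add hT0]; norm_num
  have e1 : (1 : ℝ) ≤ T ^ ((5 : ℝ) / 8) := Real.one_le_rpow hT (by norm_num)
  have e2 : (1 : ℝ) ≤ T ^ ((7 : ℝ) / 8) := Real.one_le_rpow hT (by norm_num)
  have e3 : T ^ ((1 : ℝ) / 40) * T ^ ((7 : ℝ) / 8) ≤ Q := by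
    have h1 : T ^ ((1 : ℝ) / 40) * T ^ ((7 : ℝ) / 8) = width T := by
      rw [← Real.rpow_add hT0, width]; norm_num
    rw [h1]
    exact le_mul_of_one_le_right (width_pos hT0).le (Real.one_le_rpow hlog (by norm_num))
  have e4 : 2 * (c * D + K + C * D) * T ^ ((7 : ℝ) / 8) ≤ c * a * Q := by
    rw [div_le_iff₀ (by positivity)] at hbig
    calc _ ≤ T ^ ((1 : ℝ) / 40) * (c * a) * T ^ ((7 : ℝ) / 8) := by gcongr
      _ = c * a * (T ^ ((1 : ℝ) / 40) * T ^ ((7 : ℝ) / 8)) := by ring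
      _ ≤ _ := by gcongr
  have e5 : m * (c * a * Q / 2) ≤ m * (2 * C * S) := by
    have f1 : c * m * (a * Q - D) ≤ c * m * (zetaMoment (width T) X - E) := by gcongr
    have f2 : C * E ≤ C * D := by gcongr
    have f3 : C * D ≤ C * D * (m * T ^ ((7 : ℝ) / 8)) := by
      rw [← e58]; exact le_mul_of_one_le_right (by positivity) e1
    have f4 : c * m * D ≤ c * m * D * T ^ ((7 : ℝ) / 8) :=
      le_mul_of_one_le_right (by positivity) e2
    rw [e58] at hZ'
    have f5 := mul_le_mul_of_nonneg_left e4 hm0.le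
    nlinarith
  have e6 := le_of_mul_le_mul_left e5 hm0
  rw [div_mul_eq_mul_div, div_le_iff₀ (by positivity)]
  linarith

lemma integrableOn_setIntegral_Ioc {f : ℝ → ℝ → ℝ} (hf : Continuous (Function.uncurry f))
    (a b c d : ℝ) : IntegrableOn (fun x => ∫ t in Ioc c d, f x t) (Ioc a b) := by
  have h : IntegrableOn (Function.uncurry f) (Icc a b ×ˢ Icc c d) (volume.prod volume) :=
    hf.continuousOn.integrableOn_compact (isCompact_Icc.prod isCompact_Icc)
  have h2 := h.mono_set (prod_mono Ioc_subset_Icc_self Ioc_subset_Icc_self :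
    Ioc a b ×ˢ Ioc c d ⊆ Icc a b ×ˢ Icc c d)
  rw [IntegrableOn, ← Measure.prod_restrict] at h2
  exact h2.integral_prod_left

lemma continuous_uncurry_hardyNeg_mul (Δ : ℝ) :
    Continuous (Function.uncurry fun X t : ℝ => hardyNeg t * gaussWeight Δ X t) :=
  (continuous_hardyNeg.comp continuous_snd).mul (continuous_uncurry_gaussWeight Δ)

lemma integrableOn_hardyNeg_average (Δ a b c d : ℝ) :
    IntegrableOn (fun t => ∫ X in Ioc c d, hardyNeg t * gaussWeight Δ X t) (Ioc a b) := by
  refine integrableOn_setIntegral_Ioc (f := fun t X => hardyNeg t * gaussWeight Δ X t) ?_ a b c d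
  have h : Continuous fun p : ℝ × ℝ => gaussWeight Δ p.2 p.1 :=
    (continuous_uncurry_gaussWeight Δ).comp continuous_swap
  exact (continuous_hardyNeg.comp continuous_fst).mul h

lemma exists_neg_Iminus_ge : ∃ c : ℝ, 0 < c ∧ ∀ᶠ T : ℝ in atTop,
    c * T * Real.log T ^ ((1 : ℝ) / 4) ≤ -Iminus T := by
  obtain ⟨a, ha, h⟩ := exists_hardyNeg_moment_ge
  refine ⟨a / (2 * √Real.pi), by positivity, ?_⟩
  filter_upwards [h, eventually_ge_atTop 1] with T h hT
  have hT0 : 0 < T := by linarith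
  have hw := width_pos hT0
  have hcont := continuous_uncurry_hardyNeg_mul (width T)
  have hswap := setIntegral_Ioc_swap hcont (5 / 4 * T) (7 / 4 * T) T (2 * T)
  have h1 : a * (width T * Real.log T ^ ((1 : ℝ) / 4)) * (T / 2) ≤
      ∫ X in Ioc (5 / 4 * T) (7 / 4 * T), ∫ t in Ioc T (2 * T),
        hardyNeg t * gaussWeight (width T) X t := by
    have e : a * (width T * Real.log T ^ ((1 : ℝ) / 4)) * (T / 2) =
        ∫ _ in Ioc (5 / 4 * T) (7 / 4 * T), a * (width T * Real.log T ^ ((1 : ℝ) / 4)) := by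
      rw [setIntegral_const, smul_eq_mul, Real.volume_real_Ioc_of_le (by linarith)]
      ring
    rw [e]
    refine setIntegral_mono_on (integrableOn_const (by simp))
      (integrableOn_setIntegral_Ioc hcont _ _ _ _) measurableSet_Ioc fun X hX => h X hX.1.le hX.2
  have h2 : ∫ t in Ioc T (2 * T), ∫ X in Ioc (5 / 4 * T) (7 / 4 * T),
      hardyNeg t * gaussWeight (width T) X t ≤ √Real.pi * width T * -Iminus T := by
    rw [neg_Iminus_eq, ← integral_const_mul]
    refine setIntegral_mono_on (integrableOn_hardyNeg_average (width T) _ _ _ _)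
      ?_ measurableSet_Ioc fun t _ => ?_
    · exact (continuous_hardyNeg.const_mul _).integrableOn_Ioc
    · rw [integral_const_mul, mul_comm]
      exact mul_le_mul_of_nonneg_right (setIntegral_gaussWeight_centre_le hw _ _ t)
        (hardyNeg_nonneg t)
  rw [hswap] at h1
  have h3 := h1.trans h2
  have h4 : a * Real.log T ^ ((1 : ℝ) / 4) * T / 2 ≤ √Real.pi * -Iminus T := by
    refine le_of_mul_le_mul_left ?_ hw
    linarith
  rw [div_mul_eq_mul_div, div_mul_eq_mul_div, div_le_iff₀ (by positivity)]
  linarith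

lemma exists_neg_Iminus_le : ∃ c : ℝ, 0 < c ∧ ∀ᶠ T : ℝ in atTop,
    -Iminus T ≤ c * T * Real.log T ^ ((1 : ℝ) / 4) := by
  obtain ⟨a, A, ha, hA, h⟩ := exists_zetaMoment_bounds
  refine ⟨6 * A, by positivity, ?_⟩
  filter_upwards [h, eventually_params, eventually_ge_atTop 1] with T h hp hT
  have hT0 : 0 < T := by linarith
  have hw := width_pos hT0
  have hwT : width T ≤ T := by
    conv_rhs => rw [← Real.rpow_one T]
    exact Real.rpow_le_rpow_of_exponent_le hT (by norm_num)
  have hcont := continuous_uncurry_hardyNeg_mul (width T)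
  have hswap := setIntegral_Ioc_swap hcont T (2 * T) T (2 * T)
  have h1 : ∫ X in Ioc T (2 * T), ∫ t in Ioc T (2 * T), hardyNeg t * gaussWeight (width T) X t ≤
      A * (width T * Real.log T ^ ((1 : ℝ) / 4)) * T := by
    have e : A * (width T * Real.log T ^ ((1 : ℝ) / 4)) * T =
        ∫ _ in Ioc T (2 * T), A * (width T * Real.log T ^ ((1 : ℝ) / 4)) := by
      rw [setIntegral_const, smul_eq_mul, Real.volume_real_Ioc_of_le (by linarith)]
      ring
    rw [e]
    refine setIntegral_mono_on (integrableOn_setIntegral_Ioc hcont _ _ _ _)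
      (integrableOn_const (by simp)) measurableSet_Ioc
      fun X hX => le_trans ?_ (h X hX.1.le hX.2).2
    have hi := integrable_abs_hardyZ_mul_gaussWeight hp.1 X
    have hg0 : ∀ t, 0 ≤ gaussWeight (width T) X t := fun t => (gaussWeight_pos _ X t).le
    simp_rw [zetaMoment, ← abs_hardyZ]
    refine (integral_mono_of_nonneg (ae_of_all _ fun t => mul_nonneg (hardyNeg_nonneg t) (hg0 t))
      hi.integrableOn (ae_of_all _ fun t => ?_)).trans
      (setIntegral_le_integral hi (ae_of_all _ fun t => mul_nonneg (abs_nonneg _) (hg0 t)))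
    exact mul_le_mul_of_nonneg_right (hardyNeg_le t) (hg0 t)
  have h2 : width T / 6 * -Iminus T ≤ ∫ t in Ioc T (2 * T), ∫ X in Ioc T (2 * T),
      hardyNeg t * gaussWeight (width T) X t := by
    rw [neg_Iminus_eq, ← integral_const_mul]
    refine setIntegral_mono_on ?_ (integrableOn_hardyNeg_average (width T) _ _ _ _)
      measurableSet_Ioc fun t ht => ?_
    · exact (continuous_hardyNeg.const_mul _).integrableOn_Ioc
    · rw [integral_const_mul, mul_comm]
      exact mul_le_mul_of_nonneg_left (le_setIntegral_gaussWeight_centre hw hwT ht)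
        (hardyNeg_nonneg t)
  rw [hswap] at h1
  have h3 := h2.trans h1
  refine le_of_mul_le_mul_left ?_ hw
  linarith

end HardyMoment

theorem neg_Iminus_exact_order :
    ∃ c₁ c₂ T₀ : ℝ, 0 < c₁ ∧ c₁ ≤ c₂ ∧ ∀ T ≥ T₀,
      c₁ * T * (Real.log T) ^ ((1 : ℝ) / 4) ≤ -Iminus T ∧
        -Iminus T ≤ c₂ * T * (Real.log T) ^ ((1 : ℝ) / 4) := by
  obtain ⟨c₁, h₁, hc₁⟩ := HardyMoment.exists_neg_Iminus_ge
  obtain ⟨c₂, -, hc₂⟩ := HardyMoment.exists_neg_Iminus_le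
  obtain ⟨T₀, hT₀⟩ := Filter.eventually_atTop.1
    (hc₁.and (hc₂.and (Filter.eventually_ge_atTop 1)))
  refine ⟨c₁, max c₁ c₂, T₀, h₁, le_max_left _ _, fun T hT => ?_⟩
  obtain ⟨hl, hu, hT1⟩ := hT₀ T hT
  have hlog := Real.rpow_nonneg (Real.log_nonneg hT1) ((1 : ℝ) / 4)
  refine ⟨hl, hu.trans ?_⟩
  gcongr
  exact le_max_right _ _
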